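/- arXiv:math/0610193 — 3 statements merged into one kernel-verified Lean document; each statement's English description precedes it below -/
import Mathlib

section
/- Let n ≥ 9 and let k be an integer with 1 ≤ k ≤ ⌊n/2⌋. Then there exists a real constant a_k = n/k + α_k with |α_k| ≤ 10/n such that Q - 𝟙 ⊆ P_k - 𝟙 ⊆ a_k(Q - 𝟙); that is, every f ∈ Q belongs to P_k, and for every f ∈ P_k the function 𝟙 + (1/a_k)(f - 𝟙) belongs to Q. -/
open Finset
noncomputable section
open scoped Classical

/-- Index type for the coordinates of `ℝ^{n(n-1)/2}`: unordered pairs of distinct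
vertices of the complete graph `K_n` on `Fin n`. -/
abbrev EdgeIdx (n : ℕ) := {e : Sym2 (Fin n) // ¬ e.IsDiag}

/-- The incidence vector of the Hamiltonian cycle of `K_n` determined by a
permutation `σ` of the vertices. -/
def cycleVec (n : ℕ) (σ : Equiv.Perm (Fin n)) : EdgeIdx n → ℝ :=
  fun e => if ∃ i : Fin n, (e : Sym2 (Fin n)) = s(σ i, σ (finRotate n i)) then 1 else 0

/-- `X`, the (finite) set of incidence vectors of Hamiltonian cycles of `K_n`. -/
def hamX (n : ℕ) : Finset (EdgeIdx n → ℝ) := Finset.image (cycleVec n) Finset.univ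

/-- A function `f : X → ℝ` belongs to `P_k` iff it is the restriction to `X` of a
linear function `F` on `ℝ^{n(n-1)/2}` with average value `1` on `X` such that
`(1/|X|) Σ_{x∈X} F(x) h(x)² ≥ 0` for every polynomial `h` of degree at most `k`. -/
def memP (n k : ℕ) (F : (EdgeIdx n → ℝ) →ₗ[ℝ] ℝ) : Prop :=
  ((hamX n).card : ℝ)⁻¹ * ∑ x ∈ hamX n, F x = 1 ∧
  ∀ h : MvPolynomial (EdgeIdx n) ℝ, h.totalDegree ≤ k →
    0 ≤ ((hamX n).card : ℝ)⁻¹ * ∑ x ∈ hamX n, F x * (MvPolynomial.eval x h) ^ 2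

/-- A function `f : X → ℝ` belongs to `Q` iff it is the restriction to `X` of a
linear function on `ℝ^{n(n-1)/2}`, is nonnegative on `X`, and has average value `1`. -/
def memQ (n : ℕ) (F : (EdgeIdx n → ℝ) →ₗ[ℝ] ℝ) : Prop :=
  ((hamX n).card : ℝ)⁻¹ * ∑ x ∈ hamX n, F x = 1 ∧ ∀ x ∈ hamX n, 0 ≤ F x

section FullCycles

variable {V : Type*}

/-- A permutation is a full cycle when no proper nonempty set of points is invariant. -/
def IsFullCycle (π : Equiv.Perm V) : Prop :=
  ∀ A : Set V, (∀ x, x ∈ A ↔ π x ∈ A) → ∀ x y, x ∈ A → y ∈ A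

lemma IsFullCycle.inv {π : Equiv.Perm V} (h : IsFullCycle π) : IsFullCycle π⁻¹ := by
  intro A hA x y hx
  refine h A (fun z => ?_) x y hx
  have := hA (π z)
  simpa using this.symm

lemma IsFullCycle.conj {π : Equiv.Perm V} (h : IsFullCycle π) (τ : Equiv.Perm V) :
    IsFullCycle (τ * π * τ⁻¹) := by
  intro A hA x y hx
  have := h (τ ⁻¹' A) (fun z => by simpa using hA (τ z)) (τ⁻¹ x) (τ⁻¹ y) (by simpa using hx)
  simpa using this

lemma IsFullCycle.apply_ne [Nontrivial V] {π : Equiv.Perm V} (h : IsFullCycle π) (u : V) :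
    π u ≠ u := by
  intro hu
  obtain ⟨w, hw⟩ := exists_ne u
  have := h {u} (fun x => by
    simp only [Set.mem_singleton_iff]
    exact ⟨fun hx => by rw [hx, hu], fun hx => π.injective (by rw [hx, hu])⟩) u w rfl
  exact hw this

lemma IsFullCycle.apply_apply_ne [Fintype V] (hV : 3 ≤ Fintype.card V) {π : Equiv.Perm V}
    (h : IsFullCycle π) (u : V) : π (π u) ≠ u := by
  intro hu
  obtain ⟨w, hw⟩ : ∃ w, w ∉ ({u, π u} : Finset V) := by
    by_contra! hall
    have hle : Fintype.card V ≤ #({u, π u} : Finset V) :=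
      Finset.card_le_card (fun w _ => hall w)
    have := Finset.card_le_two (a := u) (b := π u)
    omega
  have := h {u, π u} (fun x => by
    simp only [Set.mem_insert_iff, Set.mem_singleton_iff]
    constructor
    · rintro (rfl | rfl)
      · exact Or.inr rfl
      · exact Or.inl hu
    · rintro (hx | hx)
      · exact Or.inr (π.injective (by rw [hx, hu]))
      · exact Or.inl (π.injective hx)) u w (by simp)
  simp at this hw
  tauto

/-- Exchanging the point `w` with the block `a, b` in a full cycle gives a full cycle. -/
lemma IsFullCycle.exchange {π : Equiv.Perm V} (h : IsFullCycle π) {a b w : V}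
    (hab : π a = b) (hne : a ≠ b) (hwa : w ≠ a) (hwb : w ≠ b) :
    IsFullCycle (Equiv.swap w a * π * Equiv.swap w b) := by
  intro A hA
  set π' := Equiv.swap w a * π * Equiv.swap w b with hπ'
  have hπ'a : π' a = b := by
    simp only [hπ', Equiv.Perm.mul_apply]
    rw [Equiv.swap_apply_of_ne_of_ne hwa.symm hne, hab,
      Equiv.swap_apply_of_ne_of_ne hwb.symm hne.symm]
  have hπ : ∀ x, π x = Equiv.swap w a (π' (Equiv.swap w b x)) := by
    intro x; simp [hπ', Equiv.Perm.mul_apply]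
  have hbA : a ∈ A ↔ b ∈ A := by rw [hA a, hπ'a]
  let φ : V → V := fun x => if x = a ∨ x = b then w else if x = w then a else x
  have hz : ∀ z, z ≠ b → φ (Equiv.swap w a z) = z := by
    intro z hzb
    simp only [φ, Equiv.swap_apply_def]
    grind
  have hinv : ∀ x, φ x ∈ A ↔ φ (π x) ∈ A := by
    intro x
    by_cases hxa : x = a
    · subst hxa; simp [φ, hab]
    have hy : Equiv.swap w b x ≠ a := by
      simp only [Equiv.swap_apply_def]; grind
    have hne' : π' (Equiv.swap w b x) ≠ b := fun hc => hy (π'.injective (hc.trans hπ'a.symm))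
    rw [hπ x, hz _ hne', ← hA]
    simp only [φ, Equiv.swap_apply_def]
    grind
  have key := h (φ ⁻¹' A) hinv
  have hsurj : ∀ x, x ≠ b → ∃ y, φ y = x := fun x hx => ⟨_, hz x hx⟩
  have hmem : ∀ x, ∃ y, (φ y ∈ A ↔ x ∈ A) := by
    intro x
    by_cases hx : x = b
    · obtain ⟨y, hy⟩ := hsurj a hne
      exact ⟨y, by rw [hy, hx, hbA]⟩
    · obtain ⟨y, hy⟩ := hsurj x hx
      exact ⟨y, by rw [hy]⟩
  intro x y hx
  obtain ⟨x', hx'⟩ := hmem x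
  obtain ⟨y', hy'⟩ := hmem y
  exact hy'.1 (key x' y' (hx'.2 hx))

lemma swap_comm_involution {ε : V → V} (hε : ∀ v, ε (ε v) = v) (a v : V) :
    Equiv.swap a (ε a) (ε v) = ε (Equiv.swap a (ε a) v) := by
  simp only [Equiv.swap_apply_def]
  grind

variable [Fintype V]

/-- The full cycles containing, in one of the two directions, every edge `{v, ε v}` with
`ε v ≠ v`. -/
def cyclesThrough (ε : V → V) : Finset (Equiv.Perm V) :=
  univ.filter fun π => IsFullCycle π ∧ ∀ v, ε v ≠ v → π v = ε v ∨ π (ε v) = v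

/-- The number of cycles through `ε` that use the arc from `u` to `w`. -/
def arcCount (ε : V → V) (u w : V) : ℕ := #((cyclesThrough ε).filter fun π => π u = w)

/-- The weight of a vertex: `1` off the matching `ε`, `1/2` on it. -/
def matchWeight (ε : V → V) (v : V) : ℝ := if ε v = v then 1 else 1 / 2

lemma mem_cyclesThrough {ε : V → V} {π : Equiv.Perm V} :
    π ∈ cyclesThrough ε ↔ IsFullCycle π ∧ ∀ v, ε v ≠ v → π v = ε v ∨ π (ε v) = v := by
  simp [cyclesThrough]

lemma cyclesThrough_conj {ε : V → V} {τ : Equiv.Perm V} (hτ : ∀ v, τ (ε v) = ε (τ v))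
    {π : Equiv.Perm V} (h : π ∈ cyclesThrough ε) : τ * π * τ⁻¹ ∈ cyclesThrough ε := by
  rw [mem_cyclesThrough] at h ⊢
  refine ⟨h.1.conj τ, fun v hv => ?_⟩
  obtain ⟨v, rfl⟩ := τ.surjective v
  rw [← hτ] at hv ⊢
  have := h.2 v (fun hc => hv (by rw [hc]))
  simpa using this

lemma arcCount_conj_le {ε : V → V} {τ : Equiv.Perm V} (hτ : ∀ v, τ (ε v) = ε (τ v)) (u w : V) :
    arcCount ε u w ≤ arcCount ε (τ u) (τ w) := by
  refine Finset.card_le_card_of_injOn (fun π => τ * π * τ⁻¹) (fun π hπ => ?_) ?_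
  · simp only [coe_filter, Set.mem_ofPred_eq] at hπ ⊢
    exact ⟨cyclesThrough_conj hτ hπ.1, by simp [hπ.2]⟩
  · intro π _ π' _ h
    simpa using h

lemma arcCount_conj {ε : V → V} {τ : Equiv.Perm V} (hτ : ∀ v, τ (ε v) = ε (τ v)) (u w : V) :
    arcCount ε (τ u) (τ w) = arcCount ε u w := by
  refine le_antisymm ?_ (arcCount_conj_le hτ u w)
  have hτ' : ∀ v, τ⁻¹ (ε v) = ε (τ⁻¹ v) := by
    intro v
    obtain ⟨v, rfl⟩ := τ.surjective v
    rw [← hτ]; simp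
  simpa using arcCount_conj_le hτ' (τ u) (τ w)

lemma arcCount_comm (ε : V → V) (u w : V) : arcCount ε u w = arcCount ε w u := by
  have key : ∀ u w, arcCount ε u w ≤ arcCount ε w u := by
    intro u w
    refine Finset.card_le_card_of_injOn (fun π => π⁻¹) (fun π hπ => ?_) ?_
    · simp only [coe_filter, Set.mem_ofPred_eq, mem_cyclesThrough] at hπ ⊢
      refine ⟨⟨hπ.1.1.inv, fun v hv => ?_⟩, by rw [← hπ.2]; simp⟩
      rcases hπ.1.2 v hv with h | h
      · right; rw [← h]; simp
      · left; rw [Equiv.Perm.inv_eq_iff_eq]; exact h.symm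
    · intro π _ π' _ h
      simpa using h
  exact le_antisymm (key u w) (key w u)

/-- A cycle through `ε` traverses each matched edge in exactly one direction, and the two
directions are equally likely. -/
lemma card_cyclesThrough_eq_two_mul (hV : 3 ≤ Fintype.card V) {ε : V → V}
    {a : V} (ha : ε a ≠ a) :
    #(cyclesThrough ε) = 2 * arcCount ε a (ε a) := by
  have hsum := Finset.card_filter_add_card_filter_not (s := cyclesThrough ε) (fun π => π a = ε a)
  have hnot : (cyclesThrough ε).filter (fun π => ¬ π a = ε a) =
      (cyclesThrough ε).filter (fun π => π (ε a) = a) := by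
    refine Finset.filter_congr fun π hπ => ?_
    rw [mem_cyclesThrough] at hπ
    have h1 := hπ.2 a ha
    have h2 := hπ.1.apply_apply_ne hV a
    constructor
    · tauto
    · intro h h'; rw [h'] at h2; exact h2 h
  rw [hnot] at hsum
  change arcCount ε a (ε a) + arcCount ε (ε a) a = _ at hsum
  rw [arcCount_comm ε (ε a) a] at hsum
  omega

lemma arcCount_eq_two_mul (hV : 3 ≤ Fintype.card V) {ε : V → V} (hε : ∀ v, ε (ε v) = v)
    {u w a : V} (hw : ε w = w) (ha : ε a ≠ a) (huw : u ≠ w) (hua : u ≠ a) (huεa : u ≠ ε a) :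
    arcCount ε u w = 2 * arcCount ε u a := by
  set b := ε a with hb
  have hεb : ε b = a := hε a
  have hwa : w ≠ a := by rintro rfl; exact ha hw
  have hwb : w ≠ b := by rintro h; rw [h, hεb] at hw; exact ha hw.symm
  have hsum := Finset.card_filter_add_card_filter_not
    (s := (cyclesThrough ε).filter fun π => π u = w) (fun π => π a = b)
  rw [Finset.filter_filter, Finset.filter_filter] at hsum
  change _ = arcCount ε u w at hsum
  have hflip : #((cyclesThrough ε).filter fun π => π u = w ∧ ¬ π a = b) =
      #((cyclesThrough ε).filter fun π => π u = w ∧ π a = b) := by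
    have hτ := swap_comm_involution hε a
    rw [← hb] at hτ
    have hτu : Equiv.swap a b u = u := Equiv.swap_apply_of_ne_of_ne hua huεa
    have hτw : Equiv.swap a b w = w := Equiv.swap_apply_of_ne_of_ne hwa hwb
    refine Finset.card_nbij' (fun π => Equiv.swap a b * π * (Equiv.swap a b)⁻¹)
      (fun π => Equiv.swap a b * π * (Equiv.swap a b)⁻¹) ?_ ?_ ?_ ?_
    · intro π hπ
      simp only [coe_filter, Set.mem_ofPred_eq] at hπ ⊢
      refine ⟨cyclesThrough_conj hτ hπ.1, by simp [hτu, hτw, hπ.2.1], ?_⟩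
      have := ((mem_cyclesThrough.1 hπ.1).2 a ha).resolve_left hπ.2.2
      rw [← hb] at this
      simp [this]
    · intro π hπ
      simp only [coe_filter, Set.mem_ofPred_eq] at hπ ⊢
      refine ⟨cyclesThrough_conj hτ hπ.1, by simp [hτu, hτw, hπ.2.1], ?_⟩
      have := (mem_cyclesThrough.1 hπ.1).1.apply_apply_ne hV a
      rw [hπ.2.2] at this
      simpa [Equiv.swap_apply_eq_iff] using this
    · intro π _; ext x; simp
    · intro π _; ext x; simp
  have hexch : #((cyclesThrough ε).filter fun π => π u = w ∧ π a = b) = arcCount ε u a := by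
    have hpres : ∀ π ∈ cyclesThrough ε, π a = b →
        Equiv.swap w a * π * Equiv.swap w b ∈ cyclesThrough ε ∧
        (Equiv.swap w a * π * Equiv.swap w b) a = b := by
      intro π hπ hab
      rw [mem_cyclesThrough] at hπ
      have h1 : (Equiv.swap w a * π * Equiv.swap w b) a = b := by
        simp only [Equiv.Perm.mul_apply]
        rw [Equiv.swap_apply_of_ne_of_ne hwa.symm (Ne.symm ha), hab,
          Equiv.swap_apply_of_ne_of_ne hwb.symm ha]
      refine ⟨mem_cyclesThrough.2 ⟨hπ.1.exchange hab (Ne.symm ha) hwa hwb, fun v hv => ?_⟩, h1⟩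
      by_cases hva : v = a
      · left; rw [hva]; exact h1
      by_cases hvb : v = b
      · right; rw [hvb, hεb]; exact h1
      have hvw : v ≠ w := by rintro rfl; exact hv hw
      have h2 : ε v ≠ a := fun h => hvb (by rw [← hε v, h])
      have h3 : ε v ≠ b := fun h => hva (by rw [← hε v, h, hεb])
      have h4 : ε v ≠ w := fun h => hvw (by rw [← hε v, h, hw])
      simp only [Equiv.Perm.mul_apply]
      rw [Equiv.swap_apply_of_ne_of_ne hvw hvb, Equiv.swap_apply_of_ne_of_ne h4 h3]
      rcases hπ.2 v hv with h | h
      · left; rw [h, Equiv.swap_apply_of_ne_of_ne h4 h2]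
      · right; rw [h, Equiv.swap_apply_of_ne_of_ne hvw hva]
    refine Finset.card_nbij' (fun π => Equiv.swap w a * π * Equiv.swap w b)
      (fun π => Equiv.swap w a * π * Equiv.swap w b) ?_ ?_ ?_ ?_
    · intro π hπ
      simp only [coe_filter, Set.mem_ofPred_eq] at hπ ⊢
      refine ⟨(hpres π hπ.1 hπ.2.2).1, ?_⟩
      simp [Equiv.swap_apply_of_ne_of_ne huw huεa, hπ.2.1]
    · intro π hπ
      simp only [coe_filter, Set.mem_ofPred_eq] at hπ ⊢
      have hab : π a = b := ((mem_cyclesThrough.1 hπ.1).2 a ha).resolve_right fun h =>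
        huεa (π.injective (hπ.2.trans h.symm))
      refine ⟨(hpres π hπ.1 hab).1, ?_, (hpres π hπ.1 hab).2⟩
      simp [Equiv.swap_apply_of_ne_of_ne huw huεa, hπ.2]
    · intro π _; ext x; simp
    · intro π _; ext x; simp
  omega

lemma arcCount_mul_matchWeight (hV : 3 ≤ Fintype.card V) {ε : V → V} (hε : ∀ v, ε (ε v) = v)
    {u w w' : V} (hw : w ≠ u) (hw2 : w ≠ ε u) (hw' : w' ≠ u) (hw2' : w' ≠ ε u) :
    (arcCount ε u w : ℝ) * matchWeight ε w' = arcCount ε u w' * matchWeight ε w := by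
  have hεw : ε w ≠ u := fun h => hw2 (by rw [← h, hε])
  have hεw' : ε w' ≠ u := fun h => hw2' (by rw [← h, hε])
  by_cases h1 : ε w = w <;> by_cases h2 : ε w' = w'
  · have hτ : ∀ v, Equiv.swap w w' (ε v) = ε (Equiv.swap w w' v) := by
      intro v; simp only [Equiv.swap_apply_def]; grind
    have := arcCount_conj hτ u w
    rw [Equiv.swap_apply_of_ne_of_ne hw.symm hw'.symm, Equiv.swap_apply_left] at this
    simp [matchWeight, h1, h2, this]
  · have := arcCount_eq_two_mul hV hε h1 h2 hw.symm hw'.symm hεw'.symm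
    simp [matchWeight, h1, h2, this]; ring
  · have := arcCount_eq_two_mul hV hε h2 h1 hw'.symm hw.symm hεw.symm
    simp [matchWeight, h1, h2, this]; ring
  · have heq : arcCount ε u w = arcCount ε u w' := by
      by_cases h3 : w' = ε w
      · have := arcCount_conj (swap_comm_involution hε w) u w
        rw [Equiv.swap_apply_of_ne_of_ne hw.symm hεw.symm, Equiv.swap_apply_left] at this
        rw [h3, this]
      · by_cases h4 : w = w'
        · rw [h4]
        have hτ : ∀ v, (Equiv.swap w w' * Equiv.swap (ε w) (ε w')) (ε v) =
            ε ((Equiv.swap w w' * Equiv.swap (ε w) (ε w')) v) := by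
          intro v; simp only [Equiv.Perm.mul_apply, Equiv.swap_apply_def]; grind
        have := arcCount_conj hτ u w
        have hu : (Equiv.swap w w' * Equiv.swap (ε w) (ε w')) u = u := by
          simp only [Equiv.Perm.mul_apply]
          rw [Equiv.swap_apply_of_ne_of_ne hεw.symm hεw'.symm,
            Equiv.swap_apply_of_ne_of_ne hw.symm hw'.symm]
        have hw3 : (Equiv.swap w w' * Equiv.swap (ε w) (ε w')) w = w' := by
          simp only [Equiv.Perm.mul_apply, Equiv.swap_apply_def]; grind
        rw [hu, hw3] at this
        exact this.symm
    simp [matchWeight, h1, h2, heq]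

lemma arcCount_self [Nontrivial V] (ε : V → V) (u : V) : arcCount ε u u = 0 := by
  rw [arcCount, Finset.card_eq_zero, Finset.filter_eq_empty_iff]
  intro π hπ
  exact (mem_cyclesThrough.1 hπ).1.apply_ne u

lemma sum_arcCount (ε : V → V) (u : V) : ∑ w, arcCount ε u w = #(cyclesThrough ε) := by
  rw [Finset.card_eq_sum_card_fiberwise (f := fun π : Equiv.Perm V => π u) (t := univ)
    (fun _ _ => by simp)]
  rfl

lemma arcCount_involution (hV : 3 ≤ Fintype.card V) (ε : V → V) (u : V) :
    (arcCount ε u (ε u) : ℝ) = #(cyclesThrough ε) * (1 - matchWeight ε u) := by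
  have : Nontrivial V := Fintype.one_lt_card_iff_nontrivial.1 (by omega)
  by_cases hu : ε u = u
  · simp [matchWeight, hu, arcCount_self]
  · rw [card_cyclesThrough_eq_two_mul hV hu]
    simp only [matchWeight, hu]; push_cast; norm_num; ring

/-- The number of cycles through a matching that use a given arc. -/
lemma arcCount_mul_eq (hV : 3 ≤ Fintype.card V) {ε : V → V} (hε : ∀ v, ε (ε v) = v)
    {u w : V} (hw : w ≠ u) (hw2 : w ≠ ε u) :
    (arcCount ε u w : ℝ) * (∑ v, matchWeight ε v - 1) =
      #(cyclesThrough ε) * (matchWeight ε u * matchWeight ε w) := by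
  have : Nontrivial V := Fintype.one_lt_card_iff_nontrivial.1 (by omega)
  have hsum : (∑ v, (arcCount ε u v : ℝ)) = #(cyclesThrough ε) := by
    exact_mod_cast sum_arcCount ε u
  have hεu := arcCount_involution hV ε u
  have hterm : ∀ v, (arcCount ε u v : ℝ) * matchWeight ε w = arcCount ε u w * matchWeight ε v
      - (if v = u then arcCount ε u w * matchWeight ε u else 0)
      + (if v = ε u then (if ε u = u then 0 else - (arcCount ε u w * matchWeight ε u))
          + #(cyclesThrough ε) * (1 - matchWeight ε u) * matchWeight ε w else 0) := by
    intro v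
    by_cases hvε : v = ε u
    · have hm : matchWeight ε (ε u) = matchWeight ε u := by
        simp only [matchWeight, hε]
        simp [eq_comm]
      subst hvε
      by_cases hu : ε u = u
      · simp [hu, matchWeight, arcCount_self]
      · simp [hu, hεu, hm]
    · by_cases hvu : v = u
      · subst hvu
        simp [hvε, arcCount_self]
      · simp [hvε, hvu, arcCount_mul_matchWeight hV hε hvu hvε hw hw2]
  have htot := Finset.sum_congr rfl (fun v (_ : v ∈ univ) => hterm v)
  rw [← Finset.sum_mul, hsum, Finset.sum_add_distrib, Finset.sum_sub_distrib, ← Finset.mul_sum]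
    at htot
  simp only [Finset.sum_ite_eq', Finset.mem_univ, if_true] at htot
  by_cases hu : ε u = u
  · simp only [matchWeight, hu, if_true] at htot ⊢
    linarith
  · simp only [matchWeight, hu, if_false] at htot ⊢
    linarith

end FullCycles

section HamiltonianCycles

variable {n : ℕ}

/-- The incidence vector of the set of edges `{v, π v}`. -/
def permVec (π : Equiv.Perm (Fin n)) : EdgeIdx n → ℝ :=
  fun e => if ∃ v : Fin n, (e : Sym2 (Fin n)) = s(v, π v) then 1 else 0

lemma cycleVec_eq_permVec (σ : Equiv.Perm (Fin n)) :
    cycleVec n σ = permVec (σ * finRotate n * σ⁻¹) := by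
  funext e
  simp only [cycleVec, permVec]
  congr 1
  rw [eq_iff_iff]
  constructor
  · rintro ⟨i, hi⟩; exact ⟨σ i, by simpa using hi⟩
  · rintro ⟨v, hv⟩; exact ⟨σ⁻¹ v, by simpa using hv⟩

lemma permVec_mk (π : Equiv.Perm (Fin n)) {u w : Fin n} (h : ¬ (s(u, w) : Sym2 (Fin n)).IsDiag) :
    permVec π ⟨s(u, w), h⟩ = if π u = w ∨ π w = u then 1 else 0 := by
  simp only [permVec]
  congr 1
  rw [eq_iff_iff]
  constructor
  · rintro ⟨v, hv⟩
    rw [Sym2.eq_iff] at hv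
    rcases hv with ⟨rfl, rfl⟩ | ⟨rfl, rfl⟩ <;> simp
  · rintro (h | h)
    · exact ⟨u, by rw [h]⟩
    · exact ⟨w, by rw [h, Sym2.eq_swap]⟩

lemma isFullCycle_iff_isCycle (hn : 2 ≤ n) (π : Equiv.Perm (Fin n)) :
    IsFullCycle π ↔ π.IsCycle ∧ π.support = univ := by
  have : Nontrivial (Fin n) := Fin.nontrivial_iff_two_le.2 hn
  constructor
  · intro h
    have hsame : ∀ x y, π.SameCycle x y := fun x y =>
      h {y | π.SameCycle x y} (fun z => by simp) x y (by simp [Equiv.Perm.SameCycle.refl])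
    refine ⟨?_, ?_⟩
    · obtain ⟨x, -⟩ := exists_pair_ne (Fin n)
      exact ⟨x, h.apply_ne x, fun y _ => hsame x y⟩
    · ext x; simpa using h.apply_ne x
  · rintro ⟨hc, hs⟩ A hA x y hx
    have hne : ∀ z, π z ≠ z := fun z => by
      rw [← Equiv.Perm.mem_support, hs]; simp
    obtain ⟨i, rfl⟩ := hc.exists_zpow_eq (hne x) (hne y)
    have hpow : ∀ m : ℕ, ∀ z, z ∈ A ↔ (π ^ m) z ∈ A := by
      intro m
      induction m with
      | zero => simp
      | succ m ih =>
        intro z; rw [ih z, hA, pow_succ', Equiv.Perm.mul_apply]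
    cases i with
    | ofNat m => exact (hpow m x).1 hx
    | negSucc m =>
      rw [hpow (m + 1), zpow_negSucc]
      simpa using hx

lemma isFullCycle_iff_exists_conj (hn : 2 ≤ n) (π : Equiv.Perm (Fin n)) :
    IsFullCycle π ↔ ∃ σ : Equiv.Perm (Fin n), π = σ * finRotate n * σ⁻¹ := by
  have hrot : IsFullCycle (finRotate n) :=
    (isFullCycle_iff_isCycle hn _).2 ⟨isCycle_finRotate_of_le hn, support_finRotate_of_le hn⟩
  constructor
  · intro h
    have h1 := (isFullCycle_iff_isCycle hn _).1 h
    have h2 := (isFullCycle_iff_isCycle hn _).1 hrot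
    have := h2.1.isConj h1.1 (by rw [h1.2, h2.2])
    obtain ⟨σ, hσ⟩ := isConj_iff.1 this
    exact ⟨σ, hσ.symm⟩
  · rintro ⟨σ, rfl⟩
    exact hrot.conj σ

lemma permVec_conj_eq {π π' : Equiv.Perm (Fin n)} (h : permVec π = permVec π')
    (τ : Equiv.Perm (Fin n)) : permVec (τ * π * τ⁻¹) = permVec (τ * π' * τ⁻¹) := by
  funext ⟨e, he⟩
  induction e using Sym2.ind with
  | _ u w =>
    rw [permVec_mk, permVec_mk]
    have hne : ¬ (s(τ⁻¹ u, τ⁻¹ w) : Sym2 (Fin n)).IsDiag := by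
      simpa using he
    have := congrFun h ⟨_, hne⟩
    rw [permVec_mk, permVec_mk] at this
    have e1 : ∀ (ρ : Equiv.Perm (Fin n)) (x y : Fin n), (τ * ρ * τ⁻¹) x = y ↔ ρ (τ⁻¹ x) = τ⁻¹ y :=
      fun ρ x y => by
        rw [Equiv.Perm.mul_apply, Equiv.Perm.mul_apply, Equiv.Perm.eq_inv_iff_eq]
    simp only [e1]
    exact this

lemma mem_cyclesThrough_id {π : Equiv.Perm (Fin n)} :
    π ∈ cyclesThrough (id : Fin n → Fin n) ↔ IsFullCycle π := by
  simp [mem_cyclesThrough]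

lemma image_permVec_cyclesThrough_id (hn : 2 ≤ n) :
    (cyclesThrough (id : Fin n → Fin n)).image permVec = hamX n := by
  ext x
  simp only [hamX, Finset.mem_image, mem_cyclesThrough_id, Finset.mem_univ, true_and,
    isFullCycle_iff_exists_conj hn]
  constructor
  · rintro ⟨π, ⟨σ, rfl⟩, rfl⟩
    exact ⟨σ, cycleVec_eq_permVec σ⟩
  · rintro ⟨σ, rfl⟩
    exact ⟨_, ⟨σ, rfl⟩, (cycleVec_eq_permVec σ).symm⟩

/-- Each Hamiltonian cycle is represented by the same number of full cycles. -/
lemma exists_sum_permVec_eq (hn : 2 ≤ n) :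
    ∃ c : ℝ, 0 < c ∧ ∀ φ : (EdgeIdx n → ℝ) → ℝ,
      ∑ π ∈ cyclesThrough (id : Fin n → Fin n), φ (permVec π) = c * ∑ x ∈ hamX n, φ x := by
  set Z := cyclesThrough (id : Fin n → Fin n) with hZ
  have hle : ∀ π ∈ Z, ∀ π' ∈ Z, #(Z.filter fun ρ => permVec ρ = permVec π) ≤
      #(Z.filter fun ρ => permVec ρ = permVec π') := by
    intro π hπ π' hπ'
    rw [mem_cyclesThrough_id] at hπ hπ'
    obtain ⟨σ, rfl⟩ := (isFullCycle_iff_exists_conj hn π).1 hπ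
    obtain ⟨σ', rfl⟩ := (isFullCycle_iff_exists_conj hn π').1 hπ'
    refine Finset.card_le_card_of_injOn (fun ρ => (σ' * σ⁻¹) * ρ * (σ' * σ⁻¹)⁻¹) ?_ ?_
    · intro ρ hρ
      simp only [coe_filter, Set.mem_ofPred_eq, hZ, mem_cyclesThrough_id] at hρ ⊢
      refine ⟨hρ.1.conj _, ?_⟩
      rw [permVec_conj_eq hρ.2]
      congr 1
      group
    · intro ρ _ ρ' _ h
      simpa using h
  obtain ⟨π₀, hπ₀⟩ : ∃ π, IsFullCycle π :=
    ⟨_, (isFullCycle_iff_exists_conj hn _).2 ⟨(1 : Equiv.Perm (Fin n)), rfl⟩⟩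
  have hπ₀ : π₀ ∈ Z := mem_cyclesThrough_id.2 hπ₀
  refine ⟨(#(Z.filter fun ρ => permVec ρ = permVec π₀) : ℝ), ?_, fun φ => ?_⟩
  · exact_mod_cast Finset.card_pos.2 ⟨π₀, by simp [hπ₀]⟩
  · rw [← image_permVec_cyclesThrough_id hn, ← hZ,
      ← Finset.sum_fiberwise_of_maps_to (fun π hπ => Finset.mem_image_of_mem permVec hπ),
      Finset.mul_sum]
    refine Finset.sum_congr rfl fun x hx => ?_
    obtain ⟨π, hπ, rfl⟩ := Finset.mem_image.1 hx
    rw [Finset.sum_congr rfl (g := fun _ => φ (permVec π))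
      (fun ρ hρ => by rw [(Finset.mem_filter.1 hρ).2]), Finset.sum_const, nsmul_eq_mul,
      le_antisymm (hle π hπ π₀ hπ₀) (hle π₀ hπ₀ π hπ)]

/-- The mean incidence vector of the cycles through a matching. -/
def meanVec (ε : Fin n → Fin n) : EdgeIdx n → ℝ :=
  fun e => (#(cyclesThrough ε) : ℝ)⁻¹ * ∑ π ∈ cyclesThrough ε, permVec π e

lemma sum_permVec_mk (hn : 3 ≤ n) (ε : Fin n → Fin n) {u w : Fin n}
    (h : ¬ (s(u, w) : Sym2 (Fin n)).IsDiag) :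
    ∑ π ∈ cyclesThrough ε, permVec π ⟨s(u, w), h⟩ = 2 * arcCount ε u w := by
  have hterm : ∀ π ∈ cyclesThrough ε, permVec π ⟨s(u, w), h⟩ =
      (if π u = w then 1 else 0) + (if π w = u then 1 else 0) := by
    intro π hπ
    have := (mem_cyclesThrough.1 hπ).1.apply_apply_ne (by simpa using hn) u
    rw [permVec_mk]
    by_cases h1 : π u = w <;> by_cases h2 : π w = u <;> simp_all
  have hcount : ∀ x y : Fin n,
      ∑ π ∈ cyclesThrough ε, (if π x = y then (1 : ℝ) else 0) = arcCount ε x y := by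
    intro x y
    rw [Finset.sum_boole, arcCount]
    congr!
  rw [Finset.sum_congr rfl hterm, Finset.sum_add_distrib, hcount, hcount, arcCount_comm ε w u]
  ring

lemma meanVec_mk (hn : 3 ≤ n) {ε : Fin n → Fin n} (hε : ∀ v, ε (ε v) = v)
    (hne : (cyclesThrough ε).Nonempty) {D : ℝ} (hD : 0 < D) (hsum : ∑ v, matchWeight ε v - 1 = D)
    {u w : Fin n} (h : ¬ (s(u, w) : Sym2 (Fin n)).IsDiag) :
    meanVec ε ⟨s(u, w), h⟩ = 2 / D * (matchWeight ε u * matchWeight ε w) +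
      (if ε u = w then 1 - 1 / (2 * D) else 0) := by
  have hN : (0 : ℝ) < #(cyclesThrough ε) := by exact_mod_cast Finset.card_pos.2 hne
  have huw : w ≠ u := by rintro rfl; simp at h
  rw [meanVec, sum_permVec_mk hn]
  by_cases hw : ε u = w
  · subst hw
    rw [arcCount_involution (by simpa using hn) ε u]
    have h2 : ε (ε u) ≠ ε u := by rw [hε]; exact huw.symm
    simp only [matchWeight, h2, huw, if_true, if_false]
    field_simp
    ring
  · have := arcCount_mul_eq (by simpa using hn) hε huw (Ne.symm hw)
    rw [hsum] at this
    simp only [hw, if_false]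
    field_simp
    linarith

lemma map_meanVec (F : (EdgeIdx n → ℝ) →ₗ[ℝ] ℝ) (ε : Fin n → Fin n) :
    F (meanVec ε) = (#(cyclesThrough ε) : ℝ)⁻¹ * ∑ π ∈ cyclesThrough ε, F (permVec π) := by
  have : meanVec ε = (#(cyclesThrough ε) : ℝ)⁻¹ • ∑ π ∈ cyclesThrough ε, permVec π := by
    funext e; simp [meanVec]
  rw [this, map_smul, map_sum, smul_eq_mul]

lemma sum_permVec {π : Equiv.Perm (Fin n)} (hn : 3 ≤ n) (h : IsFullCycle π) :
    ∑ e, permVec π e = n := by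
  have : Nontrivial (Fin n) := Fin.nontrivial_iff_two_le.2 (by omega)
  have hnd : ∀ v, ¬ (s(v, π v) : Sym2 (Fin n)).IsDiag := fun v => by
    simpa using (h.apply_ne v).symm
  let f : Fin n → EdgeIdx n := fun v => ⟨s(v, π v), hnd v⟩
  have hf : Function.Injective f := by
    intro v w hvw
    have := congrArg Subtype.val hvw
    simp only [f, Sym2.eq_iff] at this
    rcases this with h1 | ⟨h1, h2⟩
    · exact h1.1
    · exact absurd (by rw [h2, h1]) (h.apply_apply_ne (by simpa using hn) v)
  have hset : (univ.filter fun e : EdgeIdx n => ∃ v, (e : Sym2 (Fin n)) = s(v, π v)) =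
      univ.image f := by
    ext e
    simp [f, Subtype.ext_iff, eq_comm]
  simp only [permVec]
  rw [Finset.sum_boole, hset, Finset.card_image_of_injective _ hf]
  simp

end HamiltonianCycles

section BlockMatchings

lemma card_filter_mem_powersetCard {α : Type*} [DecidableEq α] {s : Finset α} {i : α}
    (hi : i ∈ s) (k : ℕ) (p : Finset α → Prop) [DecidablePred p]
    (hp : ∀ T, p (insert i T) ↔ p T) :
    #((powersetCard (k + 1) s).filter fun T => i ∈ T ∧ p T) =
      #((powersetCard k (s.erase i)).filter p) := by
  refine Finset.card_nbij' (fun T => T.erase i) (fun T => insert i T) ?_ ?_ ?_ ?_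
  · intro T hT
    simp only [coe_filter, mem_powersetCard, Set.mem_ofPred_eq] at hT ⊢
    refine ⟨⟨Finset.erase_subset_erase i hT.1.1, ?_⟩, ?_⟩
    · rw [Finset.card_erase_of_mem hT.2.1, hT.1.2]; rfl
    · rw [← hp, Finset.insert_erase hT.2.1]; exact hT.2.2
  · intro T hT
    simp only [coe_filter, mem_powersetCard, Set.mem_ofPred_eq] at hT ⊢
    have hiT : i ∉ T := fun h => by simpa using hT.1.1 h
    refine ⟨⟨?_, ?_⟩, Finset.mem_insert_self i T, (hp T).2 hT.2⟩
    · exact Finset.insert_subset hi (hT.1.1.trans (Finset.erase_subset i s))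
    · rw [Finset.card_insert_of_notMem hiT, hT.1.2]
  · intro T hT
    simp only [coe_filter, Set.mem_ofPred_eq] at hT
    exact Finset.insert_erase hT.2.1
  · intro T hT
    simp only [coe_filter, mem_powersetCard, Set.mem_ofPred_eq] at hT
    exact Finset.erase_insert fun h => by simpa using hT.1.1 h

lemma card_filter_one_mem {α : Type*} [DecidableEq α] {s : Finset α} {i : α} (hi : i ∈ s)
    (k : ℕ) :
    #((powersetCard (k + 1) s).filter fun T => i ∈ T) = (#s - 1).choose k := by
  have := card_filter_mem_powersetCard hi k (fun _ => True) (fun _ => Iff.rfl)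
  simpa [Finset.card_erase_of_mem hi] using this

lemma card_filter_two_mem {α : Type*} [DecidableEq α] {s : Finset α} {i j : α} (hi : i ∈ s)
    (hj : j ∈ s) (hij : i ≠ j) (k : ℕ) :
    #((powersetCard (k + 1) s).filter fun T => i ∈ T ∧ j ∈ T) * (#s - 1) =
      k * (#s - 1).choose k := by
  have hcount : #((powersetCard (k + 1) s).filter fun T => i ∈ T ∧ j ∈ T) =
      #((powersetCard k (s.erase i)).filter fun T => j ∈ T) := by
    convert card_filter_mem_powersetCard hi k (fun T => j ∈ T) (fun T => by simp [hij.symm])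
  rw [hcount]
  have hj' : j ∈ s.erase i := Finset.mem_erase.2 ⟨hij.symm, hj⟩
  have hcard := Finset.card_erase_of_mem hi
  have hpos : 0 < #(s.erase i) := Finset.card_pos.2 ⟨j, hj'⟩
  cases k with
  | zero => simp
  | succ k =>
    rw [card_filter_one_mem hj', ← hcard]
    obtain ⟨l, hl⟩ := Nat.exists_eq_add_of_lt hpos
    rw [hl]
    have := Nat.add_one_mul_choose_eq (0 + l) k
    simp only [Nat.add_sub_cancel]
    linarith

variable {n : ℕ}

/-- The partner of `r` in its block `{2i, 2i+1}` if `i ∈ T`, and `r` itself otherwise. -/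
def blockFlip (T : Finset ℕ) (r : Fin n) : Fin n :=
  if h : (r : ℕ) / 2 ∈ T ∧ (r : ℕ) / 2 < n / 2 then
    ⟨if (r : ℕ) % 2 = 0 then r + 1 else r - 1, by split_ifs <;> omega⟩
  else r

lemma blockFlip_val {T : Finset ℕ} (hT : T ⊆ range (n / 2)) (r : Fin n) :
    (blockFlip T r : ℕ) =
      if (r : ℕ) / 2 ∈ T then (if (r : ℕ) % 2 = 0 then (r : ℕ) + 1 else r - 1) else r := by
  by_cases h : (r : ℕ) / 2 ∈ T
  · have h2 : (r : ℕ) / 2 < n / 2 := by simpa using hT h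
    simp [blockFlip, h, h2]
  · simp [blockFlip, h]

lemma blockFlip_blockFlip {T : Finset ℕ} (hT : T ⊆ range (n / 2)) (r : Fin n) :
    blockFlip T (blockFlip T r) = r := by
  apply Fin.ext
  rw [blockFlip_val hT, blockFlip_val hT r]
  by_cases h : (r : ℕ) / 2 ∈ T
  · by_cases h0 : (r : ℕ) % 2 = 0
    · have h1 : ((r : ℕ) + 1) / 2 = r / 2 := by omega
      have h2 : ((r : ℕ) + 1) % 2 ≠ 0 := by omega
      simp [h, h0, h1, h2]
    · have h1 : ((r : ℕ) - 1) / 2 = r / 2 := by omega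
      have h2 : ((r : ℕ) - 1) % 2 = 0 := by omega
      simp only [h, h0, h1, h2, if_true, if_false]
      omega
  · simp [h]

lemma blockFlip_eq_self_iff {T : Finset ℕ} (hT : T ⊆ range (n / 2)) (r : Fin n) :
    blockFlip T r = r ↔ (r : ℕ) / 2 ∉ T := by
  rw [Fin.ext_iff, blockFlip_val hT]
  split_ifs <;> simp_all
  omega

/-- The matching formed by the blocks in `T`, transported along the labelling `s`. -/
def blockMatching (s : Equiv.Perm (Fin n)) (T : Finset ℕ) (v : Fin n) : Fin n :=
  s (blockFlip T (s⁻¹ v))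

lemma blockMatching_apply (s : Equiv.Perm (Fin n)) (T : Finset ℕ) (r : Fin n) :
    blockMatching s T (s r) = s (blockFlip T r) := by
  simp [blockMatching]

lemma blockMatching_involutive (s : Equiv.Perm (Fin n)) {T : Finset ℕ} (hT : T ⊆ range (n / 2))
    (v : Fin n) : blockMatching s T (blockMatching s T v) = v := by
  simp [blockMatching, blockFlip_blockFlip hT]

/-- `1` if the block of `r` lies in `T`, else `0`. -/
def blockInd (T : Finset ℕ) (r : Fin n) : ℝ := if (r : ℕ) / 2 ∈ T then 1 else 0

lemma matchWeight_blockMatching (s : Equiv.Perm (Fin n)) {T : Finset ℕ}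
    (hT : T ⊆ range (n / 2)) (v : Fin n) :
    matchWeight (blockMatching s T) v = 1 - blockInd T (s⁻¹ v) / 2 := by
  have h : blockMatching s T v = v ↔ (s⁻¹ v : ℕ) / 2 ∉ T := by
    rw [← blockFlip_eq_self_iff hT, blockMatching, ← Equiv.Perm.eq_inv_iff_eq]
  simp only [matchWeight, blockInd, h]
  split_ifs <;> norm_num

lemma sum_range_div_two (f : ℕ → ℝ) (m : ℕ) :
    ∑ r ∈ range (2 * m), f (r / 2) = 2 * ∑ i ∈ range m, f i := by
  induction m with
  | zero => simp
  | succ m ih =>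
    rw [show 2 * (m + 1) = 2 * m + 1 + 1 by ring, Finset.sum_range_succ, Finset.sum_range_succ, ih,
      Finset.sum_range_succ, show (2 * m + 1) / 2 = m by omega, show 2 * m / 2 = m by omega]
    ring

lemma sum_blockInd {T : Finset ℕ} (hT : T ⊆ range (n / 2)) :
    ∑ r : Fin n, blockInd T r = 2 * #T := by
  have h1 : ∑ r : Fin n, blockInd T r = ∑ r ∈ range n, if r / 2 ∈ T then (1 : ℝ) else 0 :=
    Fin.sum_univ_eq_sum_range (fun r => if r / 2 ∈ T then (1 : ℝ) else 0) n
  have h2 : ∑ r ∈ range (2 * (n / 2)), (if r / 2 ∈ T then (1 : ℝ) else 0) =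
      ∑ r ∈ range n, if r / 2 ∈ T then (1 : ℝ) else 0 := by
    refine Finset.sum_subset (Finset.range_subset_range.2 (by omega)) fun r hr hr' => ?_
    rw [if_neg]
    intro h
    have := hT h
    simp only [Finset.mem_range] at this hr'
    omega
  rw [h1, ← h2, sum_range_div_two (fun i => if i ∈ T then (1 : ℝ) else 0), Finset.sum_boole,
    Finset.filter_mem_eq_inter, Finset.inter_eq_right.2 hT]

lemma sum_matchWeight_blockMatching (s : Equiv.Perm (Fin n)) {T : Finset ℕ}
    (hT : T ⊆ range (n / 2)) :
    ∑ v, matchWeight (blockMatching s T) v = n - #T := by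
  have hs : ∑ v, blockInd T (s⁻¹ v) = ∑ r : Fin n, blockInd T r :=
    Equiv.sum_comp s⁻¹ (fun r => blockInd T r)
  simp only [matchWeight_blockMatching s hT]
  rw [Finset.sum_sub_distrib, ← Finset.sum_div, hs, sum_blockInd hT]
  simp

lemma conj_finRotate_mem_cyclesThrough [NeZero n] (s : Equiv.Perm (Fin n)) {T : Finset ℕ}
    (hT : T ⊆ range (n / 2)) (hn : 2 ≤ n) :
    s * finRotate n * s⁻¹ ∈ cyclesThrough (blockMatching s T) := by
  rw [mem_cyclesThrough]
  refine ⟨(isFullCycle_iff_exists_conj hn _).2 ⟨s, rfl⟩, fun v hv => ?_⟩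
  obtain ⟨r, rfl⟩ := s.surjective v
  have hr : (r : ℕ) / 2 ∈ T := by
    by_contra h
    apply hv
    simp [blockMatching, (blockFlip_eq_self_iff hT r).2 h]
  have hrm : (r : ℕ) / 2 < n / 2 := by simpa using hT hr
  have hval := blockFlip_val hT r
  simp only [hr, if_true] at hval
  rw [blockMatching_apply]
  simp only [Equiv.Perm.mul_apply, show ∀ x, s⁻¹ (s x) = x from s.symm_apply_apply,
    EmbeddingLike.apply_eq_iff_eq]
  rw [finRotate_apply, finRotate_apply]
  by_cases h0 : (r : ℕ) % 2 = 0
  · left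
    apply Fin.ext
    rw [hval, if_pos h0, Fin.val_add_one_of_lt']
    omega
  · right
    apply Fin.ext
    rw [if_neg h0] at hval
    rw [Fin.val_add_one_of_lt' (by omega), hval]
    omega

/-- The edge of `K_n` joining the two labels of block `i`. -/
def blockEdge (s : Equiv.Perm (Fin n)) (i : ℕ) (hi : i < n / 2) : EdgeIdx n :=
  ⟨s(s ⟨2 * i, by omega⟩, s ⟨2 * i + 1, by omega⟩), by simp⟩

lemma mem_cyclesThrough_blockMatching (s : Equiv.Perm (Fin n)) {T : Finset ℕ}
    (hT : T ⊆ range (n / 2)) {π : Equiv.Perm (Fin n)} (hπ : IsFullCycle π) :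
    π ∈ cyclesThrough (blockMatching s T) ↔
      ∀ i : T, permVec π (blockEdge s i (Finset.mem_range.1 (hT i.2))) = 1 := by
  have hE : ∀ i : T, permVec π (blockEdge s i (Finset.mem_range.1 (hT i.2))) = 1 ↔
      (π (s ⟨2 * i, by have := Finset.mem_range.1 (hT i.2); omega⟩) =
        s ⟨2 * i + 1, by have := Finset.mem_range.1 (hT i.2); omega⟩ ∨
      π (s ⟨2 * i + 1, by have := Finset.mem_range.1 (hT i.2); omega⟩) =
        s ⟨2 * i, by have := Finset.mem_range.1 (hT i.2); omega⟩) := by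
    intro i
    rw [blockEdge, permVec_mk]
    split_ifs with h <;> simp [h]
  simp only [hE]
  rw [mem_cyclesThrough]
  constructor
  · rintro ⟨-, h⟩ ⟨i, hi⟩
    have him := Finset.mem_range.1 (hT hi)
    have hfl : blockMatching s T (s ⟨2 * i, by omega⟩) = s ⟨2 * i + 1, by omega⟩ := by
      rw [blockMatching_apply, EmbeddingLike.apply_eq_iff_eq]
      apply Fin.ext
      rw [blockFlip_val hT]
      simp [hi]
    have := h (s ⟨2 * i, by omega⟩) (by rw [hfl]; simp)
    rw [hfl] at this
    exact this
  · intro h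
    refine ⟨hπ, fun v hv => ?_⟩
    obtain ⟨r, rfl⟩ := s.surjective v
    have hr : (r : ℕ) / 2 ∈ T := by
      by_contra h
      apply hv
      simp [blockMatching, (blockFlip_eq_self_iff hT r).2 h]
    have him := Finset.mem_range.1 (hT hr)
    have hval := blockFlip_val hT r
    simp only [hr, if_true] at hval
    have := h ⟨_, hr⟩
    rw [blockMatching_apply]
    by_cases h0 : (r : ℕ) % 2 = 0
    · have h1 : (⟨2 * ((r : ℕ) / 2), by omega⟩ : Fin n) = r := Fin.ext (by simp; omega)
      have h2 : (⟨2 * ((r : ℕ) / 2) + 1, by omega⟩ : Fin n) = blockFlip T r :=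
        Fin.ext (by rw [hval, if_pos h0]; simp; omega)
      rw [h1, h2] at this
      exact this
    · have h1 : (⟨2 * ((r : ℕ) / 2), by omega⟩ : Fin n) = blockFlip T r :=
        Fin.ext (by rw [hval, if_neg h0]; simp; omega)
      have h2 : (⟨2 * ((r : ℕ) / 2) + 1, by omega⟩ : Fin n) = r := Fin.ext (by simp; omega)
      rw [h1, h2] at this
      exact this.symm

lemma map_meanVec_nonneg {k : ℕ} (hn : 2 ≤ n) {F : (EdgeIdx n → ℝ) →ₗ[ℝ] ℝ} (hF : memP n k F)
    (s : Equiv.Perm (Fin n)) {T : Finset ℕ} (hT : T ∈ powersetCard k (range (n / 2))) :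
    0 ≤ F (meanVec (blockMatching s T)) := by
  obtain ⟨hT, hTk⟩ := Finset.mem_powersetCard.1 hT
  obtain ⟨c, hc, hsum⟩ := exists_sum_permVec_eq hn
  set h : MvPolynomial (EdgeIdx n) ℝ :=
    ∏ i : T, MvPolynomial.X (blockEdge s i (Finset.mem_range.1 (hT i.2))) with hh
  have hdeg : h.totalDegree ≤ k := by
    refine (MvPolynomial.totalDegree_finsetProd _ _).trans ?_
    simp [MvPolynomial.totalDegree_X, hTk]
  have hX : (hamX n).Nonempty := Finset.univ_nonempty.image _
  have hXc : (0 : ℝ) < (#(hamX n) : ℝ)⁻¹ := by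
    rw [inv_pos]; exact_mod_cast Finset.card_pos.2 hX
  have hpos := (mul_nonneg_iff_of_pos_left hXc).1 (hF.2 h hdeg)
  have heval : ∀ π ∈ cyclesThrough (id : Fin n → Fin n),
      F (permVec π) * (MvPolynomial.eval (permVec π) h) ^ 2 =
        if π ∈ cyclesThrough (blockMatching s T) then F (permVec π) else 0 := by
    intro π hπ
    rw [mem_cyclesThrough_id] at hπ
    rw [hh, map_prod]
    simp only [MvPolynomial.eval_X]
    have hmem := mem_cyclesThrough_blockMatching s hT hπ
    split_ifs with hin
    · rw [Finset.prod_congr rfl (fun i _ => hmem.1 hin i)]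
      simp
    · obtain ⟨i, hi⟩ := not_forall.1 (fun h => hin (hmem.2 h))
      have : permVec π (blockEdge s i (Finset.mem_range.1 (hT i.2))) = 0 := by
        simp only [permVec] at hi ⊢
        split_ifs at hi ⊢ <;> simp_all
      rw [Finset.prod_eq_zero (Finset.mem_univ i) this]
      simp
  have h1 := hsum fun x => F x * (MvPolynomial.eval x h) ^ 2
  rw [Finset.sum_congr rfl heval, ← Finset.sum_filter] at h1
  have h2 : (cyclesThrough (id : Fin n → Fin n)).filter
      (fun π => π ∈ cyclesThrough (blockMatching s T)) = cyclesThrough (blockMatching s T) := by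
    ext π
    simp only [Finset.mem_filter, mem_cyclesThrough_id]
    exact ⟨fun h => h.2, fun h => ⟨(mem_cyclesThrough.1 h).1, h⟩⟩
  rw [h2] at h1
  rw [map_meanVec, h1]
  positivity

end BlockMatchings

section Averaging

variable {n : ℕ}

/-- `1` if `r` lies in a complete block `{2i, 2i+1}` of `Fin n`, else `0`. -/
def inBlock (r : Fin n) : ℝ := if (r : ℕ) / 2 < n / 2 then 1 else 0

/-- `1` if `r` is the first element of a complete block, else `0`. -/
def blockStart (r : Fin n) : ℝ := if (r : ℕ) % 2 = 0 ∧ (r : ℕ) / 2 < n / 2 then 1 else 0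

lemma sum_blockStart : ∑ r : Fin n, blockStart r = (n / 2 : ℕ) := by
  have h : #(univ.filter fun r : Fin n => (r : ℕ) % 2 = 0 ∧ (r : ℕ) / 2 < n / 2) =
      #(range (n / 2)) := by
    refine Finset.card_nbij (fun r => (r : ℕ) / 2) ?_ ?_ ?_
    · intro r hr; simp at hr ⊢; exact hr.2
    · intro r hr r' hr' h
      simp at hr hr' h
      apply Fin.ext; omega
    · intro i hi
      simp at hi
      exact ⟨⟨2 * i, by omega⟩, by simp; omega, by simp⟩
  simp only [blockStart]
  rw [Finset.sum_boole, h, Finset.card_range]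

lemma sum_inBlock_mul [NeZero n] {d : Fin n} (hd : d ≠ 0) :
    ∑ r : Fin n, inBlock r * inBlock (r + d) = 2 * ∑ r : Fin n, inBlock r - n := by
  have hpt : ∀ r : Fin n, inBlock r * inBlock (r + d) = inBlock r + inBlock (r + d) - 1 := by
    intro r
    have : (1 - inBlock r) * (1 - inBlock (r + d)) = 0 := by
      by_contra hc
      have h1 : ¬ (r : ℕ) / 2 < n / 2 := fun h => hc (by simp [inBlock, h])
      have h2 : ¬ ((r + d : Fin n) : ℕ) / 2 < n / 2 := fun h => hc (by simp [inBlock, h])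
      have hlt := (r + d).isLt
      have h3 : r + d = r := Fin.ext (by
        have hr := r.isLt
        generalize ((r + d : Fin n) : ℕ) = x at *
        omega)
      exact hd (by simpa using h3)
    linarith
  have hshift : ∑ r : Fin n, inBlock (r + d) = ∑ r : Fin n, inBlock r :=
    Equiv.sum_comp (Equiv.addRight d) inBlock
  simp only [hpt]
  rw [Finset.sum_sub_distrib, Finset.sum_add_distrib, hshift]
  simp
  ring

lemma eq_one_of_val_add_eq [NeZero n] {r d : Fin n} (h : ((r + d : Fin n) : ℕ) = r + 1) :
    d = 1 := by
  have h2 : r + d = r + 1 := by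
    apply Fin.ext
    have hlt := (r + d).isLt
    rw [h] at hlt ⊢
    rw [Fin.val_add_one_of_lt' hlt]
  exact add_left_cancel h2

lemma eq_neg_one_of_val_eq [NeZero n] {r d : Fin n} (h : (r : ℕ) = ((r + d : Fin n) : ℕ) + 1) :
    d = -1 := by
  have h2 : r = r + d + 1 := by
    apply Fin.ext
    rw [Fin.val_add_one_of_lt' (by omega), h]
  have h3 : d + 1 = 0 := by
    rw [add_assoc] at h2
    exact left_eq_add.1 h2
  exact eq_neg_of_add_eq_zero_left h3

lemma val_add_one_eq_of_blockStart [NeZero n] {r : Fin n}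
    (h : (r : ℕ) % 2 = 0 ∧ (r : ℕ) / 2 < n / 2) : ((r + 1 : Fin n) : ℕ) = r + 1 :=
  Fin.val_add_one_of_lt' (by omega)

lemma sum_blockInd_mul [NeZero n] (hn : 4 ≤ n) (k : ℕ) {r d : Fin n} (hd : d ≠ 0) (hd' : d ≠ -1) :
    ∑ T ∈ powersetCard (k + 1) (range (n / 2)), blockInd T r * blockInd T (r + d) =
      (k * ((n / 2 - 1).choose k : ℝ) / ((n / 2 : ℕ) - 1)) * (inBlock r * inBlock (r + d)) +
      (((n / 2 - 1).choose k : ℝ) - k * ((n / 2 - 1).choose k : ℝ) / ((n / 2 : ℕ) - 1)) *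
        (if d = 1 then blockStart r else 0) := by
  have hterm : ∀ T : Finset ℕ, blockInd T r * blockInd T (r + d) =
      if (r : ℕ) / 2 ∈ T ∧ ((r + d : Fin n) : ℕ) / 2 ∈ T then 1 else 0 := by
    intro T
    simp only [blockInd]
    split_ifs <;> simp_all
  simp only [hterm]
  rw [Finset.sum_boole]
  have hm : ((n / 2 : ℕ) : ℝ) - 1 = ((n / 2 - 1 : ℕ) : ℝ) := by
    rw [Nat.cast_sub (by omega)]; simp
  have hm0 : ((n / 2 - 1 : ℕ) : ℝ) ≠ 0 := by
    have : n / 2 - 1 ≠ 0 := by omega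
    exact_mod_cast this
  by_cases h1 : (r : ℕ) / 2 < n / 2
  · by_cases h2 : ((r + d : Fin n) : ℕ) / 2 < n / 2
    · by_cases h3 : (r : ℕ) / 2 = ((r + d : Fin n) : ℕ) / 2
      · have h4 : (r : ℕ) ≠ (r + d : Fin n) := fun h => hd (by
          have := Fin.ext h
          exact left_eq_add.1 this)
        have h5 : ((r + d : Fin n) : ℕ) ≠ r + 1 → (r : ℕ) = ((r + d : Fin n) : ℕ) + 1 := by
          omega
        have h6 : ((r + d : Fin n) : ℕ) = r + 1 := by
          by_contra h
          exact hd' (eq_neg_one_of_val_eq (h5 h))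
        have h7 : (r : ℕ) % 2 = 0 := by omega
        have hd1 := eq_one_of_val_add_eq h6
        rw [← h3]
        simp only [and_self]
        rw [card_filter_one_mem (Finset.mem_range.2 h1), Finset.card_range]
        rw [hd1] at h2
        simp [inBlock, blockStart, h1, h2, h7, hd1]
      · have h4 : (if d = 1 then blockStart r else 0) = 0 := by
          split_ifs with hd1
          · simp only [blockStart]
            rw [if_neg]
            intro hst
            apply h3
            rw [hd1, val_add_one_eq_of_blockStart hst]
            omega
          · rfl
        rw [h4, hm]
        have := card_filter_two_mem (Finset.mem_range.2 h1) (Finset.mem_range.2 h2) h3 k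
        rw [Finset.card_range] at this
        have hR : ((#((powersetCard (k + 1) (range (n / 2))).filter fun T =>
            (r : ℕ) / 2 ∈ T ∧ ((r + d : Fin n) : ℕ) / 2 ∈ T) : ℕ) : ℝ) * ((n / 2 - 1 : ℕ) : ℝ) =
            k * ((n / 2 - 1).choose k : ℝ) := by exact_mod_cast this
        simp only [inBlock, h1, h2, if_true, mul_one, mul_zero, add_zero]
        rw [eq_div_iff hm0]
        exact hR
    · have h0 : #((powersetCard (k + 1) (range (n / 2))).filter fun T =>
          (r : ℕ) / 2 ∈ T ∧ ((r + d : Fin n) : ℕ) / 2 ∈ T) = 0 := by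
        rw [Finset.card_eq_zero, Finset.filter_eq_empty_iff]
        intro T hT h
        exact h2 (Finset.mem_range.1 ((Finset.mem_powersetCard.1 hT).1 h.2))
      have h4 : (if d = 1 then blockStart r else 0) = 0 := by
        split_ifs with hd1
        · simp only [blockStart]
          rw [if_neg]
          intro hst
          apply h2
          rw [hd1, val_add_one_eq_of_blockStart hst]
          omega
        · rfl
      rw [h0, h4]
      simp [inBlock, h2]
  · have h0 : #((powersetCard (k + 1) (range (n / 2))).filter fun T =>
        (r : ℕ) / 2 ∈ T ∧ ((r + d : Fin n) : ℕ) / 2 ∈ T) = 0 := by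
      rw [Finset.card_eq_zero, Finset.filter_eq_empty_iff]
      intro T hT h
      exact h1 (Finset.mem_range.1 ((Finset.mem_powersetCard.1 hT).1 h.1))
    rw [h0]
    simp [inBlock, blockStart, h1]

lemma sum_blockFlip_eq [NeZero n] (k : ℕ) {r d : Fin n} (hd : d ≠ 0) (hd' : d ≠ -1) :
    ∑ T ∈ powersetCard (k + 1) (range (n / 2)), (if blockFlip T r = r + d then (1 : ℝ) else 0) =
      ((n / 2 - 1).choose k : ℝ) * (if d = 1 then blockStart r else 0) := by
  have hiff : ∀ T ∈ powersetCard (k + 1) (range (n / 2)),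
      (blockFlip T r = r + d ↔ (d = 1 ∧ (r : ℕ) % 2 = 0 ∧ (r : ℕ) / 2 < n / 2) ∧
        (r : ℕ) / 2 ∈ T) := by
    intro T hT
    have hT := (Finset.mem_powersetCard.1 hT).1
    rw [Fin.ext_iff, blockFlip_val hT]
    constructor
    · intro h
      split_ifs at h with h1 h2
      · exact ⟨⟨eq_one_of_val_add_eq h.symm, h2, by simpa using hT h1⟩, h1⟩
      · exact absurd (eq_neg_one_of_val_eq (r := r) (d := d) (by omega)) hd'
      · exact absurd (left_eq_add.1 (Fin.ext h)) hd
    · rintro ⟨⟨rfl, h0, h1⟩, h2⟩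
      rw [val_add_one_eq_of_blockStart ⟨h0, h1⟩]
      simp [h2, h0]
  rw [Finset.sum_boole, Finset.filter_congr hiff]
  by_cases h : d = 1 ∧ (r : ℕ) % 2 = 0 ∧ (r : ℕ) / 2 < n / 2
  · simp only [h, true_and, and_self]
    rw [card_filter_one_mem (Finset.mem_range.2 h.2.2), Finset.card_range]
    simp [blockStart, h.2]
  · simp only [h, false_and]
    have : (if d = 1 then blockStart r else 0) = 0 := by
      split_ifs with hd1
      · simp only [blockStart]
        rw [if_neg]
        exact fun hc => h ⟨hd1, hc⟩
      · rfl
    rw [this]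
    simp

/-- The sum of the mean vectors over all rotations of the blocks along a Hamiltonian cycle and all
choices of `k + 1` blocks. -/
def totalMean (n k : ℕ) [NeZero n] (σ : Equiv.Perm (Fin n)) : EdgeIdx n → ℝ :=
  ∑ T ∈ powersetCard (k + 1) (range (n / 2)), ∑ j : Fin n,
    meanVec (blockMatching (σ * Equiv.addRight j) T)

lemma meanVec_blockMatching [NeZero n] (hn : 4 ≤ n) (σ : Equiv.Perm (Fin n)) (j : Fin n)
    {T : Finset ℕ} (hT : T ⊆ range (n / 2)) {p q : Fin n}
    (h : ¬ (s(σ p, σ q) : Sym2 (Fin n)).IsDiag) :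
    meanVec (blockMatching (σ * Equiv.addRight j) T) ⟨s(σ p, σ q), h⟩ =
      2 / (n - #T - 1) * ((1 - blockInd T (p - j) / 2) * (1 - blockInd T (q - j) / 2)) +
      (1 - 1 / (2 * (n - #T - 1))) * (if blockFlip T (p - j) = q - j then 1 else 0) := by
  have hinv : ∀ x, (σ * Equiv.addRight j)⁻¹ (σ x) = x - j := by
    intro x
    rw [Equiv.Perm.inv_eq_iff_eq]
    simp
  have hcard : #T ≤ n / 2 := by simpa using Finset.card_le_card hT
  have hD : (0 : ℝ) < n - #T - 1 := by
    have : #T + 1 < n := by omega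
    have : ((#T + 1 : ℕ) : ℝ) < n := by exact_mod_cast this
    push_cast at this
    linarith
  rw [meanVec_mk (by omega) (blockMatching_involutive _ hT)
    ⟨_, conj_finRotate_mem_cyclesThrough _ hT (by omega)⟩ hD
    (by rw [sum_matchWeight_blockMatching _ hT]),
    matchWeight_blockMatching _ hT, matchWeight_blockMatching _ hT, hinv, hinv]
  congr 1
  have hiff : blockMatching (σ * Equiv.addRight j) T (σ p) = σ q ↔
      blockFlip T (p - j) = q - j := by
    rw [blockMatching, hinv, ← hinv q, ← Equiv.Perm.eq_inv_iff_eq]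
  simp only [hiff]
  split_ifs <;> simp

lemma totalMean_mk [NeZero n] (hn : 4 ≤ n) (k : ℕ) (σ : Equiv.Perm (Fin n)) {p d : Fin n}
    (hd : d ≠ 0) (hd' : d ≠ -1) (h : ¬ (s(σ p, σ (p + d)) : Sym2 (Fin n)).IsDiag)
    {D A B m : ℝ} (hD : D = n - (k + 1 : ℕ) - 1) (hA : A = ((n / 2 - 1).choose k : ℝ))
    (hm : m = (n / 2 : ℕ)) (hB : B = k * A / (m - 1)) :
    totalMean n k σ ⟨s(σ p, σ (p + d)), h⟩ =
      2 / D * ((n - 2 * (k + 1)) * ((n / 2).choose (k + 1) : ℝ) +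
        B * (2 * ∑ r : Fin n, inBlock r - n) / 4) +
      (if d = 1 then m * A - m * B / (2 * D) else 0) := by
  have hstart := sum_blockStart (n := n)
  rw [← hm] at hstart
  set P := powersetCard (k + 1) (range (n / 2)) with hP
  have hPc : (#P : ℝ) = ((n / 2).choose (k + 1) : ℝ) := by
    rw [hP, Finset.card_powersetCard, Finset.card_range]
  have hshift : ∀ T : Finset ℕ, ∑ r : Fin n, blockInd T (r + d) = ∑ r : Fin n, blockInd T r :=
    fun T => Equiv.sum_comp (Equiv.addRight d) (fun r => blockInd T r)
  have hterm : ∀ T ∈ P, (∑ j : Fin n, meanVec (blockMatching (σ * Equiv.addRight j) T))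
      ⟨s(σ p, σ (p + d)), h⟩ = 2 / D * (n - 2 * (k + 1) +
        (∑ r : Fin n, blockInd T r * blockInd T (r + d)) / 4) +
      (1 - 1 / (2 * D)) * ∑ r : Fin n, (if blockFlip T r = r + d then 1 else 0) := by
    intro T hT
    obtain ⟨hT, hTk⟩ := Finset.mem_powersetCard.1 hT
    rw [Finset.sum_apply, Finset.sum_congr rfl
      (fun j _ => meanVec_blockMatching hn σ j hT h), hTk, ← hD]
    have hre : ∀ f : Fin n → Fin n → ℝ, ∑ j, f (p - j) (p + d - j) = ∑ r, f r (r + d) := by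
      intro f
      rw [← Equiv.sum_comp (Equiv.subLeft p)]
      refine Finset.sum_congr rfl fun j _ => ?_
      simp only [Equiv.subLeft_apply]
      rw [sub_sub_cancel, show p + d - (p - j) = j + d by abel]
    rw [hre fun x y => 2 / D * ((1 - blockInd T x / 2) * (1 - blockInd T y / 2)) +
      (1 - 1 / (2 * D)) * (if blockFlip T x = y then 1 else 0), Finset.sum_add_distrib,
      ← Finset.mul_sum, ← Finset.mul_sum]
    congr 2
    have hexp : ∀ r : Fin n, (1 - blockInd T r / 2) * (1 - blockInd T (r + d) / 2) =
        1 - blockInd T r / 2 - blockInd T (r + d) / 2 + blockInd T r * blockInd T (r + d) / 4 :=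
      fun r => by ring
    simp only [hexp]
    rw [Finset.sum_add_distrib, Finset.sum_sub_distrib, Finset.sum_sub_distrib,
      ← Finset.sum_div, ← Finset.sum_div, ← Finset.sum_div, hshift, sum_blockInd hT, hTk]
    simp
    ring
  rw [totalMean, Finset.sum_apply, Finset.sum_congr rfl hterm, Finset.sum_add_distrib,
    ← Finset.mul_sum, ← Finset.mul_sum, Finset.sum_add_distrib, ← Finset.sum_div,
    Finset.sum_comm, Finset.sum_comm (s := P)]
  simp only [hP, sum_blockInd_mul hn k hd hd', sum_blockFlip_eq k hd hd']
  rw [← hP, ← hm, ← hA, ← hB, Finset.sum_add_distrib, ← Finset.mul_sum, ← Finset.mul_sum,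
    ← Finset.mul_sum, sum_inBlock_mul hd, Finset.sum_const, nsmul_eq_mul, hPc]
  split_ifs with hd1
  · rw [hstart]; ring
  · rw [Finset.sum_const_zero]; ring

/-- The averaged mean vector lies on the line through the constant vector and the incidence vector
of the Hamiltonian cycle. -/
lemma totalMean_eq [NeZero n] (hn : 4 ≤ n) (k : ℕ) (σ : Equiv.Perm (Fin n))
    {D A B m : ℝ} (hD : D = n - (k + 1 : ℕ) - 1) (hA : A = ((n / 2 - 1).choose k : ℝ))
    (hm : m = (n / 2 : ℕ)) (hB : B = k * A / (m - 1)) :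
    ∃ c : ℝ, totalMean n k σ = c • 1 + (m * A - m * B / (2 * D)) • cycleVec n σ := by
  refine ⟨2 / D * ((n - 2 * (k + 1)) * ((n / 2).choose (k + 1) : ℝ) +
        B * (2 * ∑ r : Fin n, inBlock r - n) / 4), ?_⟩
  have hone : (1 : Fin n) ≠ 0 := by
    rw [Ne, Fin.ext_iff, Fin.val_one', Fin.val_zero, Nat.mod_eq_of_lt (by omega)]
    omega
  have htwo : (1 : Fin n) ≠ -1 := by
    intro h
    have : (1 : Fin n) + 1 = 0 := by nth_rewrite 1 [h]; simp
    have h2 := congrArg Fin.val this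
    rw [Fin.val_add_one_of_lt', Fin.val_one', Nat.mod_eq_of_lt (by omega)] at h2
    · simp at h2
    · rw [Fin.val_one', Nat.mod_eq_of_lt (by omega)]; omega
  funext ⟨e, he⟩
  simp only [Pi.add_apply, Pi.smul_apply, Pi.one_apply, smul_eq_mul, mul_one]
  by_cases hmem : ∃ i : Fin n, e = s(σ i, σ (finRotate n i))
  · have hv : cycleVec n σ ⟨e, he⟩ = 1 := if_pos hmem
    rw [hv]
    obtain ⟨i, rfl⟩ := hmem
    simp only [finRotate_apply] at he ⊢
    rw [totalMean_mk hn k σ hone htwo he hD hA hm hB]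
    simp
  · have hv : cycleVec n σ ⟨e, he⟩ = 0 := if_neg hmem
    rw [hv]
    induction e using Sym2.ind with
    | _ u w =>
      obtain ⟨p, rfl⟩ := σ.surjective u
      obtain ⟨q, rfl⟩ := σ.surjective w
      obtain ⟨d, rfl⟩ : ∃ d, q = p + d := ⟨q - p, by simp⟩
      have hd : d ≠ 0 := by rintro rfl; simp at he
      have hd1 : d ≠ 1 := by
        rintro rfl; exact hmem ⟨p, by rw [finRotate_apply]⟩
      have hd' : d ≠ -1 := by
        rintro rfl
        exact hmem ⟨p + -1, by rw [finRotate_apply, Sym2.eq_swap]; simp⟩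
      rw [totalMean_mk hn k σ hd hd' he hD hA hm hB]
      simp [hd1]

end Averaging

section Approximation

variable {n : ℕ}

/-- The linear functional with value `1` on all incidence vectors of Hamiltonian cycles. -/
def averageEdge (n : ℕ) : (EdgeIdx n → ℝ) →ₗ[ℝ] ℝ := (n : ℝ)⁻¹ • ∑ e, LinearMap.proj e

lemma averageEdge_permVec (hn : 3 ≤ n) {π : Equiv.Perm (Fin n)} (h : IsFullCycle π) :
    averageEdge n (permVec π) = 1 := by
  have hn0 : (n : ℝ) ≠ 0 := by
    have : n ≠ 0 := by omega
    exact_mod_cast this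
  simp [averageEdge, sum_permVec hn h, hn0]

lemma averageEdge_of_mem_hamX (hn : 3 ≤ n) {x : EdgeIdx n → ℝ} (hx : x ∈ hamX n) :
    averageEdge n x = 1 := by
  obtain ⟨σ, -, rfl⟩ := Finset.mem_image.1 hx
  rw [cycleVec_eq_permVec]
  exact averageEdge_permVec hn ((isFullCycle_iff_exists_conj (by omega) _).2 ⟨σ, rfl⟩)

lemma averageEdge_meanVec (hn : 3 ≤ n) {ε : Fin n → Fin n} (hne : (cyclesThrough ε).Nonempty) :
    averageEdge n (meanVec ε) = 1 := by
  have hN : (#(cyclesThrough ε) : ℝ) ≠ 0 := by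
    exact_mod_cast (Finset.card_pos.2 hne).ne'
  rw [map_meanVec, Finset.sum_congr rfl
    (fun π hπ => averageEdge_permVec hn (mem_cyclesThrough.1 hπ).1)]
  simp [hN]

lemma cyclesThrough_id_nonempty (hn : 2 ≤ n) : (cyclesThrough (id : Fin n → Fin n)).Nonempty :=
  ⟨finRotate n, mem_cyclesThrough_id.2 ((isFullCycle_iff_exists_conj hn _).2 ⟨1, by simp⟩)⟩

lemma meanVec_id (hn : 3 ≤ n) :
    meanVec (id : Fin n → Fin n) = (2 / ((n : ℝ) - 1)) • (1 : EdgeIdx n → ℝ) := by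
  have hD : (0 : ℝ) < n - 1 := by
    have : (3 : ℝ) ≤ n := by exact_mod_cast hn
    linarith
  have hw : ∀ v : Fin n, matchWeight id v = 1 := fun v => by simp [matchWeight]
  funext ⟨e, he⟩
  induction e using Sym2.ind with
  | _ u w =>
    have huw : u ≠ w := by simpa using he
    rw [meanVec_mk hn (fun _ => rfl) (cyclesThrough_id_nonempty (by omega)) hD (by simp [hw])]
    simp [hw, huw]

/-- A linear functional whose average over `X` is `1` takes the value `(n - 1) / 2` at the
all-ones vector. -/
lemma map_one_of_average_eq_one (hn : 3 ≤ n) {F : (EdgeIdx n → ℝ) →ₗ[ℝ] ℝ}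
    (hF : ((hamX n).card : ℝ)⁻¹ * ∑ x ∈ hamX n, F x = 1) : F 1 = ((n : ℝ) - 1) / 2 := by
  have hD : (0 : ℝ) < n - 1 := by
    have : (3 : ℝ) ≤ n := by exact_mod_cast hn
    linarith
  obtain ⟨c, hc, hsum⟩ := exists_sum_permVec_eq (n := n) (by omega)
  have hcard : (#(cyclesThrough (id : Fin n → Fin n)) : ℝ) = c * #(hamX n) := by
    simpa using hsum fun _ => 1
  have hmean : F (meanVec (id : Fin n → Fin n)) = 1 := by
    rw [map_meanVec, hsum F, hcard, mul_inv, ← hF]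
    field_simp
  rw [meanVec_id hn, map_smul, smul_eq_mul] at hmean
  field_simp at hmean
  linarith

lemma average_averageEdge (hn : 3 ≤ n) :
    ((hamX n).card : ℝ)⁻¹ * ∑ x ∈ hamX n, averageEdge n x = 1 := by
  have hX : (hamX n).Nonempty := Finset.univ_nonempty.image _
  have hX0 : (#(hamX n) : ℝ) ≠ 0 := by exact_mod_cast (Finset.card_pos.2 hX).ne'
  rw [Finset.sum_congr rfl fun x hx => averageEdge_of_mem_hamX hn hx]
  simp [hX0]

lemma averageEdge_totalMean [NeZero n] (hn : 3 ≤ n) (k : ℕ) (σ : Equiv.Perm (Fin n)) :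
    averageEdge n (totalMean n k σ) = n * ((n / 2).choose (k + 1) : ℝ) := by
  have hterm : ∀ T ∈ powersetCard (k + 1) (range (n / 2)), ∀ j : Fin n,
      averageEdge n (meanVec (blockMatching (σ * Equiv.addRight j) T)) = 1 := fun T hT j =>
    averageEdge_meanVec hn ⟨_, conj_finRotate_mem_cyclesThrough _
      (Finset.mem_powersetCard.1 hT).1 (by omega)⟩
  rw [totalMean, map_sum]
  simp only [map_sum]
  rw [Finset.sum_congr rfl fun T hT => Finset.sum_congr rfl fun j _ => hterm T hT j]
  simp [mul_comm]

/-- Lower bound for elements of `P_k` at the vertices. -/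
lemma le_mul_of_memP [NeZero n] (hn : 4 ≤ n) {k : ℕ} (hk : k + 1 ≤ n / 2)
    {F : (EdgeIdx n → ℝ) →ₗ[ℝ] ℝ} (hF : memP n (k + 1) F) (σ : Equiv.Perm (Fin n)) :
    0 ≤ n + (k + 1) * (1 - k / (2 * ((n : ℝ) - k - 2) * ((n / 2 : ℕ) - 1))) *
      (F (cycleVec n σ) - 1) := by
  obtain ⟨c, hc⟩ := totalMean_eq hn k σ rfl rfl rfl rfl
  have hnonneg : 0 ≤ F (totalMean n k σ) := by
    rw [totalMean, map_sum]
    simp only [map_sum]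
    exact Finset.sum_nonneg fun T hT => Finset.sum_nonneg fun j _ =>
      map_meanVec_nonneg (by omega) hF _ hT
  have hL := averageEdge_totalMean (by omega) k σ
  rw [hc, map_add, map_smul, map_smul, smul_eq_mul, smul_eq_mul] at hnonneg hL
  rw [map_one_of_average_eq_one (by omega) hF.1] at hnonneg
  rw [map_one_of_average_eq_one (by omega) (average_averageEdge (by omega)),
    averageEdge_of_mem_hamX (by omega) (Finset.mem_image_of_mem _ (Finset.mem_univ _))] at hL
  have hchoose : ((n / 2 : ℕ) : ℝ) * ((n / 2 - 1).choose k : ℝ) =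
      ((n / 2).choose (k + 1) : ℝ) * (k + 1) := by
    have := Nat.add_one_mul_choose_eq (n / 2 - 1) k
    rw [Nat.sub_add_cancel (by omega)] at this
    exact_mod_cast this
  have hC : (0 : ℝ) < ((n / 2).choose (k + 1) : ℝ) := by exact_mod_cast Nat.choose_pos hk
  set C := ((n / 2).choose (k + 1) : ℝ)
  set A := ((n / 2 - 1).choose k : ℝ)
  set m := ((n / 2 : ℕ) : ℝ)
  have hΛ : m * A - m * (k * A / (m - 1)) / (2 * ((n : ℝ) - (k + 1 : ℕ) - 1)) =
      C * ((k + 1) * (1 - k / (2 * ((n : ℝ) - k - 2) * (m - 1)))) := by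
    rw [← mul_assoc, ← hchoose]
    push_cast
    rw [show (n : ℝ) - (k + 1) - 1 = n - k - 2 by ring, mul_comm (2 * ((n : ℝ) - k - 2)),
      ← div_div (k : ℝ)]
    ring
  rw [hΛ] at hnonneg hL
  refine nonneg_of_mul_nonneg_right (a := C) ?_ hC
  linarith

lemma one_le_correction_mul {n k m : ℝ} (hn : 9 ≤ n) (hk : 0 ≤ k) (hkm : k + 1 ≤ m)
    (hm : n ≤ 2 * m + 1) (hm' : 2 * m ≤ n) :
    1 ≤ (1 - k / (2 * (n - k - 2) * (m - 1))) * (1 + 10 * (k + 1) / n ^ 2) := by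
  have h1 : (0 : ℝ) < n - 2 := by linarith
  have h2 : (0 : ℝ) < n - 3 := by linarith
  have hδ : k / (2 * (n - k - 2) * (m - 1)) ≤ 2 * k / ((n - 2) * (n - 3)) := by
    have h3 : (n - 2) * (n - 3) ≤ 2 * (2 * (n - k - 2) * (m - 1)) := by
      have ha : n - 2 ≤ 2 * (n - k - 2) := by linarith
      have hb : n - 3 ≤ 2 * (m - 1) := by linarith
      nlinarith
    have h4 : (0 : ℝ) < 2 * (n - k - 2) * (m - 1) := by nlinarith [mul_pos h1 h2]
    rw [div_le_div_iff₀ h4 (mul_pos h1 h2)]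
    nlinarith
  have hsq : n ^ 2 ≤ 81 / 42 * ((n - 2) * (n - 3)) := by nlinarith
  have hn2 : 0 < n ^ 2 := by positivity
  have hδ2 : 2 * k / ((n - 2) * (n - 3)) ≤ 81 / 42 * (2 * k) / n ^ 2 := by
    rw [div_le_div_iff₀ (mul_pos h1 h2) hn2]
    nlinarith
  set t := k / n ^ 2 with ht
  have ht0 : 0 ≤ t := by positivity
  have hs : 10 * (k + 1) / n ^ 2 ≤ 5 / 9 := by
    rw [div_le_iff₀ hn2]; nlinarith
  have hs' : 10 * t ≤ 10 * (k + 1) / n ^ 2 := by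
    rw [ht, mul_div_assoc', div_le_div_iff_of_pos_right hn2]; linarith
  have hδ3 : k / (2 * (n - k - 2) * (m - 1)) ≤ 27 / 7 * t := by
    refine (hδ.trans hδ2).trans (le_of_eq ?_)
    rw [ht]; ring
  set δ := k / (2 * (n - k - 2) * (m - 1))
  set s := 10 * (k + 1) / n ^ 2
  have hs0 : 0 ≤ s := by linarith
  have : δ * (1 + s) ≤ 27 / 7 * t * (1 + 5 / 9) :=
    mul_le_mul hδ3 (by linarith) (by linarith) (by linarith)
  nlinarith

end Approximation

/-- For `n ≥ 9` and `1 ≤ k ≤ ⌊n/2⌋` there is a constant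
`a_k = n/k + α_k`, `|α_k| ≤ 10/n`, with `Q - 𝟙 ⊆ P_k - 𝟙 ⊆ a_k (Q - 𝟙)`:
every `f ∈ Q` belongs to `P_k`, and for every `f ∈ P_k` the function
`𝟙 + (1/a_k)(f - 𝟙)` belongs to `Q` (i.e. it is the restriction of a linear
function `G` which is nonnegative on `X` with average value `1`). -/
theorem semidefinite_approximation_of_dual
    (n k : ℕ) (hn : 9 ≤ n) (hk1 : 1 ≤ k) (hk2 : k ≤ n / 2) :
    ∃ a : ℝ, |a - (n : ℝ) / k| ≤ 10 / n ∧
      (∀ F : (EdgeIdx n → ℝ) →ₗ[ℝ] ℝ, memQ n F → memP n k F) ∧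
      (∀ F : (EdgeIdx n → ℝ) →ₗ[ℝ] ℝ, memP n k F →
        ∃ G : (EdgeIdx n → ℝ) →ₗ[ℝ] ℝ, memQ n G ∧
          ∀ x ∈ hamX n, G x = 1 + a⁻¹ * (F x - 1)) := by
  have : NeZero n := ⟨by omega⟩
  obtain ⟨k, rfl⟩ : ∃ l, k = l + 1 := ⟨k - 1, by omega⟩
  have hnR : (9 : ℝ) ≤ n := by exact_mod_cast hn
  have ha : (0 : ℝ) < n / (k + 1 : ℕ) + 10 / n := by positivity
  refine ⟨n / (k + 1 : ℕ) + 10 / n, ?_, ?_, ?_⟩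
  · rw [add_sub_cancel_left, abs_of_nonneg (by positivity)]
  · exact fun F hF => ⟨hF.1, fun h _ => mul_nonneg (by positivity)
      (Finset.sum_nonneg fun x hx => mul_nonneg (hF.2 x hx) (sq_nonneg _))⟩
  · intro F hF
    set a : ℝ := n / (k + 1 : ℕ) + 10 / n with had
    set G : (EdgeIdx n → ℝ) →ₗ[ℝ] ℝ := a⁻¹ • F + (1 - a⁻¹) • averageEdge n with hGd
    have hG : ∀ x ∈ hamX n, G x = 1 + a⁻¹ * (F x - 1) := by
      intro x hx
      simp only [hGd, LinearMap.add_apply, LinearMap.smul_apply, smul_eq_mul,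
        averageEdge_of_mem_hamX (by omega : 3 ≤ n) hx]
      ring
    refine ⟨G, ⟨?_, ?_⟩, hG⟩
    · have hmean := average_averageEdge (by omega : 3 ≤ n)
      have hFm := hF.1
      simp only [hGd, LinearMap.add_apply, LinearMap.smul_apply, smul_eq_mul]
      rw [Finset.sum_add_distrib, ← Finset.mul_sum, ← Finset.mul_sum]
      linear_combination a⁻¹ * hFm + (1 - a⁻¹) * hmean
    · intro x hx
      rw [hG x hx]
      obtain ⟨σ, -, rfl⟩ := Finset.mem_image.1 hx
      have hmain := le_mul_of_memP (by omega) hk2 hF σ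
      have hkm : (k : ℝ) + 1 ≤ (n / 2 : ℕ) := by exact_mod_cast hk2
      have hm : (n : ℝ) ≤ 2 * (n / 2 : ℕ) + 1 := by
        have : n ≤ 2 * (n / 2) + 1 := by omega
        exact_mod_cast this
      have hm' : 2 * ((n / 2 : ℕ) : ℝ) ≤ n := by
        have : 2 * (n / 2) ≤ n := by omega
        exact_mod_cast this
      have hcor := one_le_correction_mul hnR (Nat.cast_nonneg k) hkm hm hm'
      set q : ℝ := 1 - k / (2 * ((n : ℝ) - k - 2) * ((n / 2 : ℕ) - 1))
      have haq : (n : ℝ) ≤ (k + 1) * q * a := by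
        have : ((k : ℝ) + 1) * q * a = n * (q * (1 + 10 * (k + 1) / n ^ 2)) := by
          rw [had]; push_cast; field_simp
        rw [this]
        nlinarith
      have hq : 0 < ((k : ℝ) + 1) * q := by
        by_contra hc
        nlinarith
      have hkey : 0 ≤ a + (F (cycleVec n σ) - 1) := by
        by_contra hc
        nlinarith
      have : 1 + a⁻¹ * (F (cycleVec n σ) - 1) = a⁻¹ * (a + (F (cycleVec n σ) - 1)) := by
        field_simp
      rw [this]
      positivity
end
end

section
/- Let T_n denote the symmetric traveling salesman polytope, the convex hull of X, let Z be its barycenter, and let n ≥ 9 and 1 ≤ k ≤ ⌊n/2⌋. Then there exists a real constant a_k = n/k + α_k with |α_k| ≤ 10/n such that P_k° - Z ⊆ T_n - Z ⊆ a_k(P_k° - Z), where P_k° is the set of points p in the affine span of X such that g(p) ≥ 0 for every g ∈ P_k (each g ∈ P_k extends uniquely to an affine function on the affine span of X). -/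
open Finset
noncomputable section
open scoped Classical

/-- The barycenter `Z` of the symmetric traveling salesman polytope `T_n = conv(X)`. -/
def bary (n : ℕ) : EdgeIdx n → ℝ := ((hamX n).card : ℝ)⁻¹ • ∑ x ∈ hamX n, x

/-- Membership in `P_k°`: the set of points `p` of the affine span of `X` such that
`g(p) ≥ 0` for every `g ∈ P_k` (each `g ∈ P_k` is the restriction of a linear
function `F`, whose value at a point of the affine span depends only on `g`). -/
def memPolar (n k : ℕ) (p : EdgeIdx n → ℝ) : Prop :=
  p ∈ affineSpan ℝ (hamX n : Set (EdgeIdx n → ℝ)) ∧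
  ∀ F : (EdgeIdx n → ℝ) →ₗ[ℝ] ℝ, memP n k F → 0 ≤ F p

/-- The entry at `(u, v)` of the symmetric matrix with zero diagonal attached to an edge vector. -/
def entry {n : ℕ} (u v : Fin n) : (EdgeIdx n → ℝ) →ₗ[ℝ] ℝ :=
  if h : u = v then 0 else LinearMap.proj ⟨s(u, v), by simpa using h⟩

/-- The action of a permutation of the vertices on the edges. -/
def edgeMap {n : ℕ} (π : Equiv.Perm (Fin n)) (e : EdgeIdx n) : EdgeIdx n :=
  ⟨e.1.map π, by
    obtain ⟨e, he⟩ := e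
    induction e using Sym2.ind with
    | _ u v => simpa using he⟩

/-- The action of a permutation of the vertices on edge vectors. -/
def act {n : ℕ} (π : Equiv.Perm (Fin n)) : (EdgeIdx n → ℝ) →ₗ[ℝ] (EdgeIdx n → ℝ) :=
  LinearMap.funLeft ℝ ℝ (edgeMap π⁻¹)

section Basic

variable {n : ℕ}

lemma entry_self (u : Fin n) (x : EdgeIdx n → ℝ) : entry u u x = 0 := by
  simp [entry]

lemma entry_of_ne {u v : Fin n} (h : u ≠ v) (x : EdgeIdx n → ℝ) :
    entry u v x = x ⟨s(u, v), by simpa using h⟩ := by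
  simp [entry, h]

lemma entry_comm (u v : Fin n) (x : EdgeIdx n → ℝ) : entry u v x = entry v u x := by
  by_cases h : u = v
  · rw [h]
  · rw [entry_of_ne h, entry_of_ne (Ne.symm h)]
    congr 2
    exact Sym2.eq_swap

lemma ext_entry {x y : EdgeIdx n → ℝ} (h : ∀ u v, u ≠ v → entry u v x = entry u v y) :
    x = y := by
  funext ⟨e, he⟩
  induction e using Sym2.ind with
  | _ u v =>
    have huv : u ≠ v := by simpa using he
    simpa [entry_of_ne huv] using h u v huv

lemma entry_act (π : Equiv.Perm (Fin n)) (u v : Fin n) (x : EdgeIdx n → ℝ) :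
    entry u v (act π x) = entry (π⁻¹ u) (π⁻¹ v) x := by
  by_cases h : u = v
  · simp [h, entry_self]
  · have h' : π⁻¹ u ≠ π⁻¹ v := fun hh => h (π⁻¹.injective hh)
    rw [entry_of_ne h, entry_of_ne h']
    rfl

lemma entry_act_apply (π : Equiv.Perm (Fin n)) (u v : Fin n) (x : EdgeIdx n → ℝ) :
    entry (π u) (π v) (act π x) = entry u v x := by
  simp [entry_act]

lemma act_mul (π σ : Equiv.Perm (Fin n)) (x : EdgeIdx n → ℝ) :
    act (π * σ) x = act π (act σ x) :=
  ext_entry fun u v _ => by simp [entry_act]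

lemma act_one (x : EdgeIdx n → ℝ) : act 1 x = x :=
  ext_entry fun u v _ => by simp [entry_act]

lemma entry_cycleVec (σ : Equiv.Perm (Fin n)) {u v : Fin n} (h : u ≠ v) :
    entry u v (cycleVec n σ) = if ∃ i, s(u, v) = s(σ i, σ (finRotate n i)) then 1 else 0 := by
  rw [entry_of_ne h]
  rfl

lemma cycleVec_mul (π σ : Equiv.Perm (Fin n)) :
    cycleVec n (π * σ) = act π (cycleVec n σ) := by
  refine ext_entry fun u v h => ?_
  have h' : π⁻¹ u ≠ π⁻¹ v := fun hh => h (π⁻¹.injective hh)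
  rw [entry_act, entry_cycleVec _ h, entry_cycleVec _ h']
  congr 1
  refine propext (exists_congr fun i => ?_)
  simp only [Sym2.eq_iff, Equiv.Perm.inv_eq_iff_eq, Equiv.Perm.mul_apply]

lemma cycleVec_mem_hamX (σ : Equiv.Perm (Fin n)) : cycleVec n σ ∈ hamX n :=
  Finset.mem_image_of_mem _ (Finset.mem_univ σ)

lemma mem_hamX {x : EdgeIdx n → ℝ} (hx : x ∈ hamX n) : ∃ σ, x = act σ (cycleVec n 1) := by
  obtain ⟨σ, -, rfl⟩ := Finset.mem_image.1 hx
  exact ⟨σ, by rw [← cycleVec_mul, mul_one]⟩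

lemma act_mem_hamX (π : Equiv.Perm (Fin n)) {x : EdgeIdx n → ℝ} (hx : x ∈ hamX n) :
    act π x ∈ hamX n := by
  obtain ⟨σ, -, rfl⟩ := Finset.mem_image.1 hx
  rw [← cycleVec_mul]
  exact cycleVec_mem_hamX _

lemma sum_hamX_act {M : Type*} [AddCommMonoid M] (π : Equiv.Perm (Fin n))
    (f : (EdgeIdx n → ℝ) → M) :
    ∑ x ∈ hamX n, f (act π x) = ∑ x ∈ hamX n, f x :=
  Finset.sum_nbij' (act π) (act π⁻¹) (fun _ hx => act_mem_hamX _ hx)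
    (fun _ hx => act_mem_hamX _ hx) (fun x _ => by simp [← act_mul, act_one])
    (fun x _ => by simp [← act_mul, act_one]) (fun _ _ => rfl)

lemma card_hamX_pos : (0 : ℝ) < (hamX n).card :=
  Nat.cast_pos.2 (Finset.card_pos.2 ⟨_, cycleVec_mem_hamX 1⟩)

lemma entry_eq_zero_or_one {x : EdgeIdx n → ℝ} (hx : x ∈ hamX n) (u v : Fin n) :
    entry u v x = 0 ∨ entry u v x = 1 := by
  by_cases h : u = v
  · left
    rw [h, entry_self]
  · obtain ⟨σ, -, rfl⟩ := Finset.mem_image.1 hx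
    rw [entry_cycleVec _ h]
    split_ifs <;> simp

lemma entry_nonneg {x : EdgeIdx n → ℝ} (hx : x ∈ hamX n) (u v : Fin n) : 0 ≤ entry u v x := by
  rcases entry_eq_zero_or_one hx u v with h | h <;> simp [h]

/-- The edges of the cycle `0, 1, …, n - 1`. -/
lemma entry_cycleVec_one [NeZero n] {u v : Fin n} (h : u ≠ v) :
    entry u v (cycleVec n 1) = if v = u + 1 ∨ u = v + 1 then 1 else 0 := by
  rw [entry_cycleVec _ h]
  congr 1
  refine propext ⟨?_, ?_⟩
  · rintro ⟨i, hi⟩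
    simp only [Equiv.Perm.one_apply, finRotate_apply, Sym2.eq_iff] at hi
    rcases hi with ⟨rfl, rfl⟩ | ⟨rfl, rfl⟩ <;> simp
  · rintro (rfl | rfl)
    · exact ⟨u, by simp⟩
    · exact ⟨v, by simp [Sym2.eq_swap]⟩

lemma val_add_one_of_lt [NeZero n] {i : Fin n} (h : i.val + 1 < n) : (i + 1).val = i.val + 1 := by
  have h1 : (1 : Fin n).val = 1 := by
    rw [Fin.val_one', Nat.mod_eq_of_lt (by omega)]
  rw [Fin.val_add, h1, Nat.mod_eq_of_lt h]

lemma val_add_one_of_eq [NeZero n] {i : Fin n} (hn : 2 ≤ n) (h : i.val + 1 = n) :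
    (i + 1).val = 0 := by
  have h1 : (1 : Fin n).val = 1 := by
    rw [Fin.val_one', Nat.mod_eq_of_lt (by omega)]
  rw [Fin.val_add, h1, h, Nat.mod_self]

lemma add_one_ne [NeZero n] (hn : 3 ≤ n) (i : Fin n) : i + 1 ≠ i ∧ i + 1 + 1 ≠ i := by
  have key : ∀ j : Fin n, (j + 1).val = j.val + 1 ∧ j.val + 1 < n ∨
      (j + 1).val = 0 ∧ j.val + 1 = n := by
    intro j
    rcases Nat.lt_or_ge (j.val + 1) n with h | h
    · exact .inl ⟨val_add_one_of_lt h, h⟩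
    · have h' : j.val + 1 = n := by omega
      exact .inr ⟨val_add_one_of_eq (by omega) h', h'⟩
  have h1 := key i
  have h2 := key (i + 1)
  constructor <;> intro h <;> rw [Fin.ext_iff] at h <;> omega

lemma sum_entry_hamX (hn : 3 ≤ n) {x : EdgeIdx n → ℝ} (hx : x ∈ hamX n) (u : Fin n) :
    ∑ v, entry u v x = 2 := by
  have : NeZero n := ⟨by omega⟩
  obtain ⟨σ, rfl⟩ := mem_hamX hx
  simp only [entry_act]
  rw [Equiv.sum_comp σ⁻¹ (fun v => entry (σ⁻¹ u) v (cycleVec n 1))]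
  generalize σ⁻¹ u = w
  have h1 := add_one_ne hn w
  have h2 := add_one_ne hn (w - 1)
  rw [sub_add_cancel] at h2
  have : ∀ v, entry w v (cycleVec n 1) =
      (if v = w + 1 then 1 else 0) + (if v = w - 1 then 1 else 0) := by
    intro v
    by_cases h : w = v
    · subst h
      rw [entry_self, if_neg (Ne.symm h1.1), if_neg h2.1]
      simp
    · rw [entry_cycleVec_one h]
      have h3 : w = v + 1 ↔ v = w - 1 := by rw [eq_sub_iff_add_eq, eq_comm]
      simp only [h3]
      by_cases ha : v = w + 1
      · have hb : v ≠ w - 1 := fun hb => h2.2 (ha.symm.trans hb)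
        simp [ha, ha ▸ hb]
      · simp [ha]
  simp_rw [this]
  rw [Finset.sum_add_distrib]
  simp
  norm_num

end Basic

section Polarity

variable {n k : ℕ}

/-- The degree of a vertex, as a linear functional on edge vectors. -/
def vertexDegree (u : Fin n) : (EdgeIdx n → ℝ) →ₗ[ℝ] ℝ := ∑ v, entry u v

lemma vertexDegree_apply (u : Fin n) (x : EdgeIdx n → ℝ) :
    vertexDegree u x = ∑ v, entry u v x := by
  simp [vertexDegree]

lemma vertexDegree_hamX (hn : 3 ≤ n) {x : EdgeIdx n → ℝ} (hx : x ∈ hamX n) (u : Fin n) :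
    vertexDegree u x = 2 := by
  rw [vertexDegree_apply, sum_entry_hamX hn hx]

lemma eq_of_mem_affineSpan {s : Set (EdgeIdx n → ℝ)} {D : (EdgeIdx n → ℝ) →ₗ[ℝ] ℝ} {c : ℝ}
    (hD : ∀ x ∈ s, D x = c) {p : EdgeIdx n → ℝ} (hp : p ∈ affineSpan ℝ s) : D p = c := by
  refine affineSpan_induction (p := fun y => D y = c) hp hD fun t u v w hu hv hw => ?_
  simp [hu, hv, hw]

lemma memP_of_nonneg {F : (EdgeIdx n → ℝ) →ₗ[ℝ] ℝ} (hF : ∀ x ∈ hamX n, 0 ≤ F x)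
    (h1 : ((hamX n).card : ℝ)⁻¹ * ∑ x ∈ hamX n, F x = 1) : memP n k F :=
  ⟨h1, fun _ _ => mul_nonneg (inv_nonneg.2 (Nat.cast_nonneg _))
    (Finset.sum_nonneg fun x hx => mul_nonneg (hF x hx) (sq_nonneg _))⟩

lemma mem_convexHull_of_memPolar (hn : 3 ≤ n) {p : EdgeIdx n → ℝ} (hp : memPolar n k p) :
    p ∈ convexHull ℝ (hamX n : Set (EdgeIdx n → ℝ)) := by
  by_contra hcon
  have hclosed : IsClosed (convexHull ℝ (hamX n : Set (EdgeIdx n → ℝ))) :=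
    ((hamX n).finite_toSet.isCompact_convexHull ℝ).isClosed
  obtain ⟨f, c, hfp, hfc⟩ := geometric_hahn_banach_point_closed (convex_convexHull ℝ _) hclosed hcon
  have hfX : ∀ x ∈ hamX n, c < f x := fun x hx => hfc x (subset_convexHull ℝ _ hx)
  let u : Fin n := ⟨0, by omega⟩
  let F : (EdgeIdx n → ℝ) →ₗ[ℝ] ℝ := f.toLinearMap - (c / 2) • vertexDegree u
  have hFX : ∀ x ∈ hamX n, 0 < F x := by
    intro x hx
    have := hfX x hx
    simp only [F, LinearMap.sub_apply, LinearMap.smul_apply, vertexDegree_hamX hn hx u,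
      ContinuousLinearMap.coe_coe, smul_eq_mul]
    linarith
  have hFp : F p < 0 := by
    have : vertexDegree u p = 2 :=
      eq_of_mem_affineSpan (fun x hx => vertexDegree_hamX hn hx u) hp.1
    simp only [F, LinearMap.sub_apply, LinearMap.smul_apply, this,
      ContinuousLinearMap.coe_coe, smul_eq_mul]
    linarith
  set s : ℝ := ((hamX n).card : ℝ)⁻¹ * ∑ x ∈ hamX n, F x with hs
  have hspos : 0 < s := mul_pos (inv_pos.2 card_hamX_pos)
    (Finset.sum_pos hFX ⟨_, cycleVec_mem_hamX 1⟩)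
  have hmem : memP n k (s⁻¹ • F) := by
    refine memP_of_nonneg (fun x hx => ?_) ?_
    · exact mul_nonneg (inv_nonneg.2 hspos.le) (hFX x hx).le
    · simp only [LinearMap.smul_apply, smul_eq_mul]
      rw [← Finset.mul_sum, mul_left_comm, ← hs, inv_mul_cancel₀ hspos.ne']
  have h0 := hp.2 _ hmem
  rw [LinearMap.smul_apply, smul_eq_mul] at h0
  exact absurd h0 (not_le.2 (mul_neg_of_pos_of_neg (inv_pos.2 hspos) hFp))

lemma map_bary (F : (EdgeIdx n → ℝ) →ₗ[ℝ] ℝ) :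
    F (bary n) = ((hamX n).card : ℝ)⁻¹ * ∑ x ∈ hamX n, F x := by
  simp [bary]

lemma bary_mem_convexHull : bary n ∈ convexHull ℝ (hamX n : Set (EdgeIdx n → ℝ)) := by
  rw [bary, Finset.smul_sum]
  refine (convex_convexHull ℝ _).sum_mem (fun _ _ => inv_nonneg.2 (Nat.cast_nonneg _)) ?_
    (fun x hx => subset_convexHull ℝ _ hx)
  rw [Finset.sum_const, nsmul_eq_mul, mul_inv_cancel₀ card_hamX_pos.ne']

/-- A uniform lower bound for `P_k` on `X` bounds the factor by which `P_k°` has to be dilated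
about the barycenter in order to contain `T_n`. -/
lemma exists_memPolar_of_lower_bound {a : ℝ} (ha : 0 < a)
    (hF : ∀ F, memP n k F → ∀ x ∈ hamX n, 1 - a ≤ F x) {p : EdgeIdx n → ℝ}
    (hp : p ∈ convexHull ℝ (hamX n : Set (EdgeIdx n → ℝ))) :
    ∃ q : EdgeIdx n → ℝ, memPolar n k q ∧ p - bary n = a • (q - bary n) := by
  refine ⟨AffineMap.lineMap (bary n) p a⁻¹, ⟨?_, fun F hmem => ?_⟩, ?_⟩
  · exact AffineMap.lineMap_mem _ (convexHull_subset_affineSpan _ bary_mem_convexHull)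
      (convexHull_subset_affineSpan _ hp)
  · have hb : F (bary n) = 1 := by rw [map_bary, hmem.1]
    have hFp : 1 - a ≤ F p :=
      convexHull_min (t := {y | 1 - a ≤ F y}) (fun x hx => hF F hmem x hx)
        (convex_halfSpace_ge F.isLinear _) hp
    rw [AffineMap.lineMap_apply_module', map_add, map_smul, map_sub, hb, smul_eq_mul]
    have : a⁻¹ * (1 - a - 1) = -1 := by field_simp; ring
    nlinarith [mul_le_mul_of_nonneg_left (sub_le_sub_right hFp 1) (inv_nonneg.2 ha.le)]
  · rw [AffineMap.lineMap_apply_module', add_sub_cancel_right, smul_smul,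
      mul_inv_cancel₀ ha.ne', one_smul]

end Polarity

section Permutations

variable {α : Type*} [DecidableEq α]

lemma exists_perm_map_pair {u v u' v' : α} (h : u ≠ v) (h' : u' ≠ v') :
    ∃ π : Equiv.Perm α, π u = u' ∧ π v = v' ∧
      ∀ y, y ≠ u → y ≠ v → y ≠ u' → y ≠ v' → π y = y := by
  refine ⟨Equiv.swap (Equiv.swap u u' v) v' * Equiv.swap u u', ?_, ?_, ?_⟩ <;>
    simp only [Equiv.Perm.mul_apply, Equiv.swap_apply_def] <;> grind

lemma exists_perm_commute_involution {μ : Equiv.Perm α} (hμ : ∀ y, μ (μ y) = y) {u u' : α}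
    (h : μ u ≠ u) (h' : μ u' ≠ u') :
    ∃ π : Equiv.Perm α, Commute π μ ∧ π u = u' ∧
      ∀ y, y ≠ u → y ≠ μ u → y ≠ u' → y ≠ μ u' → π y = y := by
  have hinj : ∀ y z, μ y = z ↔ y = μ z := fun y z => by
    constructor <;> rintro rfl <;> simp [hμ]
  by_cases h1 : u' = μ u
  · refine ⟨Equiv.swap u (μ u), Equiv.ext fun y => ?_, by simp [h1], ?_⟩ <;>
      simp only [Equiv.Perm.mul_apply, Equiv.swap_apply_def] <;> grind
  · refine ⟨Equiv.swap u u' * Equiv.swap (μ u) (μ u'), Equiv.ext fun y => ?_, ?_, ?_⟩ <;>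
      simp only [Equiv.Perm.mul_apply, Equiv.swap_apply_def] <;> grind

lemma exists_perm_commute_involution_pair {μ : Equiv.Perm α} (hμ : ∀ y, μ (μ y) = y)
    {u v u' v' : α} (hu : μ u ≠ u) (hv : μ v ≠ v) (hu' : μ u' ≠ u') (hv' : μ v' ≠ v')
    (h : u ≠ v) (h1 : μ u ≠ v) (h' : u' ≠ v') (h1' : μ u' ≠ v') :
    ∃ π : Equiv.Perm α, Commute π μ ∧ π u = u' ∧ π v = v' := by
  obtain ⟨π, hπ, hπu, -⟩ := exists_perm_commute_involution hμ hu hu'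
  have hcomm : ∀ y, π (μ y) = μ (π y) := fun y => congrArg (fun g : Equiv.Perm α => g y) hπ.eq
  have hv1 : μ (π v) ≠ π v := fun hh => hv (π.injective (by rw [hcomm, hh]))
  obtain ⟨ρ, hρ, hρv, hfix⟩ := exists_perm_commute_involution hμ hv1 hv'
  refine ⟨ρ * π, hρ.mul_left hπ, ?_, by simpa using hρv⟩
  rw [Equiv.Perm.mul_apply, hπu]
  refine hfix u' ?_ ?_ h' ?_
  · exact fun hh => h (π.injective (hπu.trans hh))
  · intro hh
    refine h1 (π.injective ?_)
    rw [hcomm, hπu, hh, hμ]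
  · intro hh
    exact h1' (by rw [hh, hμ])

end Permutations

section Barycenter

variable {n : ℕ}

lemma act_bary (π : Equiv.Perm (Fin n)) : act π (bary n) = bary n := by
  rw [bary, map_smul, map_sum, sum_hamX_act π (fun x => x)]

lemma vertexDegree_bary (hn : 3 ≤ n) (u : Fin n) : vertexDegree u (bary n) = 2 := by
  rw [map_bary, Finset.sum_congr rfl fun x hx => vertexDegree_hamX hn hx u, Finset.sum_const,
    nsmul_eq_mul, inv_mul_cancel_left₀ card_hamX_pos.ne']

lemma entry_bary (hn : 3 ≤ n) {u v : Fin n} (h : u ≠ v) : entry u v (bary n) = 2 / (n - 1) := by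
  have hconst : ∀ w, w ≠ u → entry u w (bary n) = entry u v (bary n) := by
    intro w hw
    obtain ⟨π, hu, hv, -⟩ := exists_perm_map_pair h hw.symm
    rw [← entry_act_apply π u v, act_bary, hu, hv]
  have hsum := vertexDegree_bary hn u
  rw [vertexDegree_apply, ← Finset.add_sum_erase _ _ (Finset.mem_univ u), entry_self, zero_add,
    Finset.sum_congr rfl fun w hw => hconst w (Finset.ne_of_mem_erase hw), Finset.sum_const,
    Finset.card_erase_of_mem (Finset.mem_univ u), Finset.card_univ, Fintype.card_fin,
    nsmul_eq_mul, Nat.cast_sub (by omega), Nat.cast_one] at hsum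
  have : (n : ℝ) - 1 ≠ 0 := by
    have : (3 : ℝ) ≤ n := by exact_mod_cast hn
    linarith
  rw [eq_div_iff this, mul_comm, hsum]

end Barycenter

section Pairing

/-- The involution of the vertices exchanging `2 * j` and `2 * j + 1` whenever both are vertices. -/
def pairing (n : ℕ) : Equiv.Perm (Fin n) :=
  Function.Involutive.toPerm
    (fun v => if v.val % 2 = 0 then if h : v.val + 1 < n then ⟨v.val + 1, h⟩ else v
      else ⟨v.val - 1, by omega⟩)
    (by
      intro v
      ext
      dsimp only
      split_ifs <;> simp_all <;> omega)

variable {n : ℕ}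

lemma pairing_apply (v : Fin n) : pairing n v =
    if v.val % 2 = 0 then if h : v.val + 1 < n then ⟨v.val + 1, h⟩ else v
      else ⟨v.val - 1, by omega⟩ := rfl

lemma pairing_pairing (v : Fin n) : pairing n (pairing n v) = v := by
  have : Function.Involutive (pairing n) := Function.Involutive.toPerm_involutive _
  exact this v

lemma val_pairing (v : Fin n) :
    (v.val % 2 = 0 ∧ v.val + 1 < n ∧ (pairing n v).val = v.val + 1) ∨
    (v.val % 2 = 0 ∧ v.val + 1 = n ∧ (pairing n v).val = v.val) ∨
    (v.val % 2 = 1 ∧ (pairing n v).val + 1 = v.val) := by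
  rw [pairing_apply]
  split_ifs with h1 h2
  · exact .inl ⟨h1, h2, rfl⟩
  · exact .inr (.inl ⟨h1, by omega, rfl⟩)
  · exact .inr (.inr ⟨by omega, by simp only []; omega⟩)

lemma pairing_eq_self_iff (v : Fin n) : pairing n v = v ↔ n % 2 = 1 ∧ v.val + 1 = n := by
  rw [Fin.ext_iff]
  have := val_pairing v
  omega

/-- Paired vertices are neighbours on the cycle `0, 1, …, n - 1`. -/
lemma pairing_eq_imp [NeZero n] {u v : Fin n} (h : u ≠ v) (huv : pairing n u = v) :
    v = u + 1 ∨ u = v + 1 := by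
  subst huv
  have hv := val_pairing u
  rcases hv with hv | hv | hv
  · left
    rw [Fin.ext_iff, val_add_one_of_lt hv.2.1, hv.2.2]
  · exact absurd (Fin.ext hv.2.2.symm) h
  · right
    rw [Fin.ext_iff, val_add_one_of_lt (by omega), hv.2]

lemma card_filter_pairing_eq_self (hn : 0 < n) :
    (Finset.univ.filter fun v : Fin n => pairing n v = v).card = n % 2 := by
  rcases Nat.mod_two_eq_zero_or_one n with h | h
  · rw [h, Finset.card_eq_zero, Finset.filter_eq_empty_iff]
    intro v _
    rw [pairing_eq_self_iff]
    omega
  · rw [h, Finset.card_eq_one]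
    refine ⟨⟨n - 1, by omega⟩, ?_⟩
    ext v
    rw [Finset.mem_filter, pairing_eq_self_iff, Finset.mem_singleton, Fin.ext_iff]
    simp only [Finset.mem_univ, true_and]
    omega

end Pairing

section Pinned

/-- The even vertices below `2 * k`: one vertex of each of the first `k` pairs. -/
def evenBelow (n k : ℕ) : Finset (Fin n) :=
  Finset.univ.filter fun u => u.val < 2 * k ∧ u.val % 2 = 0

/-- On `X`, the indicator of the cycles which contain the first `k` pairs. -/
def pinInd (n k : ℕ) (x : EdgeIdx n → ℝ) : ℝ :=
  ∏ u ∈ evenBelow n k, entry u (pairing n u) x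

/-- The number of cycles which contain the first `k` pairs. -/
def pinCount (n k : ℕ) : ℝ := ∑ x ∈ hamX n, pinInd n k x

/-- The sum of the cycles which contain the first `k` pairs. -/
def pinSum (n k : ℕ) : EdgeIdx n → ℝ := ∑ x ∈ hamX n, pinInd n k x • x

/-- The polynomial whose value is `entry u v`. -/
def entryPoly {n : ℕ} (u v : Fin n) : MvPolynomial (EdgeIdx n) ℝ :=
  if h : u = v then 0 else MvPolynomial.X ⟨s(u, v), by simpa using h⟩

variable {n k : ℕ}

lemma eval_entryPoly (u v : Fin n) (x : EdgeIdx n → ℝ) :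
    MvPolynomial.eval x (entryPoly u v) = entry u v x := by
  by_cases h : u = v <;> simp [entryPoly, entry, h]

lemma totalDegree_entryPoly_le (u v : Fin n) : (entryPoly u v).totalDegree ≤ 1 := by
  by_cases h : u = v <;> simp [entryPoly, h]

lemma card_evenBelow_le (n k : ℕ) : (evenBelow n k).card ≤ k := by
  have : (evenBelow n k).card ≤ (Finset.range k).card := by
    refine Finset.card_le_card_of_injOn (fun u => u.val / 2) (fun u hu => ?_) ?_
    · have := (Finset.mem_filter.1 hu).2
      simp only [Finset.coe_range, Set.mem_Iio]
      omega
    · intro u hu v hv huv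
      have h1 := (Finset.mem_filter.1 hu).2
      have h2 := (Finset.mem_filter.1 hv).2
      simp only at huv
      ext
      omega
  simpa using this

lemma pinInd_eq_zero_or_one {x : EdgeIdx n → ℝ} (hx : x ∈ hamX n) :
    pinInd n k x = 0 ∨ pinInd n k x = 1 := by
  by_cases h : ∃ u ∈ evenBelow n k, entry u (pairing n u) x = 0
  · obtain ⟨u, hu, h0⟩ := h
    exact .inl (Finset.prod_eq_zero hu h0)
  · push Not at h
    exact .inr (Finset.prod_eq_one fun u hu =>
      (entry_eq_zero_or_one hx u _).resolve_left (h u hu))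

lemma pinInd_nonneg {x : EdgeIdx n → ℝ} (hx : x ∈ hamX n) : 0 ≤ pinInd n k x :=
  Finset.prod_nonneg fun _ _ => entry_nonneg hx _ _

lemma pinInd_sq {x : EdgeIdx n → ℝ} (hx : x ∈ hamX n) : pinInd n k x ^ 2 = pinInd n k x := by
  rcases pinInd_eq_zero_or_one (k := k) hx with h | h <;> simp [h]

lemma pinInd_act_of_fixed {π : Equiv.Perm (Fin n)} (hπ : ∀ u : Fin n, u.val < 2 * k → π u = u)
    (x : EdgeIdx n → ℝ) : pinInd n k (act π x) = pinInd n k x := by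
  refine Finset.prod_congr rfl fun u hu => ?_
  have hu := (Finset.mem_filter.1 hu).2
  have h1 := hπ u hu.1
  have h2 := hπ (pairing n u) (by have := val_pairing u; omega)
  rw [← entry_act_apply π u (pairing n u) x, h1, h2]

lemma pinInd_mul_entry {x : EdgeIdx n → ℝ} (hx : x ∈ hamX n) {u : Fin n} (hu : u.val < 2 * k) :
    pinInd n k x * entry u (pairing n u) x = pinInd n k x := by
  obtain ⟨w, hw, hwu⟩ : ∃ w ∈ evenBelow n k,
      entry w (pairing n w) x = entry u (pairing n u) x := by
    by_cases h : u.val % 2 = 0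
    · exact ⟨u, by simp [evenBelow, hu, h], rfl⟩
    · refine ⟨pairing n u, ?_, by rw [pairing_pairing, entry_comm]⟩
      have := val_pairing u
      rw [evenBelow, Finset.mem_filter]
      exact ⟨Finset.mem_univ _, by omega, by omega⟩
  rw [← hwu]
  rcases entry_eq_zero_or_one hx w (pairing n w) with h | h
  · rw [pinInd, Finset.prod_eq_zero hw h, zero_mul]
  · rw [h, mul_one]

lemma pinCount_pos (hk : 2 * k ≤ n) : 0 < pinCount n k := by
  refine Finset.sum_pos' (fun x hx => pinInd_nonneg hx) ⟨_, cycleVec_mem_hamX 1, ?_⟩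
  refine Finset.prod_pos fun u hu => ?_
  have hu := (Finset.mem_filter.1 hu).2
  have : NeZero n := ⟨by have := u.isLt; omega⟩
  have hne : u ≠ pairing n u := by
    intro h
    have := (pairing_eq_self_iff u).1 h.symm
    omega
  rw [entry_cycleVec_one hne, if_pos (pairing_eq_imp hne rfl)]
  exact one_pos

lemma entry_pinSum (u v : Fin n) :
    entry u v (pinSum n k) = ∑ x ∈ hamX n, pinInd n k x * entry u v x := by
  simp [pinSum]

lemma entry_pinSum_nonneg (u v : Fin n) : 0 ≤ entry u v (pinSum n k) := by
  rw [entry_pinSum]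
  exact Finset.sum_nonneg fun x hx => mul_nonneg (pinInd_nonneg hx) (entry_nonneg hx _ _)

lemma sum_entry_pinSum (hn : 3 ≤ n) (u : Fin n) :
    ∑ v, entry u v (pinSum n k) = 2 * pinCount n k := by
  simp_rw [entry_pinSum]
  rw [Finset.sum_comm, pinCount, Finset.mul_sum]
  refine Finset.sum_congr rfl fun x hx => ?_
  rw [← Finset.mul_sum, sum_entry_hamX hn hx, mul_comm]

lemma entry_pinSum_pairing {u : Fin n} (hu : u.val < 2 * k) :
    entry u (pairing n u) (pinSum n k) = pinCount n k := by
  rw [entry_pinSum]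
  exact Finset.sum_congr rfl fun x hx => pinInd_mul_entry hx hu

lemma act_pinSum_of_fixed {π : Equiv.Perm (Fin n)} (hπ : ∀ u : Fin n, u.val < 2 * k → π u = u) :
    act π (pinSum n k) = pinSum n k := by
  rw [pinSum, map_sum, ← sum_hamX_act π fun x => pinInd n k x • x]
  exact Finset.sum_congr rfl fun x _ => by rw [map_smul, pinInd_act_of_fixed hπ]

lemma map_act_pinSum_nonneg {F : (EdgeIdx n → ℝ) →ₗ[ℝ] ℝ} (hF : memP n k F)
    (π : Equiv.Perm (Fin n)) : 0 ≤ F (act π (pinSum n k)) := by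
  let h : MvPolynomial (EdgeIdx n) ℝ := ∏ u ∈ evenBelow n k, entryPoly (π u) (π (pairing n u))
  have hdeg : h.totalDegree ≤ k := by
    refine (MvPolynomial.totalDegree_finsetProd _ _).trans ?_
    refine (Finset.sum_le_sum fun u _ => totalDegree_entryPoly_le _ _).trans ?_
    simpa using card_evenBelow_le n k
  have heval : ∀ x, MvPolynomial.eval (act π x) h = pinInd n k x := by
    intro x
    simp only [h, map_prod, eval_entryPoly, entry_act_apply, pinInd]
  have hpos := hF.2 h hdeg
  rw [mul_nonneg_iff_of_pos_left (inv_pos.2 card_hamX_pos),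
    ← sum_hamX_act π fun x => F x * (MvPolynomial.eval x h) ^ 2] at hpos
  refine hpos.trans_eq ?_
  rw [pinSum, map_sum, map_sum]
  refine Finset.sum_congr rfl fun x hx => ?_
  rw [heval, pinInd_sq hx, map_smul, map_smul, smul_eq_mul, mul_comm]

/-- The vertices outside the first `k` pairs are interchangeable. -/
lemma exists_entry_pinSum_eq (n k : ℕ) : ∃ c : ℝ, 0 ≤ c ∧ ∀ u v : Fin n, u ≠ v →
    2 * k ≤ u.val → 2 * k ≤ v.val → entry u v (pinSum n k) = c := by
  by_cases h : ∃ u v : Fin n, u ≠ v ∧ 2 * k ≤ u.val ∧ 2 * k ≤ v.val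
  · obtain ⟨u, v, huv, hu, hv⟩ := h
    refine ⟨entry u v (pinSum n k), entry_pinSum_nonneg u v, fun u' v' huv' hu' hv' => ?_⟩
    obtain ⟨π, h1, h2, hfix⟩ := exists_perm_map_pair huv huv'
    rw [← h1, ← h2, ← entry_act_apply π u v, act_pinSum_of_fixed]
    intro y hy
    apply hfix y <;> rintro rfl <;> omega
  · exact ⟨0, le_rfl, fun u v huv hu hv => absurd ⟨u, v, huv, hu, hv⟩ h⟩

end Pinned

section PinnedBounds

variable {n k : ℕ}

lemma card_filter_val_lt (hk : 2 * k ≤ n) :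
    (Finset.univ.filter fun u : Fin n => u.val < 2 * k).card = 2 * k := by
  rw [Fin.card_filter_val_lt, min_eq_right hk]

lemma card_filter_not_val_lt (hk : 2 * k ≤ n) :
    ((Finset.univ.filter fun u : Fin n => ¬ u.val < 2 * k).card : ℝ) = n - 2 * k := by
  have h := Finset.card_filter_add_card_filter_not (s := (Finset.univ : Finset (Fin n)))
    (fun u : Fin n => u.val < 2 * k)
  rw [card_filter_val_lt hk, Finset.card_univ, Fintype.card_fin] at h
  have h' : ((2 * k + (Finset.univ.filter fun u : Fin n => ¬ u.val < 2 * k).card : ℕ) : ℝ) = n := by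
    exact_mod_cast h
  push_cast at h'
  linarith

lemma sum_entry_pairing_pinSum (hk : 2 * k ≤ n) (hn : 0 < n) {c : ℝ}
    (hc : ∀ u v : Fin n, u ≠ v → 2 * k ≤ u.val → 2 * k ≤ v.val → entry u v (pinSum n k) = c) :
    ∑ u, entry u (pairing n u) (pinSum n k) =
      2 * k * pinCount n k + (n - 2 * k - (n % 2 : ℕ)) * c := by
  have hpt : ∀ u : Fin n, entry u (pairing n u) (pinSum n k) =
      (if u.val < 2 * k then 1 else 0) * pinCount n k +
      (1 - (if u.val < 2 * k then 1 else 0) - (if pairing n u = u then 1 else 0)) * c := by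
    intro u
    have h1 := pairing_eq_self_iff u
    have h2 := val_pairing u
    by_cases h : u.val < 2 * k
    · rw [entry_pinSum_pairing h, if_pos h, if_neg (by rw [h1]; omega)]
      ring
    · by_cases h3 : pairing n u = u
      · simp [h, h3, entry_self]
      · rw [hc _ _ (Ne.symm h3) (by omega) (by omega), if_neg h, if_neg h3]
        ring
  simp_rw [hpt]
  rw [Finset.sum_add_distrib, ← Finset.sum_mul, ← Finset.sum_mul, Finset.sum_sub_distrib,
    Finset.sum_sub_distrib, Finset.sum_boole, Finset.sum_boole, card_filter_val_lt hk,
    card_filter_pairing_eq_self hn]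
  simp

lemma two_mul_pinCount_le (hk : 2 * k ≤ n) (hn : 3 ≤ n) {c : ℝ}
    (hc : ∀ u v : Fin n, u ≠ v → 2 * k ≤ u.val → 2 * k ≤ v.val → entry u v (pinSum n k) = c) :
    2 * (n - 3 * k) * pinCount n k ≤ (n - 2 * k) * (n - 2 * k - 1) * c := by
  set A : Fin n → Fin n → ℝ := fun u v => entry u v (pinSum n k) with hA
  set K : Finset (Fin n) := Finset.univ.filter fun u : Fin n => u.val < 2 * k with hK
  set U : Finset (Fin n) := Finset.univ.filter fun u : Fin n => ¬ u.val < 2 * k with hU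
  have hcardU : (U.card : ℝ) = n - 2 * k := card_filter_not_val_lt hk
  have hrow : ∀ u, ∑ v ∈ K, A u v + ∑ v ∈ U, A u v = 2 * pinCount n k := fun u => by
    rw [hK, hU, Finset.sum_filter_add_sum_filter_not, sum_entry_pinSum hn]
  have hUU : ∑ u ∈ U, ∑ v ∈ U, A u v = (n - 2 * k) * (n - 2 * k - 1) * c := by
    have : ∀ u ∈ U, ∑ v ∈ U, A u v = (n - 2 * k - 1) * c := by
      intro u hu
      have hu' := (Finset.mem_filter.1 hu).2
      have : ∀ v ∈ U, A u v = c - if v = u then c else 0 := by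
        intro v hv
        have hv' := (Finset.mem_filter.1 hv).2
        by_cases h : v = u
        · simp [hA, h, entry_self]
        · rw [if_neg h, sub_zero]
          exact hc u v (Ne.symm h) (by omega) (by omega)
      rw [Finset.sum_congr rfl this, Finset.sum_sub_distrib, Finset.sum_const,
        Finset.sum_ite_eq' U u, if_pos hu, nsmul_eq_mul, hcardU]
      ring
    rw [Finset.sum_congr rfl this, Finset.sum_const, nsmul_eq_mul, hcardU]
    ring
  have hKU : ∑ v ∈ K, ∑ u ∈ U, A v u ≤ 2 * k * pinCount n k := by
    have : ∀ v ∈ K, ∑ u ∈ U, A v u ≤ pinCount n k := by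
      intro v hv
      have hv' := (Finset.mem_filter.1 hv).2
      have hmem : pairing n v ∈ K :=
        Finset.mem_filter.2 ⟨Finset.mem_univ _, by have := val_pairing v; omega⟩
      have h1 : A v (pairing n v) ≤ ∑ u ∈ K, A v u :=
        Finset.single_le_sum (f := A v) (fun u _ => entry_pinSum_nonneg v u) hmem
      have h2 : A v (pairing n v) = pinCount n k := entry_pinSum_pairing hv'
      linarith [hrow v]
    refine (Finset.sum_le_sum this).trans_eq ?_
    rw [Finset.sum_const, nsmul_eq_mul, card_filter_val_lt hk]
    push_cast
    ring
  have htot : ∑ u ∈ U, (∑ v ∈ K, A u v + ∑ v ∈ U, A u v) = (n - 2 * k) * (2 * pinCount n k) := by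
    rw [Finset.sum_congr rfl fun u _ => hrow u, Finset.sum_const, nsmul_eq_mul, hcardU]
  rw [Finset.sum_add_distrib, hUU, Finset.sum_comm] at htot
  have hsymm : ∑ v ∈ K, ∑ u ∈ U, A u v = ∑ v ∈ K, ∑ u ∈ U, A v u :=
    Finset.sum_congr rfl fun v _ => Finset.sum_congr rfl fun u _ => entry_comm _ _ _
  linarith

end PinnedBounds

section PairSym

/-- The permutations which preserve the pairing. -/
def pairingCentralizer (n : ℕ) : Finset (Equiv.Perm (Fin n)) :=
  Finset.univ.filter fun g => Commute g (pairing n)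

/-- The symmetrization of `pinSum` under the permutations which preserve the pairing. -/
def pairSym (n k : ℕ) : EdgeIdx n → ℝ := ∑ g ∈ pairingCentralizer n, act g (pinSum n k)

variable {n k : ℕ}

lemma act_pairSym {π : Equiv.Perm (Fin n)} (hπ : Commute π (pairing n)) :
    act π (pairSym n k) = pairSym n k := by
  rw [pairSym, map_sum]
  simp_rw [← act_mul]
  refine Finset.sum_nbij' (π * ·) (π⁻¹ * ·) ?_ ?_ ?_ ?_ ?_
  · intro g hg
    exact Finset.mem_filter.2 ⟨Finset.mem_univ _, hπ.mul_left (Finset.mem_filter.1 hg).2⟩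
  · intro g hg
    exact Finset.mem_filter.2
      ⟨Finset.mem_univ _, hπ.inv_left.mul_left (Finset.mem_filter.1 hg).2⟩
  · simp
  · simp
  · simp

lemma entry_pairSym_map {π : Equiv.Perm (Fin n)} (hπ : Commute π (pairing n)) (u v : Fin n) :
    entry (π u) (π v) (pairSym n k) = entry u v (pairSym n k) := by
  rw [← entry_act_apply π u v, act_pairSym hπ]

lemma entry_pairSym (u v : Fin n) : entry u v (pairSym n k) =
    ∑ g ∈ pairingCentralizer n, entry (g⁻¹ u) (g⁻¹ v) (pinSum n k) := by
  simp only [pairSym, map_sum, entry_act]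

lemma sum_entry_pairSym (hn : 3 ≤ n) (u : Fin n) : ∑ v, entry u v (pairSym n k) =
    2 * ((pairingCentralizer n).card * pinCount n k) := by
  simp_rw [entry_pairSym]
  rw [Finset.sum_comm]
  have : ∀ g ∈ pairingCentralizer n,
      ∑ v, entry (g⁻¹ u) (g⁻¹ v) (pinSum n k) = 2 * pinCount n k := fun g _ => by
    rw [Equiv.sum_comp g⁻¹ (fun v => entry (g⁻¹ u) v (pinSum n k)), sum_entry_pinSum hn]
  rw [Finset.sum_congr rfl this, Finset.sum_const, nsmul_eq_mul]
  ring

lemma sum_entry_pairing_pairSym : ∑ u, entry u (pairing n u) (pairSym n k) =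
    (pairingCentralizer n).card * ∑ u, entry u (pairing n u) (pinSum n k) := by
  simp_rw [entry_pairSym]
  rw [Finset.sum_comm]
  have : ∀ g ∈ pairingCentralizer n, ∑ u, entry (g⁻¹ u) (g⁻¹ (pairing n u)) (pinSum n k) =
      ∑ u, entry u (pairing n u) (pinSum n k) := by
    intro g hg
    have hcomm : ∀ u, g⁻¹ (pairing n u) = pairing n (g⁻¹ u) := fun u =>
      congrArg (fun h : Equiv.Perm (Fin n) => h u) (Finset.mem_filter.1 hg).2.inv_left.eq
    simp_rw [hcomm]
    exact Equiv.sum_comp g⁻¹ (fun u => entry u (pairing n u) (pinSum n k))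
  rw [Finset.sum_congr rfl this, Finset.sum_const, nsmul_eq_mul]

/-- The indicator of the unpaired vertices. -/
def unpaired (u : Fin n) : ℝ := if pairing n u = u then 1 else 0

lemma sum_unpaired (hn : 0 < n) : ∑ u : Fin n, unpaired u = (n % 2 : ℕ) := by
  rw [← card_filter_pairing_eq_self hn]
  simp only [unpaired, Finset.sum_boole]

lemma pairing_ne_self_pairing {u : Fin n} (hu : pairing n u ≠ u) :
    pairing n (pairing n u) ≠ pairing n u := by
  rw [pairing_pairing]
  exact hu.symm

lemma exists_entry_pairSym_pairing (hn : 2 ≤ n) :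
    ∃ l : ℝ, ∀ u, pairing n u ≠ u → entry u (pairing n u) (pairSym n k) = l := by
  have h0 : pairing n ⟨0, by omega⟩ ≠ ⟨0, by omega⟩ := by
    rw [Ne, pairing_eq_self_iff]
    dsimp only
    omega
  refine ⟨entry ⟨0, by omega⟩ (pairing n ⟨0, by omega⟩) (pairSym n k), fun u hu => ?_⟩
  obtain ⟨π, hπ, h1, -⟩ := exists_perm_commute_involution pairing_pairing h0 hu
  have hcomm : π (pairing n ⟨0, by omega⟩) = pairing n (π ⟨0, by omega⟩) :=
    congrArg (fun h : Equiv.Perm (Fin n) => h ⟨0, by omega⟩) hπ.eq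
  rw [← entry_pairSym_map hπ ⟨0, by omega⟩ (pairing n ⟨0, by omega⟩), hcomm, h1]

lemma exists_entry_pairSym_eq (hn : 4 ≤ n) : ∃ l₀ l₁ : ℝ, ∀ u v : Fin n, u ≠ v →
    pairing n u ≠ v → entry u v (pairSym n k) = l₀ + (l₁ - l₀) * (unpaired u + unpaired v) := by
  have hval : ∀ i (hi : i < n), i < 3 → pairing n ⟨i, hi⟩ ≠ ⟨i, hi⟩ := by
    intro i hi hi3
    rw [Ne, pairing_eq_self_iff]
    dsimp only
    omega
  have h0 := hval 0 (by omega) (by omega)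
  have h2 := hval 2 (by omega) (by omega)
  have h02 : pairing n ⟨0, by omega⟩ ≠ ⟨2, by omega⟩ := by
    rw [Ne, Fin.ext_iff]
    have := val_pairing (⟨0, by omega⟩ : Fin n)
    dsimp only at this ⊢
    omega
  set l₀ := entry ⟨0, by omega⟩ ⟨2, by omega⟩ (pairSym n k) with hl₀
  set l₁ := entry ⟨0, by omega⟩ ⟨n - 1, by omega⟩ (pairSym n k) with hl₁
  have hfree : ∀ u v : Fin n, pairing n u ≠ u → pairing n v = v →
      entry u v (pairSym n k) = l₁ := by
    intro u v hu hv
    obtain ⟨π, hπ, h1, hfix⟩ := exists_perm_commute_involution pairing_pairing h0 hu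
    have hvn : (⟨n - 1, by omega⟩ : Fin n) = v := by
      rw [Fin.ext_iff]
      have := (pairing_eq_self_iff v).1 hv
      dsimp only
      omega
    have hne : ∀ w : Fin n, pairing n w ≠ w → v ≠ w ∧ v ≠ pairing n w := by
      refine fun w hw => ⟨fun h => hw (h ▸ hv), fun h => ?_⟩
      rw [h, pairing_pairing] at hv
      exact hw hv.symm
    have hπv : π v = v := hfix v (hne _ h0).1 (hne _ h0).2 (hne _ hu).1 (hne _ hu).2
    rw [hl₁, ← entry_pairSym_map hπ ⟨0, by omega⟩, h1, hvn, hπv]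
  refine ⟨l₀, l₁, fun u v huv hpair => ?_⟩
  by_cases hu : pairing n u = u
  · have hv : pairing n v ≠ v := by
      intro hv
      rw [pairing_eq_self_iff] at hu hv
      exact huv (Fin.ext (by omega))
    rw [entry_comm, hfree v u hv hu]
    simp [unpaired, hu, hv]
  · by_cases hv : pairing n v = v
    · rw [hfree u v hu hv]
      simp [unpaired, hu, hv]
    · obtain ⟨π, hπ, h1, h3⟩ := exists_perm_commute_involution_pair pairing_pairing h0 h2 hu hv
        (by simp [Fin.ext_iff]) h02 huv hpair
      rw [← h1, ← h3, entry_pairSym_map hπ, h1, h3]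
      simp [unpaired, hu, hv, hl₀]

end PairSym

section CycleSym

variable {n k : ℕ}

lemma exists_pairSym_relations (hn : 4 ≤ n) (hk : 2 * k ≤ n) : ∃ R l l₀ l₁ C : ℝ,
    R = (pairingCentralizer n).card * pinCount n k ∧ 0 ≤ C ∧
    (∀ u v : Fin n, u ≠ v → pairing n u ≠ v →
      entry u v (pairSym n k) = l₀ + (l₁ - l₀) * (unpaired u + unpaired v)) ∧
    l + (n - 2) * l₀ + (n % 2 : ℕ) * (l₁ - l₀) = 2 * R ∧
    (n % 2 = 1 → (n - 1) * l₁ = 2 * R) ∧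
    (n - (n % 2 : ℕ)) * l = 2 * k * R + (n - 2 * k - (n % 2 : ℕ)) * C ∧
    2 * (n - 3 * k) * R ≤ (n - 2 * k) * (n - 2 * k - 1) * C := by
  obtain ⟨l, hl⟩ := exists_entry_pairSym_pairing (n := n) (k := k) (by omega)
  obtain ⟨l₀, l₁, hoff⟩ := exists_entry_pairSym_eq (n := n) (k := k) hn
  obtain ⟨c, hc0, hc⟩ := exists_entry_pinSum_eq n k
  have hcard : (0 : ℝ) ≤ (pairingCentralizer n).card := Nat.cast_nonneg _
  refine ⟨_, l, l₀, l₁, (pairingCentralizer n).card * c, rfl, mul_nonneg hcard hc0, hoff,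
    ?_, ?_, ?_, ?_⟩
  · let u : Fin n := ⟨0, by omega⟩
    have hu : pairing n u ≠ u := by
      rw [Ne, pairing_eq_self_iff]
      dsimp only [u]
      omega
    have hpt : ∀ v, entry u v (pairSym n k) = l₀ + (l₁ - l₀) * unpaired v -
        (if v = u then l₀ else 0) + (if v = pairing n u then l - l₀ else 0) := by
      intro v
      by_cases h1 : v = u
      · subst h1
        rw [entry_self, if_pos rfl, if_neg hu.symm, unpaired, if_neg hu]
        ring
      · by_cases h2 : v = pairing n u
        · subst h2
          rw [hl u hu, if_neg hu, if_pos rfl, unpaired, if_neg (pairing_ne_self_pairing hu)]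
          ring
        · rw [hoff u v (Ne.symm h1) (Ne.symm h2), if_neg h1, if_neg h2, unpaired, if_neg hu]
          ring
    have hsum := sum_entry_pairSym (k := k) (by omega : 3 ≤ n) u
    simp_rw [hpt] at hsum
    rw [Finset.sum_add_distrib, Finset.sum_sub_distrib, Finset.sum_add_distrib, ← Finset.mul_sum,
      sum_unpaired (by omega), Finset.sum_ite_eq' Finset.univ u,
      Finset.sum_ite_eq' Finset.univ (pairing n u), if_pos (Finset.mem_univ _),
      if_pos (Finset.mem_univ _), Finset.sum_const, Finset.card_univ, Fintype.card_fin,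
      nsmul_eq_mul] at hsum
    linarith
  · intro hodd
    let u : Fin n := ⟨n - 1, by omega⟩
    have hu : pairing n u = u := by
      rw [pairing_eq_self_iff]
      dsimp only [u]
      omega
    have hpt : ∀ v, entry u v (pairSym n k) = l₁ - (if v = u then l₁ else 0) := by
      intro v
      by_cases h1 : v = u
      · subst h1
        rw [entry_self, if_pos rfl, sub_self]
      · have hv : pairing n v ≠ v := by
          intro hv
          rw [pairing_eq_self_iff] at hv
          exact h1 (Fin.ext (by dsimp only [u]; omega))
        rw [hoff u v (Ne.symm h1) (by rw [hu]; exact Ne.symm h1), if_neg h1, unpaired, unpaired,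
          if_pos hu, if_neg hv]
        ring
    have hsum := sum_entry_pairSym (k := k) (by omega : 3 ≤ n) u
    simp_rw [hpt] at hsum
    rw [Finset.sum_sub_distrib, Finset.sum_ite_eq' Finset.univ u, if_pos (Finset.mem_univ _),
      Finset.sum_const, Finset.card_univ, Fintype.card_fin, nsmul_eq_mul] at hsum
    linarith
  · have hpt : ∀ u, entry u (pairing n u) (pairSym n k) = l - l * unpaired u := by
      intro u
      by_cases hu : pairing n u = u
      · rw [unpaired, if_pos hu, hu, entry_self]
        ring
      · rw [hl u hu, unpaired, if_neg hu]
        ring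
    have hsum := sum_entry_pairing_pairSym (n := n) (k := k)
    rw [sum_entry_pairing_pinSum hk (by omega) hc] at hsum
    simp_rw [hpt] at hsum
    rw [Finset.sum_sub_distrib, ← Finset.mul_sum, sum_unpaired (by omega), Finset.sum_const,
      Finset.card_univ, Fintype.card_fin, nsmul_eq_mul] at hsum
    linarith
  · have := mul_le_mul_of_nonneg_left (two_mul_pinCount_le hk (by omega) hc) hcard
    linarith

/-- The symmetrization of `pairSym` under the rotations of the cycle `0, 1, …, n - 1`. -/
def cycleSym (n k : ℕ) [NeZero n] : EdgeIdx n → ℝ :=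
  ∑ r : Fin n, act (Equiv.addRight r) (pairSym n k)

variable [NeZero n]

lemma entry_cycleSym (u v : Fin n) :
    entry u v (cycleSym n k) = ∑ r, entry (u - r) (v - r) (pairSym n k) := by
  simp only [cycleSym, map_sum, entry_act]
  exact Finset.sum_congr rfl fun r _ => by simp [sub_eq_add_neg, Equiv.Perm.inv_def]

lemma entry_cycleSym_add (u v t : Fin n) :
    entry (u + t) (v + t) (cycleSym n k) = entry u v (cycleSym n k) := by
  rw [entry_cycleSym, entry_cycleSym, ← Equiv.sum_comp (Equiv.addRight t)]
  exact Finset.sum_congr rfl fun r _ => by simp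

lemma sum_entry_cycleSym (hn : 3 ≤ n) (u : Fin n) : ∑ v, entry u v (cycleSym n k) =
    2 * (n * ((pairingCentralizer n).card * pinCount n k)) := by
  simp_rw [entry_cycleSym]
  rw [Finset.sum_comm]
  have : ∀ r ∈ (Finset.univ : Finset (Fin n)), ∑ v, entry (u - r) (v - r) (pairSym n k) =
      2 * ((pairingCentralizer n).card * pinCount n k) := fun r _ => by
    rw [← sum_entry_pairSym hn (u - r)]
    exact Equiv.sum_comp (Equiv.subRight r) (fun v => entry (u - r) v (pairSym n k))
  rw [Finset.sum_congr rfl this, Finset.sum_const, Finset.card_univ, Fintype.card_fin,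
    nsmul_eq_mul]
  ring

lemma entry_cycleSym_of_not_adj {l₀ l₁ : ℝ} (h : ∀ u v : Fin n, u ≠ v → pairing n u ≠ v →
      entry u v (pairSym n k) = l₀ + (l₁ - l₀) * (unpaired u + unpaired v))
    {u v : Fin n} (huv : u ≠ v) (hadj : ¬ (v = u + 1 ∨ u = v + 1)) :
    entry u v (cycleSym n k) = n * l₀ + 2 * (n % 2 : ℕ) * (l₁ - l₀) := by
  have hpt : ∀ r, entry (u - r) (v - r) (pairSym n k) =
      l₀ + (l₁ - l₀) * (unpaired (u - r) + unpaired (v - r)) := by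
    intro r
    have hne : u - r ≠ v - r := fun hh => huv (sub_left_injective hh)
    refine h _ _ hne fun hp => hadj ?_
    rcases pairing_eq_imp hne hp with h1 | h1
    · left
      rw [sub_add_eq_add_sub] at h1
      exact sub_left_injective h1
    · right
      rw [sub_add_eq_add_sub] at h1
      exact sub_left_injective h1
  have hsum : ∀ w : Fin n, ∑ r, unpaired (w - r) = (n % 2 : ℕ) := fun w => by
    rw [← sum_unpaired (Nat.pos_of_ne_zero (NeZero.ne n))]
    exact Equiv.sum_comp (Equiv.subLeft w) unpaired
  rw [entry_cycleSym, Finset.sum_congr rfl fun r _ => hpt r, Finset.sum_add_distrib,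
    ← Finset.mul_sum, Finset.sum_add_distrib, hsum, hsum, Finset.sum_const, Finset.card_univ,
    Fintype.card_fin, nsmul_eq_mul]
  ring

lemma cycleSym_eq (hn : 3 ≤ n) {q : ℝ} (hq : ∀ u v : Fin n, u ≠ v →
      ¬ (v = u + 1 ∨ u = v + 1) → entry u v (cycleSym n k) = q) :
    cycleSym n k = (q * (n - 1) / 2) • bary n +
      (n * ((pairingCentralizer n).card * pinCount n k) - q * (n - 1) / 2) • cycleVec n 1 := by
  set p := entry 0 1 (cycleSym n k) with hp
  have hadj : ∀ u : Fin n, entry u (u + 1) (cycleSym n k) = p := fun u => by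
    rw [hp, ← entry_cycleSym_add 0 1 u, zero_add, add_comm]
  have hent : ∀ u v : Fin n, u ≠ v →
      entry u v (cycleSym n k) = q + (p - q) * entry u v (cycleVec n 1) := by
    intro u v huv
    rw [entry_cycleVec_one huv]
    split_ifs with h
    · rcases h with rfl | rfl
      · rw [hadj]
        ring
      · rw [entry_comm, hadj]
        ring
    · rw [hq u v huv h]
      ring
  have hpq : p - q = n * ((pairingCentralizer n).card * pinCount n k) - q * (n - 1) / 2 := by
    have hpt : ∀ v : Fin n, entry 0 v (cycleSym n k) =
        q - (if v = 0 then q else 0) + (p - q) * entry 0 v (cycleVec n 1) := by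
      intro v
      by_cases h : v = 0
      · simp [h, entry_self]
      · rw [hent 0 v (Ne.symm h), if_neg h]
        ring
    have hsum := sum_entry_cycleSym (k := k) hn 0
    simp_rw [hpt] at hsum
    rw [Finset.sum_add_distrib, Finset.sum_sub_distrib, ← Finset.mul_sum,
      sum_entry_hamX hn (cycleVec_mem_hamX 1), Finset.sum_ite_eq' Finset.univ (0 : Fin n),
      if_pos (Finset.mem_univ _), Finset.sum_const, Finset.card_univ, Fintype.card_fin,
      nsmul_eq_mul] at hsum
    linarith
  have hn1 : (n : ℝ) - 1 ≠ 0 := by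
    have : (3 : ℝ) ≤ n := by exact_mod_cast hn
    linarith
  refine ext_entry fun u v huv => ?_
  rw [hent u v huv, map_add, map_smul, map_smul, entry_bary hn huv, hpq, smul_eq_mul, smul_eq_mul]
  field_simp

lemma map_act_cycleSym_nonneg {F : (EdgeIdx n → ℝ) →ₗ[ℝ] ℝ} (hF : memP n k F)
    (π : Equiv.Perm (Fin n)) : 0 ≤ F (act π (cycleSym n k)) := by
  simp only [cycleSym, pairSym, map_sum, ← act_mul]
  exact Finset.sum_nonneg fun r _ => Finset.sum_nonneg fun g _ => map_act_pinSum_nonneg hF _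

end CycleSym

section Estimates

/-- The common shape of the two estimates below: `s * D` is at least `2 * (n - 3 * k) * R`. -/
lemma nonneg_of_weighted {R P w s D e : ℝ} (hR : 0 < R) (hD : 0 ≤ D) (hw : 0 ≤ w)
    (hsD : 2 * e * R ≤ s * D) (h : 0 ≤ P ∨ 0 < s ∧ 0 ≤ s * P + w * e) :
    0 ≤ 2 * R * P + w * D := by
  rcases h with h | ⟨hs, h⟩
  · positivity
  · have h1 := mul_le_mul_of_nonneg_left hsD hw
    have h2 := mul_nonneg hR.le h
    exact nonneg_of_mul_nonneg_right (by linarith : 0 ≤ s * (2 * R * P + w * D)) hs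

lemma even_quadratic_nonneg {n k : ℕ} (hn : 10 ≤ n) (h3 : 3 * k ≤ n) :
    (0 : ℝ) ≤ (4 * k + 1) * n ^ 2 - (10 * k ^ 2 + 15 * k) * n + 10 * k ^ 2 + 20 * k := by
  have hn' : (10 : ℝ) ≤ n := by exact_mod_cast hn
  have h3' : (3 * k : ℝ) ≤ n := by exact_mod_cast h3
  rcases Nat.lt_or_ge k 6 with hk | hk
  · interval_cases k <;> push_cast at h3' ⊢ <;> nlinarith
  · have hk' : (6 : ℝ) ≤ k := by exact_mod_cast hk
    have h1 : 0 ≤ (4 * k + 1 : ℝ) * n - (10 * k ^ 2 + 15 * k) := by nlinarith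
    nlinarith [mul_nonneg h1 (by linarith : (0 : ℝ) ≤ n)]

lemma odd_quadratic_nonneg {n k : ℕ} (hn : 9 ≤ n) (h3 : 3 * k ≤ n) :
    (0 : ℝ) ≤ (4 * k + 1) * n ^ 2 - (10 * k ^ 2 + 15 * k) * n + 20 * k ^ 2 + 10 * k := by
  have hn' : (9 : ℝ) ≤ n := by exact_mod_cast hn
  have h3' : (3 * k : ℝ) ≤ n := by exact_mod_cast h3
  rcases Nat.lt_or_ge k 6 with hk | hk
  · interval_cases k <;> push_cast at h3' ⊢ <;> nlinarith
  · have hk' : (6 : ℝ) ≤ k := by exact_mod_cast hk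
    have h1 : 0 ≤ (4 * k + 1 : ℝ) * n - (10 * k ^ 2 + 15 * k) := by nlinarith
    nlinarith [mul_nonneg h1 (by linarith : (0 : ℝ) ≤ n)]

lemma even_estimate {n k : ℕ} {R D : ℝ} (hn : 10 ≤ n) (hk : 1 ≤ k) (h2 : 2 * k ≤ n) (hR : 0 < R)
    (hD : 0 ≤ D) (hsD : 2 * (n - 3 * k) * R ≤ (n - 2 * k - 1) * D) :
    (n - 1) * (2 * n * R - 2 * k * R - D) * (n ^ 2 + 10 * k) ≤
      2 * (n - 2) * (n * R * (n ^ 2 + 10 * k - n * k)) := by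
  have hn' : (10 : ℝ) ≤ n := by exact_mod_cast hn
  have hk' : (1 : ℝ) ≤ k := by exact_mod_cast hk
  have h2' : (2 * k : ℝ) ≤ n := by exact_mod_cast h2
  have hw : 0 ≤ ((n : ℝ) - 1) * (n ^ 2 + 10 * k) := mul_nonneg (by linarith) (by positivity)
  have := nonneg_of_weighted (P := 10 * k * (k - 1) * n - 10 * k ^ 2 - n ^ 2 * (n - k))
    hR hD hw hsD ?_
  · linarith
  rcases Nat.lt_or_ge n (3 * k) with h3 | h3
  · left
    have h3' : (n : ℝ) ≤ 3 * k := by exact_mod_cast h3.le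
    have hk4 : (4 : ℝ) ≤ k := by exact_mod_cast (by omega : 4 ≤ k)
    have h1 : (n : ℝ) * (n - k) ≤ 3 * k * (2 * k) :=
      mul_le_mul h3' (by linarith) (by linarith) (by linarith)
    have h4 : (n : ℝ) * (n * (n - k)) ≤ n * (3 * k * (2 * k)) :=
      mul_le_mul_of_nonneg_left h1 (by linarith)
    have h5 : 0 ≤ (k : ℝ) * (4 * k * n - 10 * n - 10 * k) :=
      mul_nonneg (by linarith) (by nlinarith)
    linarith
  · right
    have h3' : (3 * k : ℝ) ≤ n := by exact_mod_cast h3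
    refine ⟨by nlinarith, ?_⟩
    have := mul_nonneg (by linarith : (0 : ℝ) ≤ 2 * k) (even_quadratic_nonneg hn h3)
    linarith

lemma odd_estimate {n k : ℕ} {R D : ℝ} (hn : 9 ≤ n) (hk : 1 ≤ k) (h2 : 2 * k ≤ n) (hR : 0 < R)
    (hD : 0 ≤ D) (hsD : 2 * (n - 3 * k) * R ≤ (n - 2 * k) * D) :
    ((n - 2) * (2 * n * R - 4 * R - 2 * k * R - D) + 4 * (n - 3) * R) * (n ^ 2 + 10 * k) ≤
      2 * (n - 3) * (n * R * (n ^ 2 + 10 * k - n * k)) := by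
  have hn' : (9 : ℝ) ≤ n := by exact_mod_cast hn
  have hk' : (1 : ℝ) ≤ k := by exact_mod_cast hk
  have h2' : (2 * k : ℝ) ≤ n := by exact_mod_cast h2
  have hw : 0 ≤ ((n : ℝ) - 2) * (n ^ 2 + 10 * k) := mul_nonneg (by linarith) (by positivity)
  have := nonneg_of_weighted (P := 10 * k * (k - 1) * (n - 2) - n ^ 2 * (n - k - 2))
    hR hD hw hsD ?_
  · linarith
  rcases Nat.lt_or_ge n (3 * k) with h3 | h3
  · left
    have h3' : (n : ℝ) ≤ 3 * k := by exact_mod_cast h3.le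
    have hk4 : (4 : ℝ) ≤ k := by exact_mod_cast (by omega : 4 ≤ k)
    have h1 : (n : ℝ) * (n - k - 2) ≤ 3 * k * (2 * k - 2) :=
      mul_le_mul h3' (by linarith) (by linarith) (by linarith)
    have h4 : (n : ℝ) * (n * (n - k - 2)) ≤ n * (3 * k * (2 * k - 2)) :=
      mul_le_mul_of_nonneg_left h1 (by linarith)
    have h5 : 0 ≤ (k : ℝ) * (k - 1) * (4 * n - 20) :=
      mul_nonneg (mul_nonneg (by linarith) (by linarith)) (by linarith)
    linarith
  · right
    have h3' : (3 * k : ℝ) ≤ n := by exact_mod_cast h3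
    refine ⟨by linarith, ?_⟩
    have := mul_nonneg (by linarith : (0 : ℝ) ≤ 2 * k) (odd_quadratic_nonneg hn h3)
    linarith

end Estimates

lemma sub_le_map_of_memP {n k : ℕ} (hn : 9 ≤ n) (hk1 : 1 ≤ k) (hk2 : 2 * k ≤ n)
    {F : (EdgeIdx n → ℝ) →ₗ[ℝ] ℝ} (hF : memP n k F) {x : EdgeIdx n → ℝ} (hx : x ∈ hamX n) :
    1 - ((n : ℝ) / k + 10 / n) ≤ F x := by
  have : NeZero n := ⟨by omega⟩
  obtain ⟨R, l, l₀, l₁, C, hRdef, hC, hoff, hrow, hrow', hl, hCR⟩ :=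
    exists_pairSym_relations (n := n) (k := k) (by omega) hk2
  have hR : 0 < R := by
    rw [hRdef]
    refine mul_pos (Nat.cast_pos.2 (Finset.card_pos.2 ⟨1, ?_⟩)) (pinCount_pos hk2)
    exact Finset.mem_filter.2 ⟨Finset.mem_univ _, Commute.one_left _⟩
  have hn' : (9 : ℝ) ≤ n := by exact_mod_cast hn
  have hk' : (1 : ℝ) ≤ k := by exact_mod_cast hk1
  have hk2' : (2 * k : ℝ) ≤ n := by exact_mod_cast hk2
  set q : ℝ := n * l₀ + 2 * (n % 2 : ℕ) * (l₁ - l₀) with hq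
  set B : ℝ := q * (n - 1) / 2 with hB
  have hFx : 0 ≤ B + (n * R - B) * F x := by
    obtain ⟨σ, rfl⟩ := mem_hamX hx
    have h := map_act_cycleSym_nonneg hF σ
    rwa [cycleSym_eq (by omega) fun u v huv hadj => entry_cycleSym_of_not_adj hoff huv hadj,
      ← hRdef, map_add, map_smul, map_smul, act_bary, map_add, map_smul, map_smul, map_bary, hF.1,
      smul_eq_mul, smul_eq_mul, mul_one] at h
  have hBound : B * (n ^ 2 + 10 * k) ≤ n * R * (n ^ 2 + 10 * k - n * k) := by
    rcases Nat.mod_two_eq_zero_or_one n with hpar | hpar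
    · simp only [hpar, Nat.cast_zero, mul_zero, zero_mul, add_zero, sub_zero] at hq hrow hl
      have hD : 0 ≤ (n - 2 * k) * C := mul_nonneg (by linarith) hC
      have h := even_estimate (k := k) (by omega) hk1 hk2 hR hD (by linarith)
      have hBn : 2 * (n - 2) * B = (n - 1) * (2 * n * R - 2 * k * R - (n - 2 * k) * C) := by
        rw [hB, hq]
        linear_combination (n - 1) * n * hrow - (n - 1) * hl
      rw [← hBn, mul_assoc] at h
      exact le_of_mul_le_mul_left h (by linarith)
    · simp only [hpar, Nat.cast_one, mul_one, one_mul] at hq hrow hl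
      have hrow1 := hrow' hpar
      have hD : 0 ≤ (n - 2 * k - 1) * C := by
        refine mul_nonneg ?_ hC
        have : (2 * k + 1 : ℝ) ≤ n := by exact_mod_cast (by omega : 2 * k + 1 ≤ n)
        linarith
      have h := odd_estimate (k := k) hn hk1 hk2 hR hD (by linarith)
      have hBn : 2 * (n - 3) * B = (n - 2) * (2 * n * R - 4 * R - 2 * k * R -
          (n - 2 * k - 1) * C) + 4 * (n - 3) * R := by
        rw [hB, hq]
        linear_combination (n - 2) * (n - 1) * hrow - (n - 2) * hl + (n - 4) * hrow1
      rw [← hBn, mul_assoc] at h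
      exact le_of_mul_le_mul_left h (by linarith)
  set a : ℝ := (n : ℝ) / k + 10 / n with ha
  have han : a * (n * k) = n ^ 2 + 10 * k := by
    rw [ha]
    field_simp
  have hnk : (0 : ℝ) < n * k := by positivity
  have haB : n * R ≤ (n * R - B) * a := by
    rw [← han] at hBound
    nlinarith
  have hpos : 0 < n * R - B := by
    have : 0 < a := by positivity
    by_contra hneg
    have := mul_nonpos_of_nonpos_of_nonneg (not_lt.1 hneg) this.le
    have : 0 < n * R := by positivity
    linarith
  by_contra hlt
  have := mul_lt_mul_of_pos_left (not_le.1 hlt) hpos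
  linarith

/-- For `n ≥ 9` and `1 ≤ k ≤ ⌊n/2⌋` there exists
`a_k = n/k + α_k` with `|α_k| ≤ 10/n` such that
`P_k° - Z ⊆ T_n - Z ⊆ a_k (P_k° - Z)`. -/
theorem semidefinite_approximation_of_tsp_polytope
    (n k : ℕ) (hn : 9 ≤ n) (hk1 : 1 ≤ k) (hk2 : k ≤ n / 2) :
    ∃ a : ℝ, |a - (n : ℝ) / k| ≤ 10 / n ∧
      (∀ p : EdgeIdx n → ℝ, memPolar n k p →
        p ∈ convexHull ℝ (hamX n : Set (EdgeIdx n → ℝ))) ∧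
      (∀ p ∈ convexHull ℝ (hamX n : Set (EdgeIdx n → ℝ)),
        ∃ q : EdgeIdx n → ℝ, memPolar n k q ∧ p - bary n = a • (q - bary n)) := by
  have hn' : (9 : ℝ) ≤ n := by exact_mod_cast hn
  have hk' : (1 : ℝ) ≤ k := by exact_mod_cast hk1
  refine ⟨n / k + 10 / n, ?_, fun p hp => mem_convexHull_of_memPolar (by omega) hp,
    fun p hp => exists_memPolar_of_lower_bound (by positivity)
      (fun F hF x hx => sub_le_map_of_memP hn hk1 (by omega) hF hx) hp⟩
  rw [add_sub_cancel_left, abs_of_nonneg (by positivity)]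
end
end

section
/- Let n ≥ 9 be an even integer, let k be an integer with 1 ≤ k ≤ n/2, let f ∈ P_k, and let y ∈ X. Then f(y) ≥ -n/k + 1 - n(k-1)/(k(n² - kn - 3n + k + 3)). -/
open Finset
noncomputable section
open scoped Classical

/-- The Hamiltonian cycle determined by `σ` contains the unordered pair `z`. -/
def CycleContains {n : ℕ} (σ : Equiv.Perm (Fin n)) (z : Sym2 (Fin n)) : Prop :=
  ∃ i : Fin n, z = s(σ i, σ (finRotate n i))

lemma val_finRotate {n : ℕ} (i : Fin n) :
    (finRotate n i).val = if i.val + 1 = n then 0 else i.val + 1 := by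
  obtain _ | n := n
  · exact i.elim0
  · rw [coe_finRotate]
    simp [Fin.ext_iff]

/-- Every pair `{v, p v}` with `p v ≠ v` lies on the Hamiltonian cycle determined by `σ`. -/
def ContainsPairs {n : ℕ} (p : Fin n → Fin n) (σ : Equiv.Perm (Fin n)) : Prop :=
  ∀ v, p v ≠ v → CycleContains σ s(v, p v)

/-- Arrangements that extend the first `j` values of `τ` and contain all pairs of `p`. -/
def extensions {n : ℕ} (p : Fin n → Fin n) (τ : Equiv.Perm (Fin n)) (j : ℕ) :
    Finset (Equiv.Perm (Fin n)) :=
  univ.filter fun σ => (∀ i : Fin n, i.val < j → σ i = τ i) ∧ ContainsPairs p σ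

/-- The vertices not among the first `j` values of `τ`. -/
def remaining {n : ℕ} (τ : Equiv.Perm (Fin n)) (j : ℕ) : Finset (Fin n) :=
  univ.filter fun v => j ≤ (τ.symm v).val

lemma card_remaining {n : ℕ} (τ : Equiv.Perm (Fin n)) (j : ℕ) :
    #(remaining τ j) = n - j := by
  have h : remaining τ j = (univ.filter fun i : Fin n => j ≤ i.val).map τ.toEmbedding := by
    ext v
    simp [remaining]
  rw [h, card_map]
  have := Fin.card_filter_val_lt (n := n) (m := j)
  have h2 := Finset.card_filter_add_card_filter_not (s := (univ : Finset (Fin n)))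
    (fun i : Fin n => i.val < j)
  simp only [not_lt, card_univ, Fintype.card_fin] at h2
  omega

/-- The first `j` values of `τ` consist of fixed points of `p` and of adjacent pairs of `p`. -/
def PrefixClosed {n : ℕ} (p : Fin n → Fin n) (τ : Equiv.Perm (Fin n)) (j : ℕ) : Prop :=
  ∀ i : Fin n, i.val < j → ∃ i' : Fin n, i'.val < j ∧ τ i' = p (τ i) ∧
    (i' = i ∨ i'.val = i.val + 1 ∨ i.val = i'.val + 1)

lemma exists_perm_extending {n : ℕ} (τ : Equiv.Perm (Fin n)) {j : ℕ} (hj : j < n)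
    {w : Fin n} (hw : w ∈ remaining τ j) :
    ∃ τ' : Equiv.Perm (Fin n), (∀ i : Fin n, i.val < j → τ' i = τ i) ∧ τ' ⟨j, hj⟩ = w := by
  refine ⟨τ * Equiv.swap ⟨j, hj⟩ (τ.symm w), fun i hi => ?_, by simp⟩
  simp only [remaining, mem_filter, mem_univ, true_and] at hw
  rw [Equiv.Perm.mul_apply, Equiv.swap_apply_of_ne_of_ne]
  · intro h; simp [h] at hi
  · intro h; rw [← h] at hw; omega

lemma remaining_succ {n : ℕ} {τ τ' : Equiv.Perm (Fin n)} {j : ℕ} (hj : j < n)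
    {w : Fin n} (h : ∀ i : Fin n, i.val < j → τ' i = τ i) (hw : τ' ⟨j, hj⟩ = w) :
    remaining τ' (j + 1) = (remaining τ j).erase w := by
  ext v
  simp only [remaining, mem_filter, mem_univ, true_and, mem_erase]
  rw [← not_iff_not]
  push Not
  constructor
  · intro hv hne
    have h1 : (τ'.symm v).val ≠ j := fun h2 => hne <| by
      rw [← hw]
      exact (Equiv.symm_apply_eq _).1 (Fin.ext h2)
    have h2 : (τ'.symm v).val < j := by omega
    have h3 := h _ h2
    rw [Equiv.apply_symm_apply] at h3
    rw [h3, Equiv.symm_apply_apply]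
    exact h2
  · intro hv
    by_cases hne : v = w
    · rw [hne, ← hw]; simp
    · have h2 := hv hne
      have h3 := h _ h2
      rw [Equiv.apply_symm_apply] at h3
      rw [← h3, Equiv.symm_apply_apply]
      omega

lemma filter_extensions_eq {n : ℕ} {p : Fin n → Fin n} {τ τ' : Equiv.Perm (Fin n)} {j : ℕ}
    (hj : j < n) {w : Fin n} (h : ∀ i : Fin n, i.val < j → τ' i = τ i) (hw : τ' ⟨j, hj⟩ = w) :
    (extensions p τ j).filter (fun σ => σ ⟨j, hj⟩ = w) = extensions p τ' (j + 1) := by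
  ext σ
  simp only [extensions, mem_filter, mem_univ, true_and]
  constructor
  · rintro ⟨⟨h1, h2⟩, h3⟩
    refine ⟨fun i hi => ?_, h2⟩
    rcases Nat.lt_succ_iff_lt_or_eq.1 hi with h4 | h4
    · rw [h1 i h4, h i h4]
    · obtain rfl : i = ⟨j, hj⟩ := Fin.ext h4
      rw [h3, hw]
  · rintro ⟨h1, h2⟩
    refine ⟨⟨fun i hi => ?_, h2⟩, ?_⟩
    · rw [h1 i (by omega), h i hi]
    · rw [h1 _ (by simp), hw]

/-- If a non-fixed vertex follows a closed nonempty prefix, then its partner comes next. -/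
lemma next_eq_partner {n : ℕ} {p : Fin n → Fin n} {τ σ : Equiv.Perm (Fin n)} {j : ℕ}
    (hp : Function.Involutive p) (h0 : 0 < j) (hj : j < n)
    (hc : PrefixClosed p τ j) (hσ : σ ∈ extensions p τ j)
    (hw : p (σ ⟨j, hj⟩) ≠ σ ⟨j, hj⟩) :
    ∃ h : j + 1 < n, σ ⟨j + 1, h⟩ = p (σ ⟨j, hj⟩) := by
  simp only [extensions, mem_filter, mem_univ, true_and] at hσ
  have key : ∀ i : Fin n, i.val < j → σ i ≠ p (σ ⟨j, hj⟩) := by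
    intro i hi h
    obtain ⟨i', hi', h2, -⟩ := hc i hi
    rw [← hσ.1 i hi, h, hp, ← hσ.1 i' hi'] at h2
    have := σ.injective h2
    simp [this] at hi'
  obtain ⟨i, hi⟩ := hσ.2 _ hw
  rw [Sym2.eq_iff] at hi
  have hr := val_finRotate i
  rcases hi with ⟨h1, h2⟩ | ⟨h1, h2⟩
  · have := σ.injective h1
    subst this
    by_cases hjn : j + 1 = n
    · exact absurd h2.symm (key _ (by rw [hr, if_pos hjn]; exact h0))
    · refine ⟨by omega, ?_⟩
      rw [h2]
      congr 1
      exact Fin.ext (by rw [hr, if_neg hjn])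
  · have := σ.injective h1
    rw [← this] at hr
    simp only at hr
    split_ifs at hr
    · omega
    · exact absurd h2.symm (key i (by omega))

lemma containsPairs_of_prefixClosed {n : ℕ} {p : Fin n → Fin n} {τ : Equiv.Perm (Fin n)}
    (hc : PrefixClosed p τ n) : ContainsPairs p τ := by
  intro v hv
  obtain ⟨i', -, h, h1⟩ := hc (τ.symm v) (τ.symm v).2
  rw [Equiv.apply_symm_apply] at h
  have hv' := Equiv.apply_symm_apply τ v
  generalize τ.symm v = i at *
  rcases h1 with h1 | h1 | h1
  · exact absurd (by rw [← h, h1, hv']) hv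
  · refine ⟨i, ?_⟩
    have : finRotate n i = i' := Fin.ext (by rw [val_finRotate, if_neg (by omega), h1])
    rw [this, h, hv']
  · refine ⟨i', ?_⟩
    have : finRotate n i' = i := Fin.ext (by rw [val_finRotate, if_neg (by omega), h1])
    rw [this, h, hv', Sym2.eq_swap]

theorem card_extensions {n : ℕ} {p : Fin n → Fin n} (hp : Function.Involutive p) (d : ℕ) :
    ∀ (τ : Equiv.Perm (Fin n)) (j k : ℕ), n = j + d → 0 < j → PrefixClosed p τ j →
      #((remaining τ j).filter fun v => p v ≠ v) = 2 * k →
      #(extensions p τ j) = 2 ^ k * (d - k).factorial := by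
  induction d using Nat.strong_induction_on with
  | _ d ih =>
  intro τ j k hn h0 hc hk
  have hrem := card_remaining τ j
  rcases Nat.eq_zero_or_pos d with rfl | hd
  · obtain rfl : n = j := by omega
    have h1 : remaining τ n = ∅ := by rw [← card_eq_zero]; omega
    obtain rfl : k = 0 := by rw [h1] at hk; simpa using hk.symm
    have h2 : extensions p τ n = {τ} := by
      ext σ
      simp only [extensions, mem_filter, mem_univ, true_and, mem_singleton]
      constructor
      · rintro ⟨h, -⟩
        ext i
        rw [h i i.2]
      · rintro rfl
        exact ⟨fun _ _ => rfl, containsPairs_of_prefixClosed hc⟩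
    rw [h2]
    simp
  have hj : j < n := by omega
  have hmaps : ∀ σ ∈ extensions p τ j, σ ⟨j, hj⟩ ∈ remaining τ j := by
    intro σ hσ
    simp only [extensions, remaining, mem_filter, mem_univ, true_and] at hσ ⊢
    by_contra! hlt
    have := hσ.1 _ hlt
    rw [Equiv.apply_symm_apply] at this
    have := σ.injective this
    simp [this] at hlt
  rw [card_eq_sum_card_fiberwise hmaps]
  have hsplit := card_filter_add_card_filter_not (s := remaining τ j) (fun v => p v ≠ v)
  have hlek : 2 * k ≤ d := by omega
  have hfix : ∀ w ∈ (remaining τ j).filter (fun v => ¬ p v ≠ v),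
      #((extensions p τ j).filter fun σ => σ ⟨j, hj⟩ = w) = 2 ^ k * (d - 1 - k).factorial := by
    intro w hw
    simp only [ne_eq, not_not, mem_filter] at hw
    obtain ⟨τ', h1, h2⟩ := exists_perm_extending τ hj hw.1
    rw [filter_extensions_eq hj h1 h2]
    refine ih (d - 1) (by omega) τ' (j + 1) k (by omega) (by omega) ?_ ?_
    · intro i hi
      rcases Nat.lt_succ_iff_lt_or_eq.1 hi with h4 | h4
      · obtain ⟨i', a, b, c⟩ := hc i h4
        exact ⟨i', by omega, by rw [h1 i h4, h1 i' a, b], c⟩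
      · obtain rfl : i = ⟨j, hj⟩ := Fin.ext h4
        exact ⟨_, hi, by rw [h2, hw.2], Or.inl rfl⟩
    · rw [remaining_succ hj h1 h2, filter_erase, erase_eq_of_notMem (by simp [hw.2]), hk]
  have hnon : ∀ w ∈ (remaining τ j).filter (fun v => p v ≠ v),
      2 * #((extensions p τ j).filter fun σ => σ ⟨j, hj⟩ = w) =
        2 ^ k * (d - 1 - k).factorial := by
    intro w hw
    have hkpos : 0 < #((remaining τ j).filter fun v => p v ≠ v) := card_pos.2 ⟨w, hw⟩
    simp only [mem_filter] at hw
    have hj1 : j + 1 < n := by omega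
    have hpw : p w ∈ remaining τ j := by
      simp only [remaining, mem_filter, mem_univ, true_and] at hw ⊢
      by_contra! hlt
      obtain ⟨i', a, b, -⟩ := hc _ hlt
      rw [Equiv.apply_symm_apply, hp] at b
      rw [← b, Equiv.symm_apply_apply] at hw
      omega
    obtain ⟨τ₁, h1, h2⟩ := exists_perm_extending τ hj hw.1
    have hr1 := remaining_succ hj h1 h2
    have hpw1 : p w ∈ remaining τ₁ (j + 1) := by
      rw [hr1]; exact mem_erase.2 ⟨hw.2, hpw⟩
    obtain ⟨τ₂, h3, h4⟩ := exists_perm_extending τ₁ hj1 hpw1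
    have hr2 := remaining_succ hj1 h3 h4
    have h5 : (extensions p τ j).filter (fun σ => σ ⟨j, hj⟩ = w) =
        extensions p τ₂ (j + 2) := by
      rw [← filter_extensions_eq hj1 h3 h4, ← filter_extensions_eq hj h1 h2]
      refine (filter_true_of_mem fun σ hσ => ?_).symm
      obtain ⟨hσ, hσw⟩ := mem_filter.1 hσ
      obtain ⟨_, h⟩ := next_eq_partner hp h0 hj hc hσ (by rw [hσw]; exact hw.2)
      rw [h, hσw]
    have h6 : τ₂ ⟨j, hj⟩ = w := by rw [h3 _ (by simp), h2]
    rw [h5, ih (d - 2) (by omega) τ₂ (j + 2) (k - 1) (by omega) (by omega) ?_ ?_]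
    · rw [← mul_assoc, ← pow_succ', show k - 1 + 1 = k by omega,
        show d - 2 - (k - 1) = d - 1 - k by omega]
    · intro i hi
      rcases lt_trichotomy i.val j with h7 | h7 | h7
      · obtain ⟨i', a, b, c⟩ := hc i h7
        exact ⟨i', by omega, by
          rw [h3 i (by omega), h3 i' (by omega), h1 i h7, h1 i' a, b], c⟩
      · obtain rfl : i = ⟨j, hj⟩ := Fin.ext h7
        exact ⟨⟨j + 1, hj1⟩, by simp, by rw [h4, h6], by simp⟩
      · obtain rfl : i = ⟨j + 1, hj1⟩ := Fin.ext (by simp; omega)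
        exact ⟨⟨j, hj⟩, by simp, by rw [h4, h6, hp], by simp⟩
    · rw [hr2, hr1, filter_erase, filter_erase, card_erase_of_mem, card_erase_of_mem]
      · omega
      · simp [hw.1, hw.2]
      · simp [hpw, hp w, hw.2, Ne.symm hw.2]
  rw [← sum_filter_add_sum_filter_not (remaining τ j) (fun v => p v ≠ v),
    sum_congr rfl hfix, sum_const, smul_eq_mul]
  have hsum := sum_congr rfl hnon
  rw [← mul_sum, sum_const, hk, smul_eq_mul, mul_assoc] at hsum
  rw [Nat.eq_of_mul_eq_mul_left two_pos hsum, ← add_mul,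
    show d - k = (d - 1 - k) + 1 by omega, Nat.factorial_succ,
    show k + #((remaining τ j).filter fun v => ¬ p v ≠ v) = d - 1 - k + 1 by omega]
  ring

lemma cycleContains_mul_addRight {n : ℕ} (c : Fin (n + 1)) (σ : Equiv.Perm (Fin (n + 1)))
    (z : Sym2 (Fin (n + 1))) :
    CycleContains (σ * Equiv.addRight c) z ↔ CycleContains σ z := by
  simp only [CycleContains, Equiv.Perm.mul_apply, Equiv.coe_addRight, finRotate_apply]
  constructor
  · rintro ⟨i, rfl⟩
    exact ⟨i + c, by rw [add_right_comm]⟩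
  · rintro ⟨i, rfl⟩
    exact ⟨i - c, by rw [sub_add_cancel, add_right_comm, sub_add_cancel]⟩

lemma cycleContains_mul_neg {n : ℕ} (σ : Equiv.Perm (Fin (n + 1))) (z : Sym2 (Fin (n + 1))) :
    CycleContains (σ * Equiv.neg _) z ↔ CycleContains σ z := by
  simp only [CycleContains, Equiv.Perm.mul_apply, Equiv.neg_apply, finRotate_apply]
  constructor
  · rintro ⟨i, rfl⟩
    exact ⟨-(i + 1), by rw [Sym2.eq_swap]; congr 2; abel_nf⟩
  · rintro ⟨i, rfl⟩
    exact ⟨-(i + 1), by rw [Sym2.eq_swap]; congr 2 <;> abel_nf⟩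

/-- Rotating positions: arrangements with a rotation-invariant property are `n` times as many
as those that moreover start at a given vertex. -/
lemma card_filter_eq_mul_card_start {n : ℕ} (a : Fin (n + 1))
    (P : Equiv.Perm (Fin (n + 1)) → Prop) [DecidablePred P]
    (hP : ∀ (c : Fin (n + 1)) σ, P (σ * Equiv.addRight c) ↔ P σ) :
    #(univ.filter P) = (n + 1) * #(univ.filter fun σ => σ 0 = a ∧ P σ) := by
  rw [card_eq_sum_card_fiberwise (f := fun σ : Equiv.Perm (Fin (n + 1)) => σ.symm a)
    (t := univ) (by simp), sum_congr rfl (g := fun _ => #(univ.filter fun σ => σ 0 = a ∧ P σ))]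
  · simp
  · intro c _
    refine card_bij (fun σ _ => σ * Equiv.addRight c) ?_ ?_ ?_
    · intro σ hσ
      simp only [mem_filter, mem_univ, true_and] at hσ ⊢
      refine ⟨?_, (hP c σ).2 hσ.1⟩
      simp [← hσ.2]
    · intro σ _ σ' _ h
      exact mul_right_cancel h
    · intro σ hσ
      simp only [mem_filter, mem_univ, true_and] at hσ
      refine ⟨σ * (Equiv.addRight c)⁻¹, ?_, inv_mul_cancel_right _ _⟩
      simp only [mem_filter, mem_univ, true_and]
      constructor
      · rw [← hP c, inv_mul_cancel_right]
        exact hσ.2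
      · rw [Equiv.symm_apply_eq]
        simp [hσ.1]

/-- Among the arrangements containing `k` disjoint pairs, the proportion of those that contain a
further disjoint pair is `2 / (n - k - 1)`. -/
theorem card_containsPairs_and_contains {n : ℕ} (hn : 3 ≤ n) {p : Fin n → Fin n}
    (hp : Function.Involutive p) {k : ℕ} (hk : #(univ.filter fun v => p v ≠ v) = 2 * k)
    (hkn : 2 * k + 2 ≤ n) {a b : Fin n} (hab : a ≠ b) (ha : p a = a) (hb : p b = b) :
    (n - k - 1) * #(univ.filter fun σ => ContainsPairs p σ ∧ CycleContains σ s(a, b)) =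
      2 * #(univ.filter fun σ => ContainsPairs p σ) := by
  obtain ⟨n, rfl⟩ : ∃ m, n = m + 3 := ⟨n - 3, by omega⟩
  have hrot : ∀ (c : Fin (n + 3)) σ, ContainsPairs p (σ * Equiv.addRight c) ↔
      ContainsPairs p σ := fun c σ => by
    simp only [ContainsPairs, cycleContains_mul_addRight]
  have hneg : ∀ σ, ContainsPairs p (σ * Equiv.neg (Fin (n + 3))) ↔ ContainsPairs p σ :=
    fun σ => by simp only [ContainsPairs, cycleContains_mul_neg]
  rw [card_filter_eq_mul_card_start a _ hrot, card_filter_eq_mul_card_start a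
    (fun σ => ContainsPairs p σ ∧ CycleContains σ s(a, b))
    (fun c σ => by rw [hrot, cycleContains_mul_addRight])]
  have h0 : #(univ.filter fun σ : Equiv.Perm (Fin (n + 3)) => σ 0 = a ∧ ContainsPairs p σ) =
      2 ^ k * (n + 2 - k).factorial := by
    obtain ⟨τ, hτ⟩ : ∃ τ : Equiv.Perm (Fin (n + 3)), τ 0 = a := ⟨Equiv.swap 0 a, by simp⟩
    have hpre : ∀ i : Fin (n + 3), i.val < 1 → i = 0 := fun i hi => Fin.ext (by rw [Fin.val_zero]; omega)
    rw [← card_extensions hp (n + 2) τ 1 k (by omega) one_pos]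
    · congr 1
      ext σ
      simp only [extensions, mem_filter, mem_univ, true_and]
      refine and_congr_left fun _ => ⟨fun h i hi => ?_, fun h => ?_⟩
      · rw [hpre i hi, h, hτ]
      · rw [h 0 (by simp), hτ]
    · intro i hi
      exact ⟨i, hi, by rw [hpre i hi, hτ, ha], Or.inl rfl⟩
    · rw [← hk]
      congr 1
      ext v
      simp only [remaining, mem_filter, mem_univ, true_and, and_iff_right_iff_imp]
      intro hv
      by_contra! hlt
      have := (Equiv.symm_apply_eq _).1 (hpre _ hlt)
      rw [hτ] at this
      exact hv (by rw [this, ha])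
  have h1 : #(univ.filter fun σ : Equiv.Perm (Fin (n + 3)) =>
      σ 0 = a ∧ σ 1 = b ∧ ContainsPairs p σ) = 2 ^ k * (n + 1 - k).factorial := by
    obtain ⟨τ, hτ, hτ1⟩ : ∃ τ : Equiv.Perm (Fin (n + 3)), τ 0 = a ∧ τ 1 = b := by
      refine ⟨Equiv.swap a 0 * Equiv.swap 1 (Equiv.swap a 0 b), ?_, by simp⟩
      have h : Equiv.swap 1 (Equiv.swap a 0 b) 0 = 0 :=
        Equiv.swap_apply_of_ne_of_ne (by simp) fun h =>
          hab (by simpa using congrArg (Equiv.swap a 0) h)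
      rw [Equiv.Perm.mul_apply, h, Equiv.swap_apply_right]
    have hpre : ∀ i : Fin (n + 3), i.val < 2 → i = 0 ∨ i = 1 := fun i hi => by
      simp only [Fin.ext_iff, Fin.val_zero, Fin.val_one]
      omega
    rw [← card_extensions hp (n + 1) τ 2 k (by omega) two_pos]
    · congr 1
      ext σ
      simp only [extensions, mem_filter, mem_univ, true_and, ← and_assoc]
      refine and_congr_left fun _ => ⟨fun h i hi => ?_, fun h => ?_⟩
      · rcases hpre i hi with rfl | rfl
        · rw [h.1, hτ]
        · rw [h.2, hτ1]
      · rw [h 0 (by simp), h 1 (by simp), hτ, hτ1]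
        exact ⟨rfl, rfl⟩
    · intro i hi
      refine ⟨i, hi, ?_, Or.inl rfl⟩
      rcases hpre i hi with rfl | rfl
      · rw [hτ, ha]
      · rw [hτ1, hb]
    · rw [← hk]
      congr 1
      ext v
      simp only [remaining, mem_filter, mem_univ, true_and, and_iff_right_iff_imp]
      intro hv
      by_contra! hlt
      rcases hpre _ hlt with h | h
      · rw [Equiv.symm_apply_eq, hτ] at h
        exact hv (by rw [h, ha])
      · rw [Equiv.symm_apply_eq, hτ1] at h
        exact hv (by rw [h, hb])
  have h2 : #(univ.filter fun σ : Equiv.Perm (Fin (n + 3)) =>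
      σ 0 = a ∧ σ (-1) = b ∧ ContainsPairs p σ) = 2 ^ k * (n + 1 - k).factorial := by
    rw [← h1]
    refine card_bij (fun σ _ => σ * Equiv.neg _) ?_ ?_ ?_
    · intro σ hσ
      simpa [hneg] using hσ
    · intro σ _ σ' _ h
      exact mul_right_cancel h
    · intro σ hσ
      refine ⟨σ * Equiv.neg _, ?_, by ext; simp⟩
      simpa [hneg] using hσ
  have h3 : #(univ.filter fun σ : Equiv.Perm (Fin (n + 3)) =>
      σ 0 = a ∧ ContainsPairs p σ ∧ CycleContains σ s(a, b)) =
      2 * (2 ^ k * (n + 1 - k).factorial) := by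
    rw [two_mul]
    nth_rw 1 [← h1]
    rw [← h2, ← card_union_of_disjoint]
    · congr 1
      ext σ
      simp only [mem_filter, mem_univ, true_and, mem_union]
      rw [← and_or_left, ← or_and_right, and_comm (a := ContainsPairs p σ)]
      refine and_congr_right fun h => and_congr_left fun _ => ?_
      simp only [CycleContains, finRotate_apply, Sym2.eq_iff]
      constructor
      · rintro ⟨i, ⟨h4, h5⟩ | ⟨h4, h5⟩⟩
        · rw [← h] at h4
          rw [← σ.injective h4] at h5
          left; rw [h5, zero_add]
        · rw [← h] at h4
          have := σ.injective h4
          right; rw [h5, ← eq_neg_of_add_eq_zero_left this.symm]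
      · rintro (h4 | h4)
        · exact ⟨0, Or.inl ⟨h.symm, by rw [zero_add, h4]⟩⟩
        · exact ⟨-1, Or.inr ⟨by rw [neg_add_cancel, h], h4.symm⟩⟩
    · rw [disjoint_filter]
      rintro σ - ⟨-, h4, -⟩ ⟨-, h5, -⟩
      have h6 := σ.injective (h4.trans h5.symm)
      rw [Fin.ext_iff, Fin.neg_def] at h6
      simp at h6
  rw [h0, h3, show n + 2 - k = (n + 1 - k) + 1 by omega, Nat.factorial_succ,
    show n + 3 - k - 1 = n + 1 - k + 1 by omega]
  ring

/-- The perfect matching formed by the orbits of a fixed-point-free involution. -/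
def pairs {n : ℕ} (q : Fin n → Fin n) : Finset (Sym2 (Fin n)) := univ.image fun v => s(v, q v)

lemma mem_pairs_mk {n : ℕ} {q : Fin n → Fin n} (hq : Function.Involutive q) {u v : Fin n} :
    s(u, v) ∈ pairs q ↔ v = q u := by
  simp only [pairs, mem_image, mem_univ, true_and, Sym2.eq_iff]
  constructor
  · rintro ⟨w, ⟨rfl, rfl⟩ | ⟨rfl, rfl⟩⟩
    · rfl
    · exact (hq w).symm
  · rintro rfl
    exact ⟨u, Or.inl ⟨rfl, rfl⟩⟩

lemma sum_filter_pairs {n : ℕ} {q : Fin n → Fin n} (hq : Function.Involutive q)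
    (hfix : ∀ v, q v ≠ v) {S : Finset (Sym2 (Fin n))} (hS : S ⊆ pairs q)
    {R : Type*} [AddCommMonoid R] (g : Sym2 (Fin n) → R) :
    ∑ v ∈ univ.filter (fun v => s(v, q v) ∈ S), g s(v, q v) = 2 • ∑ z ∈ S, g z := by
  rw [← sum_fiberwise_of_maps_to (t := S) (g := fun v => s(v, q v)) (by simp), smul_sum]
  refine sum_congr rfl fun z hz => ?_
  obtain ⟨u, -, rfl⟩ := mem_image.1 (hS hz)
  have h : (univ.filter fun v => s(v, q v) ∈ S).filter (fun v => s(v, q v) = s(u, q u)) =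
      {u, q u} := by
    ext v
    simp only [mem_filter, mem_univ, true_and, mem_insert, mem_singleton, Sym2.eq_iff]
    constructor
    · rintro ⟨-, ⟨h, -⟩ | ⟨h, -⟩⟩
      · exact Or.inl h
      · exact Or.inr h
    · rintro (rfl | rfl)
      · exact ⟨hz, Or.inl ⟨rfl, rfl⟩⟩
      · exact ⟨by rw [hq, Sym2.eq_swap]; exact hz, Or.inr ⟨rfl, hq u⟩⟩
  rw [h, sum_pair (hfix u).symm, hq, Sym2.eq_swap, two_nsmul, Sym2.eq_swap]

lemma two_mul_card_of_subset_pairs {n : ℕ} {q : Fin n → Fin n} (hq : Function.Involutive q)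
    (hfix : ∀ v, q v ≠ v) {S : Finset (Sym2 (Fin n))} (hS : S ⊆ pairs q) :
    #(univ.filter fun v => s(v, q v) ∈ S) = 2 * #S := by
  rw [card_eq_sum_ones, card_eq_sum_ones]
  exact sum_filter_pairs hq hfix hS (fun _ => 1)

lemma two_mul_card_pairs {n : ℕ} {q : Fin n → Fin n} (hq : Function.Involutive q)
    (hfix : ∀ v, q v ≠ v) : 2 * #(pairs q) = n := by
  rw [← two_mul_card_of_subset_pairs hq hfix subset_rfl,
    filter_true_of_mem (fun v _ => (mem_pairs_mk hq).2 rfl), card_univ, Fintype.card_fin]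

/-- Arrangements whose cycle contains all pairs in `S`. -/
def containing {n : ℕ} (S : Finset (Sym2 (Fin n))) : Finset (Equiv.Perm (Fin n)) :=
  univ.filter fun σ => ∀ z ∈ S, CycleContains σ z

lemma card_containing_filter {n : ℕ} (hn : 3 ≤ n) {q : Fin n → Fin n}
    (hq : Function.Involutive q) (hfix : ∀ v, q v ≠ v) {S : Finset (Sym2 (Fin n))}
    (hS : S ⊆ pairs q) {z : Sym2 (Fin n)} (hz : z ∈ pairs q) (hzS : z ∉ S) :
    (n - #S - 1) * #((containing S).filter fun σ => CycleContains σ z) =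
      2 * #(containing S) := by
  obtain ⟨u, -, rfl⟩ := mem_image.1 hz
  set p : Fin n → Fin n := fun v => if s(v, q v) ∈ S then q v else v with hp
  have hswap : ∀ v, s(q v, q (q v)) = s(v, q v) := fun v => by rw [hq, Sym2.eq_swap]
  have hpinv : Function.Involutive p := by
    intro v
    by_cases h : s(v, q v) ∈ S
    · have h' := h
      rw [← hswap, hq] at h'
      simp only [hp, h, h', if_true, hq v]
    · simp only [hp, h, if_false]
  have hpne : ∀ v, p v ≠ v ↔ s(v, q v) ∈ S := by
    intro v
    by_cases h : s(v, q v) ∈ S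
    · simp [hp, h, hfix]
    · simp [hp, h]
  have hcont : ∀ σ, ContainsPairs p σ ↔ ∀ z ∈ S, CycleContains σ z := by
    intro σ
    constructor
    · intro h z hz
      obtain ⟨v, -, rfl⟩ := mem_image.1 (hS hz)
      have := h v ((hpne v).2 hz)
      simpa [hp, hz] using this
    · intro h v hv
      have hv := (hpne v).1 hv
      simpa [hp, hv] using h _ hv
  have hlt : #S < #(pairs q) := card_lt_card ⟨hS, fun h => hzS (h hz)⟩
  have hcard := two_mul_card_pairs hq hfix
  have key := card_containsPairs_and_contains hn hpinv (k := #S)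
    (by rw [← two_mul_card_of_subset_pairs hq hfix hS]; simp only [hpne]) (by omega)
    (hfix u).symm (by simp [hp, hzS]) (by simp only [hp, hswap, hzS, if_false])
  simp only [hcont] at key
  rw [containing, filter_filter]
  exact key

lemma cycleContains_mul_left {n : ℕ} (π σ : Equiv.Perm (Fin n)) (z : Sym2 (Fin n)) :
    CycleContains (π * σ) (z.map π) ↔ CycleContains σ z := by
  simp only [CycleContains, Equiv.Perm.mul_apply]
  refine exists_congr fun i => ?_
  rw [← Sym2.map_mk]
  exact (Sym2.map.injective π.injective).eq_iff

/-- The number of incidences of `z` with cycles containing a `k`-subset of the matching `q`,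
counted once for each such subset. -/
def weight {n : ℕ} (q : Fin n → Fin n) (k : ℕ) (z : Sym2 (Fin n)) : ℕ :=
  ∑ S ∈ powersetCard k (pairs q), #((containing S).filter fun σ => CycleContains σ z)

/-- The total number of pairs of a `k`-subset of the matching and a cycle containing it. -/
def totalWeight {n : ℕ} (q : Fin n → Fin n) (k : ℕ) : ℕ :=
  ∑ S ∈ powersetCard k (pairs q), #(containing S)

lemma weight_eq_sum_choose {n : ℕ} (q : Fin n → Fin n) (k : ℕ) (z : Sym2 (Fin n)) :
    weight q k z = ∑ σ ∈ univ.filter (fun σ => CycleContains σ z),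
      (#((pairs q).filter (CycleContains σ))).choose k := by
  refine Eq.trans ?_ ((sum_card_bipartiteAbove_eq_sum_card_bipartiteBelow
    (s := univ.filter fun σ => CycleContains σ z) (t := powersetCard k (pairs q))
    (r := fun σ S => ∀ z ∈ S, CycleContains σ z)).symm.trans ?_)
  · refine sum_congr rfl fun S _ => ?_
    rw [containing, filter_comm, bipartiteBelow]
  refine sum_congr rfl fun σ _ => ?_
  rw [← card_powersetCard]
  congr 1
  ext S
  simp only [bipartiteAbove, mem_filter, mem_powersetCard, subset_iff]
  grind

lemma weight_map {n : ℕ} {q : Fin n → Fin n} {π : Equiv.Perm (Fin n)}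
    (hπ : ∀ v, π (q v) = q (π v)) (k : ℕ) (z : Sym2 (Fin n)) :
    weight q k (z.map π) = weight q k z := by
  rw [weight_eq_sum_choose, weight_eq_sum_choose]
  symm
  refine sum_bij (fun σ _ => π * σ) ?_ ?_ ?_ ?_
  · intro σ hσ
    simpa [cycleContains_mul_left] using hσ
  · intro σ _ σ' _ h
    exact mul_left_cancel h
  · intro σ hσ
    refine ⟨π⁻¹ * σ, ?_, mul_inv_cancel_left _ _⟩
    simp only [mem_filter, mem_univ, true_and] at hσ ⊢
    rwa [← cycleContains_mul_left π, mul_inv_cancel_left]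
  · intro σ _
    congr 1
    refine card_bij (fun z _ => z.map π) ?_ ?_ ?_
    · intro z hz
      simp only [mem_filter, cycleContains_mul_left] at hz ⊢
      refine ⟨?_, hz.2⟩
      obtain ⟨v, -, rfl⟩ := mem_image.1 hz.1
      exact mem_image.2 ⟨π v, mem_univ _, by rw [Sym2.map_mk, hπ]⟩
    · intro z _ z' _ h
      exact Sym2.map.injective π.injective h
    · intro z hz
      simp only [mem_filter] at hz
      obtain ⟨v, -, rfl⟩ := mem_image.1 hz.1
      have h : s(v, q v) = (s(π.symm v, q (π.symm v))).map π := by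
        rw [Sym2.map_mk, hπ, Equiv.apply_symm_apply]
      refine ⟨s(π.symm v, q (π.symm v)), ?_, h.symm⟩
      simp only [mem_filter]
      refine ⟨mem_image.2 ⟨_, mem_univ _, rfl⟩, ?_⟩
      rw [← cycleContains_mul_left π, ← h]
      exact hz.2

lemma exists_commuting_perm {n : ℕ} {q : Fin n → Fin n} (hq : Function.Involutive q)
    (hfix : ∀ v, q v ≠ v) (a b : Fin n) :
    ∃ π : Equiv.Perm (Fin n), (∀ v, π (q v) = q (π v)) ∧ π a = b ∧
      ∀ v, v ≠ a → v ≠ q a → v ≠ b → v ≠ q b → π v = v := by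
  have hqa := hfix a
  have hqb := hfix b
  have hinj : ∀ u v, q u = q v → u = v := fun u v h => hq.injective h
  by_cases h : b = q a
  · refine ⟨Equiv.swap a b, fun v => ?_, by simp, fun v h1 _ h3 _ =>
      Equiv.swap_apply_of_ne_of_ne h1 h3⟩
    have := hq a
    have := hq v
    simp only [Equiv.swap_apply_def]
    grind
  by_cases hab : a = b
  · exact ⟨1, fun v => rfl, by simp [hab], fun v _ _ _ _ => rfl⟩
  · refine ⟨Equiv.swap a b * Equiv.swap (q a) (q b), fun v => ?_, ?_, ?_⟩
    · have := hq a
      have := hq b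
      have := hq v
      simp only [Equiv.Perm.mul_apply, Equiv.swap_apply_def]
      grind
    · simp only [Equiv.Perm.mul_apply, Equiv.swap_apply_def]
      have := hq b
      grind
    · intro v h1 h2 h3 h4
      rw [Equiv.Perm.mul_apply, Equiv.swap_apply_of_ne_of_ne h2 h4,
        Equiv.swap_apply_of_ne_of_ne h1 h3]

lemma weight_eq_of_mem_pairs {n : ℕ} {q : Fin n → Fin n} (hq : Function.Involutive q)
    (hfix : ∀ v, q v ≠ v) (k : ℕ) {z z' : Sym2 (Fin n)} (hz : z ∈ pairs q)
    (hz' : z' ∈ pairs q) : weight q k z = weight q k z' := by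
  obtain ⟨u, -, rfl⟩ := mem_image.1 hz
  obtain ⟨v, -, rfl⟩ := mem_image.1 hz'
  obtain ⟨π, h1, h2, -⟩ := exists_commuting_perm hq hfix u v
  rw [← weight_map h1, Sym2.map_mk, h1, h2]

lemma weight_eq_of_notMem_pairs {n : ℕ} {q : Fin n → Fin n} (hq : Function.Involutive q)
    (hfix : ∀ v, q v ≠ v) (k : ℕ) {z z' : Sym2 (Fin n)} (hd : ¬ z.IsDiag) (hd' : ¬ z'.IsDiag)
    (hz : z ∉ pairs q) (hz' : z' ∉ pairs q) : weight q k z = weight q k z' := by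
  induction z with | _ u v
  induction z' with | _ u' v'
  rw [mem_pairs_mk hq] at hz hz'
  rw [Sym2.mk_isDiag_iff] at hd hd'
  obtain ⟨π, h1, h2, -⟩ := exists_commuting_perm hq hfix u u'
  obtain ⟨ρ, h3, h4, h5⟩ := exists_commuting_perm hq hfix (π v) v'
  have hne : π v ≠ u' := by rw [← h2]; exact fun h => hd (π.injective h).symm
  have hne' : π v ≠ q u' := by rw [← h2, ← h1]; exact fun h => hz (π.injective h)
  have h6 : ρ u' = u' := by
    refine h5 u' hne.symm ?_ hd' ?_
    · intro h; exact hne' (by rw [h, hq])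
    · intro h; exact hz' (by rw [h, hq])
  rw [← weight_map h1, ← weight_map h3, Sym2.map_mk, Sym2.map_mk, h2, h4, h6]

lemma finRotate_ne_self {n : ℕ} (hn : 2 ≤ n) (i : Fin n) : finRotate n i ≠ i := by
  intro h
  have := val_finRotate i
  rw [h] at this
  split_ifs at this <;> omega

lemma CycleContains.not_isDiag {n : ℕ} (hn : 2 ≤ n) {σ : Equiv.Perm (Fin n)}
    {z : Sym2 (Fin n)} (h : CycleContains σ z) : ¬ z.IsDiag := by
  obtain ⟨i, rfl⟩ := h
  rw [Sym2.mk_isDiag_iff]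
  exact fun h => finRotate_ne_self hn i (σ.injective h).symm

lemma cycle_edge_injective {n : ℕ} (hn : 3 ≤ n) (σ : Equiv.Perm (Fin n)) :
    Function.Injective fun i => s(σ i, σ (finRotate n i)) := by
  intro i i' h
  rcases Sym2.eq_iff.1 h with ⟨h1, -⟩ | ⟨h1, h2⟩
  · exact σ.injective h1
  · have h3 := congrArg Fin.val (σ.injective h1)
    have h4 := congrArg Fin.val (σ.injective h2)
    rw [val_finRotate] at h3 h4
    split_ifs at h3 h4 <;> omega

lemma filter_cycleContains {n : ℕ} (σ : Equiv.Perm (Fin n)) :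
    univ.filter (CycleContains σ) = univ.image fun i => s(σ i, σ (finRotate n i)) := by
  ext z
  simp [CycleContains, eq_comm]

lemma sum_weight {n : ℕ} (hn : 3 ≤ n) (q : Fin n → Fin n) (k : ℕ) :
    ∑ z, weight q k z = n * totalWeight q k := by
  simp only [weight, totalWeight]
  rw [sum_comm, mul_sum]
  refine sum_congr rfl fun S _ => ?_
  refine (sum_card_bipartiteAbove_eq_sum_card_bipartiteBelow (s := containing S)
    (t := univ) (r := CycleContains)).symm.trans ?_
  rw [sum_congr rfl (g := fun _ => n), sum_const, smul_eq_mul, mul_comm]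
  intro σ _
  rw [bipartiteAbove, filter_cycleContains, card_image_of_injective _ (cycle_edge_injective hn σ),
    card_univ, Fintype.card_fin]

lemma sum_weight_pairs {n : ℕ} (hn : 3 ≤ n) {q : Fin n → Fin n}
    (hq : Function.Involutive q) (hfix : ∀ v, q v ≠ v) {k : ℕ} (hk : 2 * k ≤ n) :
    (n - k - 1) * ∑ z ∈ pairs q, weight q k z =
      (k * (n - k - 1) + (n - 2 * k)) * totalWeight q k := by
  simp only [weight, totalWeight]
  rw [sum_comm, mul_sum, mul_sum]
  refine sum_congr rfl fun S hS => ?_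
  obtain ⟨hS, hSk⟩ := mem_powersetCard.1 hS
  have hcard := two_mul_card_pairs hq hfix
  rw [← sum_sdiff hS, mul_add, add_mul, add_comm]
  congr 1
  · rw [sum_congr rfl (g := fun _ => #(containing S)), sum_const, hSk, smul_eq_mul]
    · ring
    · intro z hz
      congr 1
      refine filter_true_of_mem fun σ hσ => ?_
      exact (mem_filter.1 hσ).2 z hz
  · rw [mul_sum, sum_congr rfl (g := fun _ => 2 * #(containing S)), sum_const,
      card_sdiff_of_subset hS, hSk, smul_eq_mul, ← mul_assoc]
    · congr 1
      omega
    · intro z hz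
      rw [mem_sdiff] at hz
      rw [← hSk]
      exact card_containing_filter hn hq hfix hS hz.1 hz.2

lemma weight_eq_zero_of_isDiag {n : ℕ} (hn : 2 ≤ n) (q : Fin n → Fin n) (k : ℕ)
    {z : Sym2 (Fin n)} (hz : z.IsDiag) : weight q k z = 0 := by
  refine sum_eq_zero fun S _ => ?_
  rw [card_eq_zero]
  exact filter_false_of_mem fun σ _ h => h.not_isDiag hn hz

/-- The value of `weight` on an edge of the matching, divided by `totalWeight`. -/
def pairDensity (n k : ℕ) : ℝ := 2 * (k * (n - k - 1) + (n - 2 * k)) / (n * (n - k - 1))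

theorem sum_mul_weight {n : ℕ} (hn : 4 ≤ n) {q : Fin n → Fin n}
    (hq : Function.Involutive q) (hfix : ∀ v, q v ≠ v) {k : ℕ} (hk : 2 * k ≤ n)
    (c : Sym2 (Fin n) → ℝ) (hc : ∀ z, z.IsDiag → c z = 0) :
    ∑ z, c z * weight q k z = totalWeight q k *
      (pairDensity n k * ∑ z ∈ pairs q, c z +
        (2 - pairDensity n k) / (n - 2) * (∑ z, c z - ∑ z ∈ pairs q, c z)) := by
  set N : ℝ := ((totalWeight q k : ℕ) : ℝ) with hN
  set E : Finset (Sym2 (Fin n)) := univ.filter fun z => ¬ z.IsDiag with hE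
  have hcardE : #E = n.choose 2 := by
    have := Sym2.card_subtype_not_diag (α := Fin n)
    rw [Fintype.card_fin, Fintype.card_subtype] at this
    rw [← this]
  have hsub : pairs q ⊆ E := by
    intro z hz
    obtain ⟨v, -, rfl⟩ := mem_image.1 hz
    simpa [hE] using (hfix v).symm
  have hE0 : ∀ g : Sym2 (Fin n) → ℝ, (∀ z, z.IsDiag → g z = 0) →
      ∑ z, g z = ∑ z ∈ E \ pairs q, g z + ∑ z ∈ pairs q, g z := by
    intro g hg
    rw [sum_sdiff hsub]
    refine (sum_subset (subset_univ _) fun z _ hz => hg z ?_).symm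
    simpa [hE] using hz
  obtain ⟨A, hA⟩ : ∃ A : ℝ, ∀ z ∈ pairs q, (weight q k z : ℝ) = A := by
    refine ⟨weight q k s(⟨0, by omega⟩, q ⟨0, by omega⟩), fun z hz => ?_⟩
    rw [weight_eq_of_mem_pairs hq hfix k hz (mem_image_of_mem _ (mem_univ _))]
  obtain ⟨B, hB⟩ : ∃ B : ℝ, ∀ z ∈ E \ pairs q, (weight q k z : ℝ) = B := by
    rcases (E \ pairs q).eq_empty_or_nonempty with h | ⟨z', hz'⟩
    · exact ⟨0, by simp [h]⟩
    · refine ⟨weight q k z', fun z hz => ?_⟩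
      simp only [hE, mem_sdiff, mem_filter, mem_univ, true_and] at hz hz'
      rw [weight_eq_of_notMem_pairs hq hfix k hz.1 hz'.1 hz.2 hz'.2]
  have hM : (2 : ℝ) * #(pairs q) = n := by exact_mod_cast two_mul_card_pairs hq hfix
  have hD : 2 * (#(E \ pairs q) : ℝ) = n * (n - 2) := by
    rw [card_sdiff_of_subset hsub, Nat.cast_sub (card_le_card hsub), hcardE,
      Nat.cast_choose_two]
    linarith
  have hn' : (4 : ℝ) ≤ n := by exact_mod_cast hn
  have hk' : (2 : ℝ) * k ≤ n := by exact_mod_cast hk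
  have hA1 : A = pairDensity n k * N := by
    have h := sum_weight_pairs (by omega) hq hfix hk
    have h' : ((n : ℝ) - k - 1) * ∑ z ∈ pairs q, (weight q k z : ℝ) =
        (k * (n - k - 1) + (n - 2 * k)) * N := by
      have := congrArg (Nat.cast (R := ℝ)) h
      push_cast [Nat.cast_sub (show 1 ≤ n - k by omega), Nat.cast_sub (show k ≤ n by omega),
        Nat.cast_sub hk] at this
      exact this
    rw [sum_congr rfl hA, sum_const, nsmul_eq_mul] at h'
    rw [pairDensity, div_mul_eq_mul_div, eq_div_iff (by nlinarith)]
    rw [← hM] at h' ⊢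
    linear_combination 2 * h'
  have hB1 : B = (2 - pairDensity n k) / (n - 2) * N := by
    have h : ∑ z, (weight q k z : ℝ) = n * N := by
      rw [hN]
      exact_mod_cast sum_weight (by omega) q k
    rw [hE0 _ (fun z hz => by rw [weight_eq_zero_of_isDiag (by omega) q k hz, Nat.cast_zero]),
      sum_congr rfl hA, sum_congr rfl hB, sum_const, sum_const, nsmul_eq_mul, nsmul_eq_mul,
      hA1] at h
    rw [div_mul_eq_mul_div, eq_div_iff (by linarith)]
    refine mul_left_cancel₀ (show (n : ℝ) ≠ 0 by linarith) ?_
    linear_combination 2 * h - B * hD - pairDensity n k * N * hM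
  rw [hE0 _ (fun z hz => by rw [hc z hz, zero_mul]), hE0 c hc,
    sum_congr (s₁ := pairs q) rfl (g := fun z => c z * A) (fun z hz => by rw [hA z hz]),
    sum_congr (s₁ := E \ pairs q) rfl (g := fun z => c z * B) (fun z hz => by rw [hB z hz]),
    ← sum_mul, ← sum_mul, hA1, hB1]
  ring

lemma cycleVec_apply {n : ℕ} (σ : Equiv.Perm (Fin n)) (e : EdgeIdx n) :
    cycleVec n σ e = if CycleContains σ e then 1 else 0 :=
  if_congr Iff.rfl rfl rfl

lemma cycleVec_eq_iff {n : ℕ} {σ σ' : Equiv.Perm (Fin n)} :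
    cycleVec n σ = cycleVec n σ' ↔
      ∀ z : Sym2 (Fin n), ¬ z.IsDiag → (CycleContains σ z ↔ CycleContains σ' z) := by
  rw [funext_iff]
  constructor
  · intro h z hz
    have := h ⟨z, hz⟩
    rw [cycleVec_apply, cycleVec_apply] at this
    by_cases h1 : CycleContains σ z <;> by_cases h2 : CycleContains σ' z <;> simp_all
  · intro h e
    rw [cycleVec_apply, cycleVec_apply]
    simp only [h e.1 e.2]

lemma cycleVec_mul_left {n : ℕ} (π : Equiv.Perm (Fin n)) {σ σ' : Equiv.Perm (Fin n)}
    (h : cycleVec n σ = cycleVec n σ') : cycleVec n (π * σ) = cycleVec n (π * σ') := by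
  rw [cycleVec_eq_iff] at h ⊢
  intro z hz
  obtain ⟨z, rfl⟩ : ∃ z', z = Sym2.map π z' :=
    ⟨z.map π.symm, by rw [Sym2.map_map]; simp⟩
  rw [cycleContains_mul_left, cycleContains_mul_left]
  refine h z fun hd => hz ?_
  induction z with | _ u v
  rw [Sym2.mk_isDiag_iff] at hd
  rw [hd, Sym2.map_mk]
  exact Sym2.mk_isDiag_iff.2 rfl

/-- All Hamiltonian cycles come from the same number of permutations. -/
lemma sum_cycleVec_eq (n : ℕ) : ∃ r : ℝ, 0 < r ∧ ∀ g : (EdgeIdx n → ℝ) → ℝ,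
    ∑ σ, g (cycleVec n σ) = r * ∑ x ∈ hamX n, g x := by
  refine ⟨#(univ.filter fun σ => cycleVec n σ = cycleVec n 1), ?_, fun g => ?_⟩
  · exact_mod_cast card_pos.2 ⟨1, by simp⟩
  rw [← sum_fiberwise_of_maps_to (t := hamX n) (g := cycleVec n)
    (fun σ _ => mem_image_of_mem _ (mem_univ _)), mul_sum]
  refine sum_congr rfl fun x hx => ?_
  obtain ⟨τ, -, rfl⟩ := mem_image.1 hx
  rw [sum_congr rfl (g := fun _ => g (cycleVec n τ))
    (fun σ hσ => by rw [(mem_filter.1 hσ).2]), sum_const, nsmul_eq_mul]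
  congr 2
  symm
  refine card_bij (fun σ _ => τ * σ) ?_ (fun σ _ σ' _ h => mul_left_cancel h) ?_
  · intro σ hσ
    simp only [mem_filter, mem_univ, true_and] at hσ ⊢
    simpa using cycleVec_mul_left τ hσ
  · intro σ hσ
    simp only [mem_filter, mem_univ, true_and] at hσ
    refine ⟨τ⁻¹ * σ, ?_, mul_inv_cancel_left _ _⟩
    simp only [mem_filter, mem_univ, true_and]
    simpa using cycleVec_mul_left τ⁻¹ hσ

/-- The coefficients of a linear function on `ℝ^{n(n-1)/2}`, extended by `0` to loops. -/
def edgeCoeff {n : ℕ} (F : (EdgeIdx n → ℝ) →ₗ[ℝ] ℝ) (z : Sym2 (Fin n)) : ℝ :=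
  if h : ¬ z.IsDiag then F (Pi.single ⟨z, h⟩ 1) else 0

lemma map_cycleVec {n : ℕ} (F : (EdgeIdx n → ℝ) →ₗ[ℝ] ℝ) (σ : Equiv.Perm (Fin n)) :
    F (cycleVec n σ) = ∑ z ∈ univ.filter (CycleContains σ), edgeCoeff F z := by
  rw [LinearMap.pi_apply_eq_sum_univ, sum_filter]
  have h1 : ∀ e : EdgeIdx n, (cycleVec n σ e • F fun j => if e = j then 1 else 0) =
      (fun z => if CycleContains σ z then edgeCoeff F z else 0) (e : Sym2 (Fin n)) := by
    intro e
    have h2 : (fun j => if e = j then (1 : ℝ) else 0) = Pi.single e 1 := by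
      ext j
      simp [Pi.single_apply, eq_comm]
    simp only [h2, cycleVec_apply, edgeCoeff, e.2, smul_eq_mul]
    by_cases h : CycleContains σ e <;> simp [h]
  rw [sum_congr rfl (fun e _ => h1 e),
    ← sum_subtype (univ.filter fun z : Sym2 (Fin n) => ¬ z.IsDiag) (by simp)
      (fun z => if CycleContains σ z then edgeCoeff F z else 0)]
  refine sum_subset (subset_univ _) fun z _ hz => ?_
  have hz : z.IsDiag := by simpa using hz
  simp [edgeCoeff, hz]

lemma memP.sum_eq_factorial {n k : ℕ} {F : (EdgeIdx n → ℝ) →ₗ[ℝ] ℝ} (hF : memP n k F) :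
    ∑ σ, F (cycleVec n σ) = n.factorial := by
  obtain ⟨r, hr, h⟩ := sum_cycleVec_eq n
  have h1 := h fun _ => 1
  simp only [sum_const, card_univ, Fintype.card_perm, Fintype.card_fin, nsmul_eq_mul,
    mul_one] at h1
  rw [h F, h1]
  have h2 := hF.1
  have hne : ((hamX n).card : ℝ) ≠ 0 := by
    intro h0
    rw [h0, inv_zero, zero_mul] at h2
    exact zero_ne_one h2
  field_simp at h2
  rw [h2]

lemma memP.sum_containing_nonneg {n k : ℕ} {F : (EdgeIdx n → ℝ) →ₗ[ℝ] ℝ} (hF : memP n k F)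
    {S : Finset (Sym2 (Fin n))} (hS : ∀ z ∈ S, ¬ z.IsDiag) (hk : #S ≤ k) :
    0 ≤ ∑ σ ∈ containing S, F (cycleVec n σ) := by
  obtain ⟨r, hr, h⟩ := sum_cycleVec_eq n
  set S' : Finset (EdgeIdx n) := S.subtype fun z => ¬ z.IsDiag with hS'
  have h1 := hF.2 (∏ e ∈ S', MvPolynomial.X e) (by
    refine (MvPolynomial.totalDegree_finsetProd _ _).trans ?_
    simp only [MvPolynomial.totalDegree_X, sum_const, smul_eq_mul, mul_one]
    exact (card_subtype _ _).le.trans ((card_filter_le _ _).trans hk))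
  have hne : 0 < ((hamX n).card : ℝ)⁻¹ := by
    have : (hamX n).Nonempty := ⟨cycleVec n 1, mem_image_of_mem _ (mem_univ _)⟩
    have := card_pos.2 this
    positivity
  have h2 := nonneg_of_mul_nonneg_right h1 hne
  have h3 := h fun x => F x * (MvPolynomial.eval x (∏ e ∈ S', MvPolynomial.X e)) ^ 2
  have h4 : ∀ σ, F (cycleVec n σ) *
      (MvPolynomial.eval (cycleVec n σ) (∏ e ∈ S', MvPolynomial.X e)) ^ 2 =
      if ∀ z ∈ S, CycleContains σ z then F (cycleVec n σ) else 0 := by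
    intro σ
    simp only [map_prod, MvPolynomial.eval_X, cycleVec_apply]
    have h5 : (∀ z ∈ S, CycleContains σ z) ↔ ∀ e ∈ S', CycleContains σ e := by
      constructor
      · intro h e he
        exact h _ (mem_subtype.1 he)
      · intro h z hz
        exact h ⟨z, hS z hz⟩ (mem_subtype.2 hz)
    by_cases hall : ∀ e ∈ S', CycleContains σ e
    · rw [if_pos (h5.2 hall), prod_congr rfl (fun e he => if_pos (hall e he))]
      simp
    · rw [if_neg (fun h => hall (h5.1 h))]
      push Not at hall
      obtain ⟨e, he, hne⟩ := hall
      rw [prod_eq_zero he (if_neg hne)]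
      simp
  rw [containing, sum_filter, ← sum_congr rfl (fun σ _ => h4 σ), h3]
  exact mul_nonneg hr.le h2

lemma sum_sum_containing {n : ℕ} (F : (EdgeIdx n → ℝ) →ₗ[ℝ] ℝ) (q : Fin n → Fin n) (k : ℕ) :
    ∑ S ∈ powersetCard k (pairs q), ∑ σ ∈ containing S, F (cycleVec n σ) =
      ∑ z, edgeCoeff F z * weight q k z := by
  simp only [weight, Nat.cast_sum, mul_sum, map_cycleVec, sum_filter]
  rw [sum_comm (s := univ)]
  refine sum_congr rfl fun S _ => ?_
  rw [sum_comm]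
  refine sum_congr rfl fun z _ => ?_
  rw [← sum_filter, sum_const, nsmul_eq_mul, mul_comm]

lemma edgeCoeff_of_isDiag {n : ℕ} (F : (EdgeIdx n → ℝ) →ₗ[ℝ] ℝ) {z : Sym2 (Fin n)}
    (hz : z.IsDiag) : edgeCoeff F z = 0 := by
  simp [edgeCoeff, hz]

lemma memP.sum_edgeCoeff {n k : ℕ} (hn : 4 ≤ n) {F : (EdgeIdx n → ℝ) →ₗ[ℝ] ℝ}
    (hF : memP n k F) {q : Fin n → Fin n} (hq : Function.Involutive q) (hfix : ∀ v, q v ≠ v) :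
    ∑ z, edgeCoeff F z = ((n : ℝ) - 1) / 2 := by
  have h := sum_mul_weight hn hq hfix (k := 0) (by omega) (edgeCoeff F)
    fun z => edgeCoeff_of_isDiag F
  have hcont : containing (∅ : Finset (Sym2 (Fin n))) = univ := by simp [containing]
  rw [← sum_sum_containing, powersetCard_zero, sum_singleton, hcont, hF.sum_eq_factorial,
    totalWeight, powersetCard_zero, sum_singleton, hcont, card_univ, Fintype.card_perm,
    Fintype.card_fin] at h
  have hn' : (4 : ℝ) ≤ n := by exact_mod_cast hn
  have hfac : (n.factorial : ℝ) ≠ 0 := by exact_mod_cast n.factorial_ne_zero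
  have ha : pairDensity n 0 = 2 / (n - 1) := by
    have : (n : ℝ) - 1 ≠ 0 := by linarith
    rw [pairDensity]
    simp
    field_simp
  have hb : (2 - pairDensity n 0) / (n - 2) = 2 / ((n : ℝ) - 1) := by
    have h1 : (n : ℝ) - 1 ≠ 0 := by linarith
    have h2 : (n : ℝ) - 2 ≠ 0 := by linarith
    rw [ha]
    field_simp
    ring
  rw [hb, ha, ← mul_add, add_sub_cancel] at h
  have h3 := mul_left_cancel₀ hfac ((mul_one _).trans h)
  have h1 : (n : ℝ) - 1 ≠ 0 := by linarith
  field_simp at h3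
  linarith

/-- The inequality obtained from a matching contained in a Hamiltonian cycle. -/
lemma memP.pairs_inequality {n k : ℕ} (hn : 4 ≤ n) (hk : 2 * k ≤ n)
    {F : (EdgeIdx n → ℝ) →ₗ[ℝ] ℝ} (hF : memP n k F) {q : Fin n → Fin n}
    (hq : Function.Involutive q) (hfix : ∀ v, q v ≠ v) {τ : Equiv.Perm (Fin n)}
    (hτ : ∀ v, CycleContains τ s(v, q v)) :
    0 ≤ pairDensity n k * ∑ z ∈ pairs q, edgeCoeff F z +
      (2 - pairDensity n k) / (n - 2) *
        (((n : ℝ) - 1) / 2 - ∑ z ∈ pairs q, edgeCoeff F z) := by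
  have h := sum_mul_weight hn hq hfix hk (edgeCoeff F) fun z => edgeCoeff_of_isDiag F
  rw [← sum_sum_containing, hF.sum_edgeCoeff hn hq hfix] at h
  have hpos : 0 < totalWeight q k := by
    obtain ⟨S, hS⟩ : (powersetCard k (pairs q)).Nonempty := by
      rw [powersetCard_nonempty]
      have := two_mul_card_pairs hq hfix
      omega
    refine sum_pos' (fun _ _ => Nat.zero_le _) ⟨S, hS, card_pos.2 ⟨τ, ?_⟩⟩
    simp only [containing, mem_filter, mem_univ, true_and]
    intro z hz
    obtain ⟨v, -, rfl⟩ := mem_image.1 ((mem_powersetCard.1 hS).1 hz)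
    exact hτ v
  refine nonneg_of_mul_nonneg_right (h ▸ sum_nonneg fun S hS => ?_) (Nat.cast_pos.2 hpos)
  obtain ⟨hS, hSk⟩ := mem_powersetCard.1 hS
  refine hF.sum_containing_nonneg (fun z hz => ?_) hSk.le
  obtain ⟨v, -, rfl⟩ := mem_image.1 (hS hz)
  exact (hτ v).not_isDiag (by omega)

/-- Match each position `i` with `P i` to the next one, and every other one to the previous. -/
def alternate {n : ℕ} (P : Fin n → Prop) (τ : Equiv.Perm (Fin n)) (v : Fin n) : Fin n :=
  τ (if P (τ.symm v) then finRotate n (τ.symm v) else (finRotate n).symm (τ.symm v))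

lemma alternate_apply {n : ℕ} (P : Fin n → Prop) (τ : Equiv.Perm (Fin n)) (i : Fin n) :
    alternate P τ (τ i) = τ (if P i then finRotate n i else (finRotate n).symm i) := by
  rw [alternate, Equiv.symm_apply_apply]

lemma alternate_involutive {n : ℕ} {P : Fin n → Prop}
    (hP : ∀ i, P (finRotate n i) ↔ ¬ P i) (τ : Equiv.Perm (Fin n)) :
    Function.Involutive (alternate P τ) := by
  intro v
  obtain ⟨i, rfl⟩ := τ.surjective v
  rw [alternate_apply, alternate_apply]
  congr 1
  by_cases h : P i
  · rw [if_pos h, if_neg (by simpa only [hP, not_not] using h), Equiv.symm_apply_apply]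
  · have := hP ((finRotate n).symm i)
    rw [Equiv.apply_symm_apply] at this
    simp only [if_neg h]
    rw [if_pos (by tauto), Equiv.apply_symm_apply]

lemma alternate_ne {n : ℕ} (hn : 2 ≤ n) (P : Fin n → Prop) (τ : Equiv.Perm (Fin n))
    (v : Fin n) : alternate P τ v ≠ v := by
  obtain ⟨i, rfl⟩ := τ.surjective v
  rw [alternate_apply, τ.injective.ne_iff]
  split_ifs
  · exact finRotate_ne_self hn i
  · rw [Ne, Equiv.symm_apply_eq]
    exact (finRotate_ne_self hn i).symm

lemma cycleContains_alternate {n : ℕ} (P : Fin n → Prop) (τ : Equiv.Perm (Fin n))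
    (v : Fin n) : CycleContains τ s(v, alternate P τ v) := by
  obtain ⟨i, rfl⟩ := τ.surjective v
  rw [alternate_apply]
  split_ifs
  · exact ⟨i, rfl⟩
  · exact ⟨(finRotate n).symm i, by rw [Equiv.apply_symm_apply, Sym2.eq_swap]⟩

lemma two_mul_sum_pairs_alternate {n : ℕ} (hn : 2 ≤ n) {P : Fin n → Prop}
    (hP : ∀ i, P (finRotate n i) ↔ ¬ P i) (τ : Equiv.Perm (Fin n)) (c : Sym2 (Fin n) → ℝ) :
    2 * ∑ z ∈ pairs (alternate P τ), c z =
      ∑ i, c s(τ i, τ (if P i then finRotate n i else (finRotate n).symm i)) := by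
  have hq := alternate_involutive hP τ
  have h := sum_filter_pairs hq (alternate_ne hn P τ) subset_rfl c
  rw [filter_true_of_mem (fun v _ => (mem_pairs_mk hq).2 rfl), nsmul_eq_mul,
    Nat.cast_ofNat] at h
  rw [← h, ← Equiv.sum_comp τ]
  simp only [alternate_apply]

lemma sum_pairs_alternate_add {n : ℕ} (hn : 3 ≤ n) {P : Fin n → Prop}
    (hP : ∀ i, P (finRotate n i) ↔ ¬ P i) (τ : Equiv.Perm (Fin n)) (c : Sym2 (Fin n) → ℝ) :
    ∑ z ∈ pairs (alternate P τ), c z + ∑ z ∈ pairs (alternate (fun i => ¬ P i) τ), c z =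
      ∑ z ∈ univ.filter (CycleContains τ), c z := by
  have h1 := two_mul_sum_pairs_alternate (by omega) hP τ c
  have h2 := two_mul_sum_pairs_alternate (P := fun i => ¬ P i) (by omega)
    (fun i => by rw [hP]) τ c
  rw [filter_cycleContains, sum_image (cycle_edge_injective hn τ).injOn]
  have h3 : ∑ i, c s(τ i, τ ((finRotate n).symm i)) = ∑ i, c s(τ i, τ (finRotate n i)) := by
    rw [← Equiv.sum_comp (finRotate n)]
    refine sum_congr rfl fun i _ => ?_
    rw [Equiv.symm_apply_apply, Sym2.eq_swap]
  have h4 : 2 * ∑ z ∈ pairs (alternate P τ), c z +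
      2 * ∑ z ∈ pairs (alternate (fun i => ¬ P i) τ), c z =
      ∑ i, c s(τ i, τ (finRotate n i)) + ∑ i, c s(τ i, τ ((finRotate n).symm i)) := by
    rw [h1, h2, ← sum_add_distrib, ← sum_add_distrib]
    refine sum_congr rfl fun i _ => ?_
    by_cases h : P i
    · simp [h]
    · simp [h, add_comm]
  linarith

lemma even_finRotate_iff {n : ℕ} (heven : Even n) (i : Fin n) :
    Even (finRotate n i).val ↔ ¬ Even i.val := by
  rw [val_finRotate]
  split_ifs with h
  · have : Even (i.val + 1) := by rwa [h]
    rw [Nat.even_add_one] at this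
    simpa using this
  · exact Nat.even_add_one

/-- **Proposition, even case.** Let `n ≥ 9` be even, `1 ≤ k ≤ n/2`,
`f ∈ P_k` and `y ∈ X`.  Then
`f(y) ≥ -n/k + 1 - n(k-1)/(k(n² - kn - 3n + k + 3))`. -/
theorem lower_bound_on_Pk_even
    (n k : ℕ) (hn : 9 ≤ n) (heven : Even n) (hk1 : 1 ≤ k) (hk2 : k ≤ n / 2)
    (F : (EdgeIdx n → ℝ) →ₗ[ℝ] ℝ) (hF : memP n k F)
    (y : EdgeIdx n → ℝ) (hy : y ∈ hamX n) :
    -(n : ℝ) / k + 1 -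
        (n : ℝ) * ((k : ℝ) - 1) /
          ((k : ℝ) * ((n : ℝ) ^ 2 - (k : ℝ) * n - 3 * n + k + 3)) ≤ F y := by
  obtain ⟨τ, -, rfl⟩ := mem_image.1 hy
  have hk : 2 * k ≤ n := by omega
  have hP := even_finRotate_iff heven
  have hP' : ∀ i : Fin n, ¬ Even (finRotate n i).val ↔ ¬ ¬ Even i.val := fun i => by rw [hP]
  have h1 := hF.pairs_inequality (by omega) hk (alternate_involutive (P := fun i => Even i.val) hP τ)
    (alternate_ne (by omega) _ τ) (cycleContains_alternate _ τ)
  have h2 := hF.pairs_inequality (by omega) hk (alternate_involutive (P := fun i => ¬ Even i.val) hP' τ)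
    (alternate_ne (by omega) _ τ) (cycleContains_alternate _ τ)
  have h3 := sum_pairs_alternate_add (P := fun i => Even i.val) (by omega) hP τ (edgeCoeff F)
  rw [← map_cycleVec] at h3
  have hnR : (9 : ℝ) ≤ n := by exact_mod_cast hn
  have hkR : (2 : ℝ) * k ≤ n := by exact_mod_cast hk
  have hk1R : (1 : ℝ) ≤ k := by exact_mod_cast hk1
  have hsum : 0 ≤ (pairDensity n k - (2 - pairDensity n k) / (n - 2)) * F (cycleVec n τ) +
      (2 - pairDensity n k) / (n - 2) * (n - 1) := by
    rw [← h3]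
    linarith
  generalize F (cycleVec n τ) = y at hsum
  have hn0 : (0 : ℝ) < n := by linarith
  have hk0 : (0 : ℝ) < k := by linarith
  have hn2 : (0 : ℝ) < n - 2 := by linarith
  have hd : (0 : ℝ) < n - k - 1 := by linarith
  have hD : (0 : ℝ) < (n : ℝ) ^ 2 - k * n - 3 * n + k + 3 := by nlinarith
  obtain ⟨D, hDdef⟩ : ∃ D : ℝ, D = (n : ℝ) ^ 2 - k * n - 3 * n + k + 3 := ⟨_, rfl⟩
  rw [← hDdef] at hD ⊢
  have ha : pairDensity n k - (2 - pairDensity n k) / (n - 2) =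
      2 * k * D / (n * (n - k - 1) * (n - 2)) := by
    rw [pairDensity]
    field_simp
    rw [hDdef]
    ring
  have hb : (2 - pairDensity n k) / (n - 2) * (n - 1) =
      2 * k * D / (n * (n - k - 1) * (n - 2)) *
        ((n : ℝ) / k - 1 + n * (k - 1) / (k * D)) := by
    rw [pairDensity]
    field_simp
    rw [hDdef]
    ring
  rw [ha, hb, ← mul_add] at hsum
  have := nonneg_of_mul_nonneg_right hsum (by positivity)
  rw [neg_div]
  linarith
end
end
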